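/- arXiv:math/0411124 — 3 statements merged into one kernel-verified Lean document; each statement's English description precedes it below -/
import Mathlib

section
/- Let B be a commutative Noetherian ring of Krull dimension 2 and let I be an ideal of B such that dim(B/I) ≤ 1. Let P be a finitely generated projective B-module of constant rank 2 such that P/IP is free. Then any element of SL₂(B/I) ∩ ESp₄(B/I) can be lifted to an element of SL(P), the group of automorphisms of P of determinant 1. -/
/-- An element `m` of an `R`-module `M` is *unimodular* if some linear functional maps it to `1`. -/
def IsUnimodular (R : Type*) {M : Type*} [CommRing R] [AddCommGroup M] [Module R M]
    (m : M) : Prop :=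
  ∃ ψ : M →ₗ[R] R, ψ m = 1

/-- The (finite) rank of the `R`-module `M` at a prime `𝔭` of `R`. -/
noncomputable def rankAt (R M : Type*) [CommRing R] [AddCommGroup M] [Module R M]
    (𝔭 : PrimeSpectrum R) : ℕ :=
  Module.finrank (Localization.AtPrime 𝔭.asIdeal) (LocalizedModule 𝔭.asIdeal.primeCompl M)

/-- The `4 × 4` block-diagonal matrix with the two given `2 × 2` blocks. -/
def blockDiag4 {C : Type*} [CommRing C] (M₁ M₂ : Matrix (Fin 2) (Fin 2) C) :
    Matrix (Fin 4) (Fin 4) C :=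
  Matrix.reindex finSumFinEquiv finSumFinEquiv (Matrix.fromBlocks M₁ 0 0 M₂)

/-- The standard symplectic form on `C⁴ = C² ⊥ C²`, where on each `C²` factor the form is
`⟨(a,b),(c,d)⟩ = ad - bc`. -/
def stdSymplForm (C : Type*) [CommRing C] (u v : Fin 4 → C) : C :=
  dotProduct u
    ((blockDiag4 !![(0 : C), 1; -1, 0] !![(0 : C), 1; -1, 0]).mulVec v)

/-- A symplectic transvection `τ_(a,u,v)` of `(C⁴, stdSymplForm)`:
`w ↦ w + ⟨w,v⟩u + ⟨w,u⟩v + a⟨w,u⟩u`, where `⟨u,v⟩ = 0` and `u` or `v` is unimodular. -/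
def IsSymplecticTransvection {C : Type*} [CommRing C]
    (τ : Module.End C (Fin 4 → C)) : Prop :=
  ∃ (a : C) (u v : Fin 4 → C), stdSymplForm C u v = 0 ∧
    (IsUnimodular C u ∨ IsUnimodular C v) ∧
    ∀ w : Fin 4 → C,
      τ w = w + stdSymplForm C w v • u + stdSymplForm C w u • v +
        (a * stdSymplForm C w u) • u

/-- `ESp₄(C)`: the subgroup (here: submonoid, the generating set being closed under inverses)
of the isometry group generated by symplectic transvections. -/
def ESp4 (C : Type*) [CommRing C] : Submonoid (Module.End C (Fin 4 → C)) :=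
  Submonoid.closure {τ : Module.End C (Fin 4 → C) | IsSymplecticTransvection τ}


structure SympData (B P L : Type*) [CommRing B] [AddCommGroup P] [Module B P]
    [AddCommGroup L] [Module B L]
    (om : P →ₗ[B] P →ₗ[B] L) (z : Module.Dual B P → L →ₗ[B] P) : Prop where
  alt : ∀ a, om a a = 0
  contr : ∀ (ψ : Module.Dual B P) (x : P) (l : L), om x (z ψ l) = ψ x • l
  zz : ∀ (ψ : Module.Dual B P) (l : L), ψ (z ψ l) = 0
  symL : ∀ (f : Module.Dual B L) (l l' : L), f l • l' = f l' • l
  loc : ∀ 𝔭 : Ideal B, 𝔭.IsPrime → ∃ (f : Module.Dual B L) (a b : P), f (om a b) ∉ 𝔭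

section avoid
variable {B : Type*} [CommRing B]

theorem avoid {N : Type*} [AddCommGroup N] [Module B N]
    (F : Ideal B → Submodule B N) (G : Submodule B N) (x : N) (t : B) (s : Finset (Ideal B)) :
    (∀ 𝔭 ∈ s, 𝔭.IsPrime ∧ t ∉ 𝔭 ∧ (∀ r ∈ 𝔭, ∀ y, r • y ∈ F 𝔭) ∧
      (∀ r ∉ 𝔭, ∀ y, r • y ∈ F 𝔭 → y ∈ F 𝔭) ∧ (x ∈ F 𝔭 → ∃ m ∈ G, m ∉ F 𝔭)) →
    ∃ c ∈ G, ∀ 𝔭 ∈ s, x + t • c ∉ F 𝔭 := by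
  induction s using Finset.strongInduction with
  | H s ih =>
    intro hs
    rcases s.eq_empty_or_nonempty with rfl | hne
    · exact ⟨0, G.zero_mem, by simp⟩
    obtain ⟨𝔭, hp, hmin⟩ := s.exists_minimal hne
    obtain ⟨c, hc, hcs⟩ := ih (s.erase 𝔭) (Finset.erase_ssubset hp)
      (fun q hq => hs q (Finset.mem_of_mem_erase hq))
    obtain ⟨hpp, htp, h1, h2, h3⟩ := hs 𝔭 hp
    by_cases hx : x + t • c ∈ F 𝔭
    · obtain ⟨m, hm, hmF⟩ : ∃ m ∈ G, m ∉ F 𝔭 := by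
        by_cases hcF : c ∈ F 𝔭
        · exact h3 (by simpa using (F 𝔭).sub_mem hx ((F 𝔭).smul_mem t hcF))
        · exact ⟨c, hc, hcF⟩
      obtain ⟨r, hr, hrp⟩ : ∃ r, (∀ q ∈ s.erase 𝔭, r ∈ q) ∧ r ∉ 𝔭 := by
        by_contra hcon
        push Not at hcon
        have : (s.erase 𝔭).inf id ≤ 𝔭 := fun r hr => hcon r (by
          intro q hq
          exact (Finset.inf_le hq : (s.erase 𝔭).inf id ≤ id q) hr)
        obtain ⟨q, hq, hqp⟩ := (hpp.inf_le').1 this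
        have hqs := Finset.mem_of_mem_erase hq
        have := hmin hqs hqp
        exact (Finset.ne_of_mem_erase hq) (le_antisymm hqp this)
      refine ⟨c + r • m, G.add_mem hc (G.smul_mem r hm), fun q hq => ?_⟩
      have e : x + t • (c + r • m) = (x + t • c) + r • (t • m) := by
        rw [smul_add, ← add_assoc, smul_comm]
      rw [e]
      by_cases hqp : q = 𝔭
      · subst hqp
        intro h
        exact hmF (h2 t htp _ (h2 r hrp _ ((Submodule.add_mem_iff_right _ hx).1 h)))
      · have hq' : q ∈ s.erase 𝔭 := Finset.mem_erase.2 ⟨hqp, hq⟩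
        intro h
        exact hcs q hq' ((Submodule.add_mem_iff_left _ ((hs q hq).2.2.1 r (hr q hq') _)).1 h)
    · refine ⟨c, hc, fun q hq => ?_⟩
      by_cases hqp : q = 𝔭
      · subst hqp; exact hx
      · exact hcs q (Finset.mem_erase.2 ⟨hqp, hq⟩)

/-- elements of `N` vanishing at `𝔭` -/
def vanish (N : Type*) [AddCommGroup N] [Module B N] (𝔭 : Ideal B) : Submodule B N where
  carrier := {y | ∀ f : Module.Dual B N, f y ∈ 𝔭}
  add_mem' := fun ha hb f => by rw [map_add]; exact 𝔭.add_mem (ha f) (hb f)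
  zero_mem' := fun f => by simp
  smul_mem' := fun c x hx f => by rw [map_smul]; exact 𝔭.mul_mem_left c (hx f)

theorem mem_vanish {N : Type*} [AddCommGroup N] [Module B N] {𝔭 : Ideal B} {y : N} :
    y ∈ vanish N 𝔭 ↔ ∀ f : Module.Dual B N, f y ∈ 𝔭 := Iff.rfl

/-- order ideal -/
def ordI {N : Type*} [AddCommGroup N] [Module B N] (y : N) : Ideal B :=
  LinearMap.range (Module.Dual.eval B N y)

theorem mem_ordI {N : Type*} [AddCommGroup N] [Module B N] {y : N} {r : B} :
    r ∈ ordI y ↔ ∃ f : Module.Dual B N, f y = r := Iff.rfl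

theorem ordI_le {N : Type*} [AddCommGroup N] [Module B N] {y : N} {𝔭 : Ideal B} :
    ordI y ≤ 𝔭 ↔ y ∈ vanish N 𝔭 := by
  constructor
  · intro h f; exact h ⟨f, rfl⟩
  · rintro h _ ⟨f, rfl⟩; exact h f

theorem vanish_smul {N : Type*} [AddCommGroup N] [Module B N] {𝔭 : Ideal B} {r : B}
    (hr : r ∈ 𝔭) (y : N) : r • y ∈ vanish N 𝔭 := fun f => by
  rw [map_smul]; exact 𝔭.mul_mem_right _ hr

theorem vanish_sat {N : Type*} [AddCommGroup N] [Module B N] {𝔭 : Ideal B} (hp : 𝔭.IsPrime)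
    {r : B} (hr : r ∉ 𝔭) (y : N) (h : r • y ∈ vanish N 𝔭) : y ∈ vanish N 𝔭 := fun f => by
  have := h f
  rw [map_smul] at this
  exact (hp.mem_or_mem this).resolve_left hr

theorem no_chain (hdim : ringKrullDim B ≤ 2) {a b c d : Ideal B} (ha : a.IsPrime) (hb : b.IsPrime)
    (hc : c.IsPrime) (hd : d.IsPrime) (hab : a < b) (hbc : b < c) (hcd : c ≤ d) : c = d := by
  by_contra hne
  have hcd : c < d := lt_of_le_of_ne hcd hne
  have hab' : (⟨a, ha⟩ : PrimeSpectrum B) < ⟨b, hb⟩ := hab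
  have hbc' : (⟨b, hb⟩ : PrimeSpectrum B) < ⟨c, hc⟩ := hbc
  have hcd' : (⟨c, hc⟩ : PrimeSpectrum B) < ⟨d, hd⟩ := hcd
  let S : LTSeries (PrimeSpectrum B) :=
    (((RelSeries.singleton _ (⟨a, ha⟩ : PrimeSpectrum B)).snoc ⟨b, hb⟩ (by simpa using hab')).snoc
      ⟨c, hc⟩ (by simpa using hbc')).snoc ⟨d, hd⟩ (by simpa using hcd')
  have h1 : (S.length : WithBot ℕ∞) ≤ ringKrullDim B := Order.LTSeries.length_le_krullDim S
  have h2 : S.length = 3 := rfl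
  rw [h2] at h1
  have := h1.trans hdim
  have h3 : ((3:ℕ) : WithBot ℕ∞) ≤ ((2:ℕ) : WithBot ℕ∞) := by exact_mod_cast this
  norm_cast at h3

end avoid

section skew
variable {B P L : Type*} [CommRing B] [AddCommGroup P] [Module B P]
    [AddCommGroup L] [Module B L]
    {om : P →ₗ[B] P →ₗ[B] L} {z : Module.Dual B P → L →ₗ[B] P}

theorem SympData.skew (D : SympData B P L om z) (a b : P) : om a b = - om b a := by
  have := D.alt (a + b)
  simp only [map_add, LinearMap.add_apply, D.alt, zero_add, add_zero] at this
  exact eq_neg_of_add_eq_zero_right this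

end skew

section stable
variable {B P L : Type*} [CommRing B] [IsNoetherianRing B] [AddCommGroup P] [Module B P]
    [AddCommGroup L] [Module B L]
    {om : P →ₗ[B] P →ₗ[B] L} {z : Module.Dual B P → L →ₗ[B] P}

/-- the elements `g` with `om p g` vanishing at `𝔭` -/
def vanish2 (om : P →ₗ[B] P →ₗ[B] L) (p : P) (𝔭 : Ideal B) : Submodule B P :=
  (vanish L 𝔭).comap (om p)

theorem stable (D : SympData B P L om z) (hdim : ringKrullDim B ≤ 2)
    {K : Type*} [AddCommGroup K] [Module B K]
    (hK : ∀ 𝔭 : Ideal B, 𝔭.IsPrime → ∃ (f : Module.Dual B K) (l : K), f l ∉ 𝔭)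
    (p : P) (k : K) (t : B) (h : ordI p ⊔ ordI k ⊔ Ideal.span {t} = (⊤ : Ideal B)) :
    ∃ (q : P) (c : K), ordI (p + t • q) ⊔ ordI (k + t • c) = (⊤ : Ideal B) := by
  classical
  have fin : ∀ J : Ideal B, J.minimalPrimes.Finite := fun J => Ideal.finite_minimalPrimes_of_isNoetherianRing B J
  let ms : Ideal B → Finset (Ideal B) := fun J => (fin J).toFinset.filter (fun q => t ∉ q)
  have hms : ∀ J q, q ∈ ms J ↔ q ∈ J.minimalPrimes ∧ t ∉ q := fun J q => by simp [ms]
  have below : ∀ (J q : Ideal B), q.IsPrime → J ≤ q → t ∉ q → ∃ r ∈ ms J, r ≤ q := by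
    intro J q hq hJ ht
    obtain ⟨r, hr, hrq⟩ := Ideal.exists_minimalPrimes_le hJ
    exact ⟨r, (hms _ _).2 ⟨hr, fun h => ht (hrq h)⟩, hrq⟩
  have prime : ∀ (J q : Ideal B), q ∈ ms J → q.IsPrime := fun J q hq => ((hms _ _).1 hq).1.1.1
  have le : ∀ (J q : Ideal B), q ∈ ms J → J ≤ q := fun J q hq => ((hms _ _).1 hq).1.1.2
  have tn : ∀ (J q : Ideal B), q ∈ ms J → t ∉ q := fun J q hq => ((hms _ _).1 hq).2
  -- step 1
  obtain ⟨c, -, hc⟩ := avoid (vanish K) ⊤ k t (ms ⊥) (by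
    intro 𝔭 hp
    refine ⟨prime _ _ hp, tn _ _ hp, fun r hr y => vanish_smul hr y,
      fun r hr y => vanish_sat (prime _ _ hp) hr y, fun _ => ?_⟩
    obtain ⟨f, l, hl⟩ := hK 𝔭 (prime _ _ hp)
    exact ⟨l, trivial, fun h => hl (h f)⟩)
  set k' := k + t • c with hk'
  have P0 : ∀ q : Ideal B, q.IsPrime → t ∉ q → ordI k' ≤ q → ∃ a : Ideal B, a.IsPrime ∧ a < q := by
    intro q hq ht hle
    obtain ⟨r, hr, hrq⟩ := below ⊥ q hq bot_le ht
    refine ⟨r, prime _ _ hr, lt_of_le_of_ne hrq ?_⟩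
    rintro rfl
    exact hc r hr (ordI_le.1 hle)
  have exP : ∀ 𝔭 : Ideal B, 𝔭.IsPrime → ∃ m : P, m ∉ vanish P 𝔭 := by
    intro 𝔭 hp
    obtain ⟨f, a, b, hl⟩ := D.loc 𝔭 hp
    exact ⟨a, fun h => hl (by simpa using h (f ∘ₗ om.flip b))⟩
  -- step 2
  obtain ⟨q, -, hq⟩ := avoid (vanish P) ⊤ p t (ms (ordI k')) (by
    intro 𝔭 hp
    refine ⟨prime _ _ hp, tn _ _ hp, fun r hr y => vanish_smul hr y,
      fun r hr y => vanish_sat (prime _ _ hp) hr y, fun _ => ?_⟩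
    obtain ⟨l, hl⟩ := exP 𝔭 (prime _ _ hp)
    exact ⟨l, trivial, hl⟩)
  set p' := p + t • q with hp'
  have P1 : ∀ q r : Ideal B, q.IsPrime → t ∉ q → ordI k' ≤ q →
      (∀ s ∈ ms (ordI k'), s ≠ q) → r.IsPrime → q ≤ r → q = r := by
    intro q r hq ht hle hne hr hqr
    obtain ⟨s, hs, hsq⟩ := below _ q hq hle ht
    obtain ⟨a, ha, has⟩ := P0 s (prime _ _ hs) (tn _ _ hs) (le _ _ hs)
    exact no_chain hdim ha (prime _ _ hs) hq hr has (lt_of_le_of_ne hsq (hne s hs)) hqr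
  -- step 3
  let F : Ideal B → Submodule B P := fun 𝔭 =>
    if 𝔭 ∈ ms (ordI k') then vanish2 om p' 𝔭 else vanish P 𝔭
  obtain ⟨g, -, hg⟩ := avoid F ⊤ (0 : P) t (ms (ordI k') ∪ ms (ordI k' ⊔ ordI p')) (by
    intro 𝔭 hp
    have hpr : 𝔭.IsPrime ∧ t ∉ 𝔭 := by
      rcases Finset.mem_union.1 hp with hp | hp
      · exact ⟨prime _ _ hp, tn _ _ hp⟩
      · exact ⟨prime _ _ hp, tn _ _ hp⟩
    refine ⟨hpr.1, hpr.2, ?_⟩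
    by_cases hS : 𝔭 ∈ ms (ordI k')
    · simp only [F, if_pos hS, vanish2, Submodule.mem_comap, map_smul]
      refine ⟨fun r hr y => vanish_smul hr _, fun r hr y => vanish_sat hpr.1 hr _, fun _ => ?_⟩
      have := hq 𝔭 hS
      rw [mem_vanish] at this
      push Not at this
      obtain ⟨ψ, hψ⟩ := this
      obtain ⟨f, a, b, hl⟩ := D.loc 𝔭 hpr.1
      refine ⟨z ψ (om a b), trivial, fun h => ?_⟩
      have := h f
      rw [D.contr, map_smul] at this
      exact (hpr.1.mem_or_mem this).elim hψ hl
    · simp only [F, if_neg hS]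
      refine ⟨fun r hr y => vanish_smul hr _, fun r hr y => vanish_sat hpr.1 hr _, fun _ => ?_⟩
      obtain ⟨l, hl⟩ := exP 𝔭 hpr.1
      exact ⟨l, trivial, hl⟩)
  simp only [zero_add] at hg
  set g' := t • g with hg'
  have gS : ∀ 𝔭 ∈ ms (ordI k'), om p' g' ∉ vanish L 𝔭 := by
    intro 𝔭 hp
    have := hg 𝔭 (Finset.mem_union_left _ hp)
    simpa only [F, if_pos hp, vanish2, Submodule.mem_comap] using this
  have T1 : ∀ 𝔭 : Ideal B, 𝔭.IsPrime → t ∉ 𝔭 → ordI k' ≤ 𝔭 → om p' g' ∈ vanish L 𝔭 →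
      ∀ s ∈ ms (ordI k'), s ≠ 𝔭 := by
    rintro 𝔭 hp ht hle hv s hs rfl
    exact gS s hs hv
  have gZ : ∀ 𝔭 : Ideal B, 𝔭.IsPrime → t ∉ 𝔭 → ordI k' ≤ 𝔭 → om p' g' ∈ vanish L 𝔭 →
      p' ∈ vanish P 𝔭 → g' ∉ vanish P 𝔭 := by
    intro 𝔭 hp ht hle hv hv'
    obtain ⟨r, hr, hrp⟩ := below (ordI k' ⊔ ordI p') 𝔭 hp (sup_le hle (ordI_le.2 hv')) ht
    have hrS : ∀ s ∈ ms (ordI k'), s ≠ r := by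
      rintro s hs rfl
      exact hq s hs (ordI_le.1 (le_sup_right.trans (le _ _ hr)))
    have := P1 r 𝔭 (prime _ _ hr) (tn _ _ hr) (le_sup_left.trans (le _ _ hr)) hrS hp hrp
    subst this
    have h1 := hg r (Finset.mem_union_right _ hr)
    rwa [show F r = vanish P r from if_neg (fun h => hrS r h rfl)] at h1
  -- step 4
  obtain ⟨w, hw, hwT⟩ := avoid (vanish P) (B ∙ g') p' t (ms (ordI k' ⊔ ordI (om p' g'))) (by
    intro 𝔭 hp
    refine ⟨prime _ _ hp, tn _ _ hp, fun r hr y => vanish_smul hr y,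
      fun r hr y => vanish_sat (prime _ _ hp) hr y, fun hv => ?_⟩
    have h0 := le _ _ hp
    exact ⟨g', Submodule.mem_span_singleton_self _, gZ 𝔭 (prime _ _ hp) (tn _ _ hp)
      (le_sup_left.trans h0) (ordI_le.1 (le_sup_right.trans h0)) hv⟩)
  obtain ⟨a, rfl⟩ := Submodule.mem_span_singleton.1 hw
  refine ⟨q + a • g', c, ?_⟩
  rw [smul_add, ← add_assoc, ← hp', ← hk']
  by_contra hne
  obtain ⟨m, hm, hle⟩ := Ideal.exists_le_maximal _ hne
  have hmp := hm.isPrime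
  have l1 := ordI_le.1 (le_sup_left.trans hle)
  have l2 := le_sup_right.trans hle
  by_cases ht : t ∈ m
  · apply hm.ne_top
    rw [eq_top_iff, ← h]
    refine sup_le (sup_le (ordI_le.2 ?_) (ordI_le.2 ?_)) ((Ideal.span_singleton_le_iff_mem _).2 ht)
    · rw [hp', add_assoc, ← smul_add] at l1
      exact (Submodule.add_mem_iff_left _ (vanish_smul ht _)).1 l1
    · exact (Submodule.add_mem_iff_left _ (vanish_smul ht _)).1 (ordI_le.1 l2)
  · have hv : om p' g' ∈ vanish L m := by
      intro f
      have h1 := l1 (f ∘ₗ om.flip g')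
      simpa [D.alt] using h1
    obtain ⟨r, hr, hrm⟩ := below (ordI k' ⊔ ordI (om p' g')) m hmp (sup_le l2 (ordI_le.2 hv)) ht
    have h0 := le _ _ hr
    have := P1 r m (prime _ _ hr) (tn _ _ hr) (le_sup_left.trans h0)
      (T1 r (prime _ _ hr) (tn _ _ hr) (le_sup_left.trans h0)
        (ordI_le.1 (le_sup_right.trans h0))) hmp hrm
    subst this
    exact hwT r hr l1
end stable

section sympl
variable {B P L : Type*} [CommRing B] [AddCommGroup P] [Module B P]
    [AddCommGroup L] [Module B L]
    {om : P →ₗ[B] P →ₗ[B] L} {z : Module.Dual B P → L →ₗ[B] P}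

/-- the `L`-valued symplectic form on `P ⊥ (B ⊕ L)` -/
def frm (om : P →ₗ[B] P →ₗ[B] L) : (P × B × L) →ₗ[B] (P × B × L) →ₗ[B] L :=
  LinearMap.mk₂ B (fun w w' => om w.1 w'.1 + w.2.1 • w'.2.2 - w'.2.1 • w.2.2)
    (fun a b c => by simp only [Prod.fst_add, Prod.snd_add, map_add, LinearMap.add_apply]; module)
    (fun r a b => by
      simp only [Prod.smul_fst, Prod.smul_snd, map_smul, LinearMap.smul_apply, smul_eq_mul]; module)
    (fun a b c => by simp only [Prod.fst_add, Prod.snd_add, map_add]; module)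
    (fun r a b => by simp only [Prod.smul_fst, Prod.smul_snd, map_smul, smul_eq_mul]; module)

theorem frm_apply (om : P →ₗ[B] P →ₗ[B] L) (w w' : P × B × L) :
    frm om w w' = om w.1 w'.1 + w.2.1 • w'.2.2 - w'.2.1 • w.2.2 := rfl

theorem frm_alt (D : SympData B P L om z) (w) : frm om w w = 0 := by
  rw [frm_apply, D.alt]; module

theorem frm_skew (D : SympData B P L om z) (w w') : frm om w w' = - frm om w' w := by
  rw [frm_apply, frm_apply, D.skew]; module

/-- isometries -/
def Isom (om : P →ₗ[B] P →ₗ[B] L) (θ : (P × B × L) →ₗ[B] (P × B × L)) : Prop :=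
  ∀ w w', frm om (θ w) (θ w') = frm om w w'

theorem Isom.comp {θ θ' : (P × B × L) →ₗ[B] (P × B × L)} (h : Isom om θ) (h' : Isom om θ') :
    Isom om (θ ∘ₗ θ') := fun w w' => by
  simp only [LinearMap.comp_apply]; rw [h, h']

/-- twisted transvections -/
def T3 (om : P →ₗ[B] P →ₗ[B] L) (f : Module.Dual B L) (u v : P × B × L) (a : B) :
    (P × B × L) →ₗ[B] (P × B × L) :=
  LinearMap.id + (f ∘ₗ (frm om).flip v).smulRight u + (f ∘ₗ (frm om).flip u).smulRight v
    + (a • (f ∘ₗ (frm om).flip u)).smulRight u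

theorem T3_apply (f : Module.Dual B L) (u v : P × B × L) (a : B) (w) :
    T3 om f u v a w = w + f (frm om w v) • u + f (frm om w u) • v + (a * f (frm om w u)) • u := by
  simp [T3]

theorem T3_isom (D : SympData B P L om z) (f : Module.Dual B L) (u v : P × B × L) (a : B)
    (huv : frm om u v = 0) : Isom om (T3 om f u v a) := by
  intro w w'
  have hvu : frm om v u = 0 := by rw [frm_skew D, huv, neg_zero]
  have h1 := D.symL f (frm om w' v) (frm om w u)
  have h2 := D.symL f (frm om w' u) (frm om w v)
  have h3 := D.symL f (frm om w' u) (frm om w u)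
  rw [T3_apply, T3_apply]
  simp only [map_add, map_smul, LinearMap.add_apply, LinearMap.smul_apply, huv, hvu, frm_alt D,
    smul_zero, add_zero]
  rw [frm_skew D u w', frm_skew D v w']
  linear_combination (norm := module) h1 + h2 + a • h3

/-- second kind -/
def T2 (om : P →ₗ[B] P →ₗ[B] L) (q : P) (l : L) : (P × B × L) →ₗ[B] (P × B × L) :=
  LinearMap.id + LinearMap.prod ((LinearMap.fst B B L ∘ₗ LinearMap.snd B P (B × L)).smulRight q)
    (LinearMap.prod 0 (-(om q ∘ₗ LinearMap.fst B P (B × L)) +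
      (LinearMap.fst B B L ∘ₗ LinearMap.snd B P (B × L)).smulRight l))

theorem T2_apply (q : P) (l : L) (p x y) :
    T2 om q l (p, x, y) = (p + x • q, x, y + (-om q p + x • l)) := by
  simp [T2]

theorem T2_isom (D : SympData B P L om z) (q : P) (l : L) : Isom om (T2 om q l) := by
  rintro ⟨p, x, y⟩ ⟨p', x', y'⟩
  rw [T2_apply, T2_apply, frm_apply, frm_apply]
  simp only [map_add, map_smul, LinearMap.add_apply, LinearMap.smul_apply, D.alt]
  rw [D.skew p q]
  module

/-- first kind -/
def T1 (z : Module.Dual B P → L →ₗ[B] P) (ψ : Module.Dual B P) (f : Module.Dual B L) :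
    (P × B × L) →ₗ[B] (P × B × L) :=
  LinearMap.id + LinearMap.prod (z ψ ∘ₗ LinearMap.snd B B L ∘ₗ LinearMap.snd B P (B × L))
    (LinearMap.prod (- (ψ ∘ₗ LinearMap.fst B P (B × L)) +
      f ∘ₗ LinearMap.snd B B L ∘ₗ LinearMap.snd B P (B × L)) 0)

theorem T1_apply (ψ : Module.Dual B P) (f : Module.Dual B L) (p x y) :
    T1 z ψ f (p, x, y) = (p + z ψ y, x + (-ψ p + f y), y) := by
  simp [T1]

theorem T1_isom (D : SympData B P L om z) (ψ : Module.Dual B P) (f : Module.Dual B L) :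
    Isom om (T1 z ψ f) := by
  rintro ⟨p, x, y⟩ ⟨p', x', y'⟩
  rw [T1_apply, T1_apply, frm_apply, frm_apply]
  have h1 := D.symL f y y'
  simp only [map_add, LinearMap.add_apply, D.contr, D.zz]
  rw [D.skew (z ψ y) p', D.contr]
  linear_combination (norm := module) h1

/-- the inverse of `T1`, on the left -/
def T1' (z : Module.Dual B P → L →ₗ[B] P) (ψ : Module.Dual B P) (f : Module.Dual B L) :
    (P × B × L) →ₗ[B] (P × B × L) :=
  LinearMap.id - LinearMap.prod (z ψ ∘ₗ LinearMap.snd B B L ∘ₗ LinearMap.snd B P (B × L))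
    (LinearMap.prod (- (ψ ∘ₗ LinearMap.fst B P (B × L)) +
      f ∘ₗ LinearMap.snd B B L ∘ₗ LinearMap.snd B P (B × L)) 0)

theorem T1'_apply (ψ : Module.Dual B P) (f : Module.Dual B L) (p x y) :
    T1' z ψ f (p, x, y) = (p - z ψ y, x - (-ψ p + f y), y) := by
  simp [T1']

theorem T1'_isom (D : SympData B P L om z) (ψ : Module.Dual B P) (f : Module.Dual B L) :
    Isom om (T1' z ψ f) := by
  rintro ⟨p, x, y⟩ ⟨p', x', y'⟩
  rw [T1'_apply, T1'_apply, frm_apply, frm_apply]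
  have h1 := D.symL f y y'
  simp only [map_sub, LinearMap.sub_apply, D.contr, D.zz]
  rw [D.skew (z ψ y) p', D.contr]
  linear_combination (norm := module) -h1

theorem T1'_T1 (D : SympData B P L om z) (ψ : Module.Dual B P) (f : Module.Dual B L) (w) :
    T1' z ψ f (T1 z ψ f w) = w := by
  obtain ⟨p, x, y⟩ := w
  rw [T1_apply, T1'_apply]
  simp [D.zz]

/-! ### congruences modulo `I` -/

theorem mem_IQ (I : Ideal B) (p : P) (x : B) (y : L) :
    (p, x, y) ∈ (I • ⊤ : Submodule B (P × B × L)) ↔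
      p ∈ (I • ⊤ : Submodule B P) ∧ x ∈ I ∧ y ∈ (I • ⊤ : Submodule B L) := by
  constructor
  · intro h
    refine ⟨?_, ?_, ?_⟩
    · exact Submodule.smul_top_le_comap_smul_top I (LinearMap.fst B P (B × L)) h
    · simpa using! Submodule.smul_top_le_comap_smul_top I
        (LinearMap.fst B B L ∘ₗ LinearMap.snd B P (B × L)) h
    · exact Submodule.smul_top_le_comap_smul_top I
        (LinearMap.snd B B L ∘ₗ LinearMap.snd B P (B × L)) h
  · rintro ⟨h1, h2, h3⟩
    have e1 := Submodule.smul_top_le_comap_smul_top I (LinearMap.inl B P (B × L)) h1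
    have e2 := Submodule.smul_top_le_comap_smul_top I
      (LinearMap.inr B P (B × L) ∘ₗ LinearMap.inl B B L) (show x ∈ I • ⊤ by simpa using! h2)
    have e3 := Submodule.smul_top_le_comap_smul_top I
      (LinearMap.inr B P (B × L) ∘ₗ LinearMap.inr B B L) h3
    rw [Submodule.mem_comap] at e1 e2 e3
    simpa using add_mem (add_mem e1 e2) e3

theorem lin_I {M N : Type*} [AddCommGroup M] [Module B M] [AddCommGroup N] [Module B N]
    (I : Ideal B) (f : M →ₗ[B] N) {x : M} (h : x ∈ (I • ⊤ : Submodule B M)) :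
    f x ∈ (I • ⊤ : Submodule B N) := Submodule.smul_top_le_comap_smul_top I f h

/-- congruence modulo `I` -/
def Cong (I : Ideal B) (θ θ' : (P × B × L) →ₗ[B] (P × B × L)) : Prop :=
  ∀ w, θ w - θ' w ∈ (I • ⊤ : Submodule B (P × B × L))

theorem Cong.comp_id {I : Ideal B} {θ θ' : (P × B × L) →ₗ[B] (P × B × L)}
    (h : Cong I θ LinearMap.id) : Cong I (θ ∘ₗ θ') θ' := fun w => h (θ' w)

theorem Cong.trans {I : Ideal B} {θ θ' θ'' : (P × B × L) →ₗ[B] (P × B × L)}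
    (h : Cong I θ θ') (h' : Cong I θ' θ'') : Cong I θ θ'' := fun w => by
  simpa using add_mem (h w) (h' w)

theorem T2_cong (I : Ideal B) (q : P) (l : L) (hq : q ∈ (I • ⊤ : Submodule B P))
    (hl : l ∈ (I • ⊤ : Submodule B L)) : Cong I (T2 om q l) LinearMap.id := by
  rintro ⟨p, x, y⟩
  rw [T2_apply]
  simp only [LinearMap.id_apply, Prod.mk_sub_mk, mem_IQ, add_sub_cancel_left, sub_self]
  refine ⟨Submodule.smul_mem _ _ hq, zero_mem _, add_mem (neg_mem ?_) (Submodule.smul_mem _ _ hl)⟩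
  exact lin_I I (om.flip p) hq

theorem T3_cong (I : Ideal B) (f : Module.Dual B L) (u v : P × B × L) (a : B)
    (hv : v ∈ (I • ⊤ : Submodule B (P × B × L))) (ha : a ∈ I) :
    Cong I (T3 om f u v a) LinearMap.id := by
  intro w
  rw [T3_apply]
  have h1 : f (frm om w v) ∈ I := by simpa using! lin_I I (f ∘ₗ frm om w) hv
  have : w + f (frm om w v) • u + f (frm om w u) • v + (a * f (frm om w u)) • u
      - LinearMap.id (R := B) w = f (frm om w v) • u + f (frm om w u) • v
        + (a * f (frm om w u)) • u := by
    rw [LinearMap.id_apply]; abel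
  rw [this]
  exact add_mem (add_mem (Submodule.smul_mem_smul h1 trivial) (Submodule.smul_mem _ _ hv))
    (Submodule.smul_mem_smul (I.mul_mem_right _ ha) trivial)

/-! ### moving a unimodular vector to `e` -/

theorem ordI_top {N : Type*} [AddCommGroup N] [Module B N] {K : Type*} [AddCommGroup K]
    [Module B K] (n : N) (k : K) :
    ordI n ⊔ ordI k = (⊤ : Ideal B) ↔ ∃ (f : Module.Dual B N) (g : Module.Dual B K),
      f n + g k = 1 := by
  rw [Ideal.eq_top_iff_one, Submodule.mem_sup]
  constructor
  · rintro ⟨_, ⟨f, rfl⟩, _, ⟨g, rfl⟩, h⟩; exact ⟨f, g, h⟩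
  · rintro ⟨f, g, h⟩; exact ⟨_, ⟨f, rfl⟩, _, ⟨g, rfl⟩, h⟩

theorem ordI_top3 {N : Type*} [AddCommGroup N] [Module B N] {K : Type*} [AddCommGroup K]
    [Module B K] (n : N) (k : K) (t : B) (f : Module.Dual B N) (g : Module.Dual B K) (c : B)
    (h : f n + g k + c * t = 1) : ordI n ⊔ ordI k ⊔ Ideal.span {t} = (⊤ : Ideal B) := by
  rw [Ideal.eq_top_iff_one, ← h]
  refine add_mem (Submodule.mem_sup_left (add_mem (Submodule.mem_sup_left ⟨f, rfl⟩)
    (Submodule.mem_sup_right ⟨g, rfl⟩))) (Submodule.mem_sup_right ?_)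
  exact Ideal.mul_mem_left _ _ (Ideal.mem_span_singleton_self t)

theorem dual_self (c : Module.Dual B B) (x : B) : c x = c 1 * x := by
  rw [← smul_eq_mul, smul_eq_mul, mul_comm, ← smul_eq_mul, ← map_smul, smul_eq_mul, mul_one]

theorem hKB : ∀ 𝔭 : Ideal B, 𝔭.IsPrime → ∃ (f : Module.Dual B B) (l : B), f l ∉ 𝔭 :=
  fun _ hp => ⟨LinearMap.id, 1, fun h => hp.ne_top ((Ideal.eq_top_iff_one _).2 h)⟩

/-- unimodularity in `P × B × L` -/
def Uni (w : P × B × L) : Prop :=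
  ∃ (ψ : Module.Dual B P) (c : B) (f : Module.Dual B L), ψ w.1 + c * w.2.1 + f w.2.2 = 1

theorem uni_of_isom (D : SympData B P L om z) {θ : (P × B × L) →ₗ[B] (P × B × L)}
    (hθ : Isom om θ) : Uni (θ (0, 1, 0)) := by
  have h : ordI (θ (0, 1, 0)) = (⊤ : Ideal B) := by
    by_contra hne
    obtain ⟨m, hm, hle⟩ := Ideal.exists_le_maximal _ hne
    obtain ⟨f, a, b, hl⟩ := D.loc m hm.isPrime
    apply hl
    have h1 : f (frm om (θ (0, 1, 0)) (θ (0, 0, om a b))) ∈ m :=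
      hle ⟨f ∘ₗ (frm om).flip (θ (0, 0, om a b)), rfl⟩
    rw [hθ, frm_apply] at h1
    simpa using h1
  rw [Ideal.eq_top_iff_one] at h
  obtain ⟨F, hF⟩ := h
  have hF : F (θ (0, 1, 0)) = 1 := hF
  generalize θ (0, 1, 0) = w at hF
  obtain ⟨p, x, y⟩ := w
  refine ⟨F ∘ₗ LinearMap.inl B P (B × L), F (0, 1, 0),
    F ∘ₗ LinearMap.inr B P (B × L) ∘ₗ LinearMap.inr B B L, ?_⟩
  refine Eq.trans ?_ hF
  have : (p, x, y) = (p, (0 : B), (0 : L)) + x • ((0 : P), (1 : B), (0 : L)) +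
    ((0 : P), (0 : B), y) := by simp
  conv_rhs => rw [this]
  rw [map_add, map_add, map_smul, smul_eq_mul, mul_comm x]
  rfl

theorem move1 [IsNoetherianRing B] (D : SympData B P L om z) (hdim : ringKrullDim B ≤ 2)
    (I : Ideal B)
    {θ : (P × B × L) →ₗ[B] (P × B × L)} (hθ : Isom om θ)
    (he : θ (0, 1, 0) - (0, 1, 0) ∈ (I • ⊤ : Submodule B (P × B × L))) :
    ∃ θ', Isom om θ' ∧ Cong I θ' θ ∧ ∃ (p : P) (x : B) (y : L) (ψ : Module.Dual B P) (c : B),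
      θ' (0, 1, 0) = (p, x, y) ∧ ψ p + c * x = 1 := by
  obtain ⟨ψ, c, f, hu⟩ := uni_of_isom D hθ
  obtain ⟨⟨p, x, y⟩, hw⟩ : ∃ w, w = θ (0, 1, 0) := ⟨_, rfl⟩
  rw [← hw] at hu he
  dsimp only at hu
  rw [Prod.mk_sub_mk, Prod.mk_sub_mk, mem_IQ, sub_zero, sub_zero] at he
  obtain ⟨hp, hx, hy⟩ := he
  have hfy : f y ∈ I := by simpa using! lin_I I f hy
  obtain ⟨q, m, hqm⟩ := stable D hdim hKB p x (f y ^ 2) (ordI_top3 _ _ _ ((1 + f y) • ψ)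
    (((1 + f y) * c) • LinearMap.id) 1 (by simp; linear_combination (1 + f y) * hu))
  obtain ⟨ψ', c', h1⟩ := (ordI_top _ _).1 hqm
  rw [dual_self c'] at h1
  have hv : ((-(f y)) • q, (0 : B), (0 : L)) ∈ (I • ⊤ : Submodule B (P × B × L)) := by
    rw [mem_IQ]
    exact ⟨Submodule.smul_mem_smul (neg_mem hfy) trivial, zero_mem _, zero_mem _⟩
  refine ⟨T3 om f (0, 1, 0) ((-(f y)) • q, 0, 0) (-(f y) * m) ∘ₗ θ,
    (T3_isom D _ _ _ _ (by simp [frm_apply])).comp hθ,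
    (T3_cong I _ _ _ _ hv (I.mul_mem_right _ (neg_mem hfy))).comp_id,
    p + (f y) ^ 2 • q, x + (f y) ^ 2 * m - f y * f (om p q), y,
    ψ' + (c' 1 * f y) • (f ∘ₗ om.flip q), c' 1, ?_, ?_⟩
  · rw [LinearMap.comp_apply, ← hw, T3_apply, frm_apply, frm_apply]
    simp only [map_zero, smul_zero, Prod.smul_mk, Prod.mk_add_mk, zero_smul, add_zero, map_smul,
      zero_sub, one_smul, map_neg, smul_eq_mul, mul_one, sub_zero, mul_zero, smul_smul]
    refine Prod.ext ?_ (Prod.ext ?_ ?_)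
    · simp only []; module
    · simp only []; ring
    · simp
  · refine Eq.trans ?_ h1
    generalize c' 1 = c1
    simp [D.alt]
    ring

theorem move2 (D : SympData B P L om z) (I : Ideal B)
    {θ : (P × B × L) →ₗ[B] (P × B × L)} (hθ : Isom om θ)
    (p x y) (hw : θ (0, 1, 0) = (p, x, y)) (hy : y ∈ (I • ⊤ : Submodule B L))
    (ψ : Module.Dual B P) (c : B) (hu : ψ p + c * x = 1) :
    ∃ θ', Isom om θ' ∧ Cong I θ' θ ∧ ∃ (p : P) (ψ : Module.Dual B P) (c : B),
      θ' (0, 1, 0) = (p, x, 0) ∧ ψ p + c * x = 1 := by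
  refine ⟨T2 om (-z ψ y) (-c • y) ∘ₗ θ, (T2_isom D _ _).comp hθ,
    (T2_cong I _ _ (neg_mem (lin_I I _ hy)) (Submodule.smul_mem _ _ hy)).comp_id,
    p + x • (- z ψ y), ψ, c, ?_, ?_⟩
  · rw [LinearMap.comp_apply, hw, T2_apply]
    refine Prod.ext rfl (Prod.ext rfl ?_)
    simp only [map_neg, LinearMap.neg_apply]
    rw [D.skew (z ψ y) p, D.contr]
    have : y = (ψ p + c * x) • y := by rw [hu, one_smul]
    linear_combination (norm := module) this
  · simp [D.zz, hu]

theorem move3 [IsNoetherianRing B] (D : SympData B P L om z) (hdim : ringKrullDim B ≤ 2)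
    (I : Ideal B) (f0 : Module.Dual B L) (l0 : L) (h0 : 1 - f0 l0 ∈ I)
    {θ : (P × B × L) →ₗ[B] (P × B × L)} (hθ : Isom om θ)
    (p x) (hw : θ (0, 1, 0) = (p, x, 0)) (hx : 1 - x ∈ I)
    (ψ : Module.Dual B P) (c : B) (hu : ψ p + c * x = 1) :
    ∃ θ', Isom om θ' ∧ Cong I θ' θ ∧ ∃ (p : P) (y : L) (ψ : Module.Dual B P) (f : Module.Dual B L),
      θ' (0, 1, 0) = (p, x, y) ∧ ψ p + f y = 1 - x := by
  obtain ⟨q, l', hql⟩ := stable D hdim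
    (fun 𝔭 hp => by obtain ⟨f, a, b, h⟩ := D.loc 𝔭 hp; exact ⟨f, _, h⟩) p l0 (x * (1 - f0 l0))
    (ordI_top3 _ _ _ ψ ((c * x) • f0) c (by simp; linear_combination hu))
  obtain ⟨f, g, hfg⟩ := (ordI_top _ _).1 hql
  obtain ⟨l, hl⟩ : ∃ l, l = l0 + (x * (1 - f0 l0)) • l' := ⟨_, rfl⟩
  rw [← hl] at hfg
  obtain ⟨z1, hz1⟩ : ∃ z1, z1 = (1 - f0 l0) • q := ⟨_, rfl⟩
  rw [mul_smul, ← hz1] at hfg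
  have hz1I : z1 ∈ (I • ⊤ : Submodule B P) := hz1 ▸ Submodule.smul_mem_smul h0 trivial
  have hYI : (1 - x) • l ∈ (I • ⊤ : Submodule B L) := Submodule.smul_mem_smul hx trivial
  obtain ⟨Y, hY⟩ : ∃ Y, Y = (1 - x) • l := ⟨_, rfl⟩
  rw [← hY] at hYI
  obtain ⟨p2, hp2⟩ : ∃ p2, p2 = p + x • z ψ Y + x • z1 := ⟨_, rfl⟩
  refine ⟨T2 om z1 0 ∘ₗ T2 om (z ψ Y) (c • Y) ∘ₗ θ,
    (T2_isom D _ _).comp ((T2_isom D _ _).comp hθ),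
    ((T2_cong I _ _ hz1I (zero_mem _)).comp_id).trans
      (T2_cong I _ _ (lin_I I _ hYI) (Submodule.smul_mem _ _ hYI)).comp_id,
    p2, Y - om z1 p2, (1 - x) • f + (g - ((1 - x) * x) • (f ∘ₗ z ψ)) ∘ₗ om z1,
    g - ((1 - x) * x) • (f ∘ₗ z ψ), ?_, ?_⟩
  · rw [LinearMap.comp_apply, LinearMap.comp_apply, hw, T2_apply, T2_apply, hp2]
    refine Prod.ext rfl (Prod.ext rfl ?_)
    simp only [map_add, map_smul, D.alt]
    rw [D.skew (z ψ Y) p, D.contr]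
    have : Y = (ψ p + c * x) • Y := by rw [hu, one_smul]
    linear_combination (norm := module) -this
  · have e1 : g Y = (1 - x) * g l := by rw [hY]; simp
    have e2 : f p2 = f (p + x • z1) + x * f (z ψ Y) := by
      rw [hp2]; simp only [map_add, map_smul, smul_eq_mul]; ring
    simp only [LinearMap.add_apply, LinearMap.smul_apply, LinearMap.comp_apply,
      LinearMap.sub_apply, map_sub, smul_eq_mul, e1, e2]
    linear_combination (1 - x) * hfg

theorem move4 (D : SympData B P L om z) (I : Ideal B)
    {θ : (P × B × L) →ₗ[B] (P × B × L)} (hθ : Isom om θ)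
    (p x y) (hw : θ (0, 1, 0) = (p, x, y)) (hp : p ∈ (I • ⊤ : Submodule B P))
    (hy : y ∈ (I • ⊤ : Submodule B L))
    (ψ : Module.Dual B P) (f : Module.Dual B L) (hu : ψ p + f y = 1 - x) :
    ∃ θ', Isom om θ' ∧ Cong I θ' θ ∧ θ' (0, 1, 0) = (0, 1, 0) := by
  obtain ⟨p1, hp1⟩ : ∃ p1, p1 = p + z (-ψ) y := ⟨_, rfl⟩
  have hp1I : p1 ∈ (I • ⊤ : Submodule B P) := hp1 ▸ add_mem hp (lin_I I _ hy)
  refine ⟨T1' z (-ψ) f ∘ₗ T2 om (-p1) (-y) ∘ₗ T1 z (-ψ) f ∘ₗ θ,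
    (T1'_isom D _ _).comp ((T2_isom D _ _).comp ((T1_isom D _ _).comp hθ)), ?_, ?_⟩
  · intro w
    have h1 := lin_I I (T1' z (-ψ) f)
      (T2_cong (om := om) I (-p1) (-y) (neg_mem hp1I) (neg_mem hy) (T1 z (-ψ) f (θ w)))
    rw [map_sub, LinearMap.id_apply, T1'_T1 D] at h1
    exact h1
  · simp only [LinearMap.comp_apply, hw]
    have : x + (-(-ψ) p + f y) = 1 := by simp; linear_combination hu
    rw [T1_apply, this, ← hp1, T2_apply, T1'_apply]
    simp [D.alt]

theorem cong_e {I : Ideal B} {θ θ' : (P × B × L) →ₗ[B] (P × B × L)} (h : Cong I θ' θ)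
    (he : θ (0, 1, 0) - (0, 1, 0) ∈ (I • ⊤ : Submodule B (P × B × L)))
    {p x y} (hw : θ' (0, 1, 0) = (p, x, y)) :
    p ∈ (I • ⊤ : Submodule B P) ∧ 1 - x ∈ I ∧ y ∈ (I • ⊤ : Submodule B L) := by
  have h1 := add_mem (h (0, 1, 0)) he
  rw [sub_add_sub_cancel, hw, Prod.mk_sub_mk, Prod.mk_sub_mk, mem_IQ, sub_zero, sub_zero] at h1
  exact ⟨h1.1, by simpa using neg_mem h1.2.1, h1.2.2⟩

theorem move [IsNoetherianRing B] (D : SympData B P L om z) (hdim : ringKrullDim B ≤ 2)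
    (I : Ideal B) (f0 : Module.Dual B L) (l0 : L) (h0 : 1 - f0 l0 ∈ I)
    {θ : (P × B × L) →ₗ[B] (P × B × L)} (hθ : Isom om θ)
    (he : θ (0, 1, 0) - (0, 1, 0) ∈ (I • ⊤ : Submodule B (P × B × L))) :
    ∃ θ', Isom om θ' ∧ Cong I θ' θ ∧ θ' (0, 1, 0) = (0, 1, 0) := by
  obtain ⟨θ1, i1, c1, p, x, y, ψ, c, hw, hu⟩ := move1 D hdim I hθ he
  obtain ⟨-, -, hy⟩ := cong_e c1 he hw
  obtain ⟨θ2, i2, c2, p, ψ, c, hw, hu⟩ := move2 D I i1 p x y hw hy ψ c hu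
  have c2 := c2.trans c1
  obtain ⟨-, hx, -⟩ := cong_e c2 he hw
  obtain ⟨θ3, i3, c3, p, y, ψ, f, hw, hu⟩ := move3 D hdim I f0 l0 h0 i2 p x hw hx ψ c hu
  have c3 := c3.trans c2
  obtain ⟨hp, -, hy⟩ := cong_e c3 he hw
  obtain ⟨θ4, i4, c4, hw⟩ := move4 D I i3 p x y hw hp hy ψ f hu
  exact ⟨θ4, i4, c4.trans c3, hw⟩

/-- the automorphism of `P = e^⊥/e` -/
theorem descend
    {θ : (P × B × L) →ₗ[B] (P × B × L)} (hθ : Isom om θ) (he : θ (0, 1, 0) = (0, 1, 0)) (a b : P) :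
    om (θ (a, 0, 0)).1 (θ (b, 0, 0)).1 = om a b := by
  have h1 : ∀ a, (θ (a, 0, 0)).2.2 = 0 := by
    intro a
    have := hθ (a, 0, 0) (0, 1, 0)
    rw [he, frm_apply, frm_apply] at this
    simpa using this
  have := hθ (a, 0, 0) (b, 0, 0)
  rw [frm_apply, frm_apply, h1, h1] at this
  simpa using this

end sympl

section lifting
open Matrix

theorem stdSymplForm_eq {C : Type*} [CommRing C] (u v : Fin 4 → C) :
    stdSymplForm C u v = u 0 * v 1 - u 1 * v 0 + (u 2 * v 3 - u 3 * v 2) := by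
  have e0 : (finSumFinEquiv (m := 2) (n := 2)).symm 0 = Sum.inl 0 := rfl
  have e1 : (finSumFinEquiv (m := 2) (n := 2)).symm 1 = Sum.inl 1 := rfl
  have e2 : (finSumFinEquiv (m := 2) (n := 2)).symm 2 = Sum.inr 0 := rfl
  have e3 : (finSumFinEquiv (m := 2) (n := 2)).symm 3 = Sum.inr 1 := rfl
  simp [stdSymplForm, blockDiag4, dotProduct, mulVec, Fin.sum_univ_four, e0, e1, e2, e3]
  ring

theorem blockDiag4_mulVec {C : Type*} [CommRing C] (M : Matrix (Fin 2) (Fin 2) C) (u : Fin 4 → C) :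
    (blockDiag4 M 1).mulVec u = ![M 0 0 * u 0 + M 0 1 * u 1, M 1 0 * u 0 + M 1 1 * u 1, u 2, u 3] := by
  have e0 : (finSumFinEquiv (m := 2) (n := 2)).symm 0 = Sum.inl 0 := rfl
  have e1 : (finSumFinEquiv (m := 2) (n := 2)).symm 1 = Sum.inl 1 := rfl
  have e2 : (finSumFinEquiv (m := 2) (n := 2)).symm 2 = Sum.inr 0 := rfl
  have e3 : (finSumFinEquiv (m := 2) (n := 2)).symm 3 = Sum.inr 1 := rfl
  ext i
  fin_cases i <;>
  simp [blockDiag4, dotProduct, mulVec, Fin.sum_univ_four, e0, e1, e2, e3]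

variable {B P L : Type*} [CommRing B] [AddCommGroup P] [Module B P]
    [AddCommGroup L] [Module B L]
    {om : P →ₗ[B] P →ₗ[B] L} {z : Module.Dual B P → L →ₗ[B] P}

/-- data modulo `I` -/
structure ModData (om : P →ₗ[B] P →ₗ[B] L) (I : Ideal B) (χ φ : Module.Dual B P)
    (f0 : Module.Dual B L) : Prop where
  ker : ∀ p, χ p ∈ I → φ p ∈ I → p ∈ (I • ⊤ : Submodule B P)
  surj : ∀ c d : B, ∃ p, χ p - c ∈ I ∧ φ p - d ∈ I
  det : ∀ a b, f0 (om a b) - (χ a * φ b - φ a * χ b) ∈ I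

/-- reduction modulo `I` -/
def rho (I : Ideal B) (χ φ : Module.Dual B P) (f0 : Module.Dual B L) :
    (P × B × L) →ₗ[B] (Fin 4 → B ⧸ I) :=
  LinearMap.pi ![Algebra.linearMap B (B ⧸ I) ∘ₗ χ ∘ₗ LinearMap.fst B P (B × L),
    Algebra.linearMap B (B ⧸ I) ∘ₗ φ ∘ₗ LinearMap.fst B P (B × L),
    Algebra.linearMap B (B ⧸ I) ∘ₗ LinearMap.fst B B L ∘ₗ LinearMap.snd B P (B × L),
    Algebra.linearMap B (B ⧸ I) ∘ₗ f0 ∘ₗ LinearMap.snd B B L ∘ₗ LinearMap.snd B P (B × L)]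

variable {I : Ideal B} {χ φ : Module.Dual B P} {f0 : Module.Dual B L}

theorem rho_apply (p : P) (x : B) (y : L) : rho I χ φ f0 (p, x, y) =
    ![Ideal.Quotient.mk I (χ p), Ideal.Quotient.mk I (φ p), Ideal.Quotient.mk I x,
      Ideal.Quotient.mk I (f0 y)] := by
  ext i
  fin_cases i <;> rfl

theorem rho_IQ {w : P × B × L} (h : w ∈ (I • ⊤ : Submodule B (P × B × L))) :
    rho I χ φ f0 w = 0 := by
  refine Submodule.smul_induction_on h ?_ ?_
  · intro r hr n _
    rw [map_smul]
    ext i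
    have : algebraMap B (B ⧸ I) r = 0 := Ideal.Quotient.eq_zero_iff_mem.2 hr
    rw [Pi.smul_apply, Algebra.smul_def, this, zero_mul, Pi.zero_apply]
  · intro a b ha hb
    rw [map_add, ha, hb, add_zero]

theorem ModData.ex_l0 (E : ModData om I χ φ f0) : ∃ l0, 1 - f0 l0 ∈ I := by
  obtain ⟨a, ha1, ha2⟩ := E.surj 1 0
  obtain ⟨b, hb1, hb2⟩ := E.surj 0 1
  refine ⟨om a b, ?_⟩
  have := E.det a b
  rw [← Ideal.Quotient.eq_zero_iff_mem] at *
  simp only [map_sub, map_mul, map_one, map_zero, sub_eq_zero, sub_zero] at *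
  rw [this, ha1, ha2, hb1, hb2]; simp

theorem ModData.kerL (D : SympData B P L om z) (E : ModData om I χ φ f0) (l : L)
    (h : f0 l ∈ I) : l ∈ (I • ⊤ : Submodule B L) := by
  obtain ⟨l0, h0⟩ := E.ex_l0
  have : l = f0 l • l0 + (1 - f0 l0) • l := by
    rw [← D.symL f0 l0 l]; module
  rw [this]
  exact add_mem (Submodule.smul_mem_smul h trivial) (Submodule.smul_mem_smul h0 trivial)

theorem ModData.kerQ (D : SympData B P L om z) (E : ModData om I χ φ f0) (w : P × B × L)
    (h : rho I χ φ f0 w = 0) : w ∈ (I • ⊤ : Submodule B (P × B × L)) := by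
  obtain ⟨p, x, y⟩ := w
  rw [rho_apply] at h
  have h0 := congrFun h 0
  have h1 := congrFun h 1
  have h2 := congrFun h 2
  have h3 := congrFun h 3
  simp [Ideal.Quotient.eq_zero_iff_mem] at h0 h1 h2 h3
  rw [mem_IQ]
  exact ⟨E.ker _ h0 h1, h2, E.kerL D _ h3⟩

theorem ModData.surjQ (E : ModData om I χ φ f0) (u : Fin 4 → B ⧸ I) :
    ∃ w, rho I χ φ f0 w = u := by
  obtain ⟨l0, h0⟩ := E.ex_l0
  choose c hc using fun i => Ideal.Quotient.mk_surjective (u i)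
  obtain ⟨p, hp1, hp2⟩ := E.surj (c 0) (c 1)
  refine ⟨(p, c 2, c 3 • l0), ?_⟩
  rw [← Ideal.Quotient.eq_zero_iff_mem, map_sub, sub_eq_zero] at hp1 hp2 h0
  rw [rho_apply]
  ext i
  fin_cases i <;> simp [hp1, hp2, hc, ← h0]

theorem ModData.form (E : ModData om I χ φ f0) (w w' : P × B × L) :
    stdSymplForm (B ⧸ I) (rho I χ φ f0 w) (rho I χ φ f0 w') =
      Ideal.Quotient.mk I (f0 (frm om w w')) := by
  obtain ⟨p, x, y⟩ := w
  obtain ⟨p', x', y'⟩ := w'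
  have := E.det p p'
  rw [← Ideal.Quotient.eq_zero_iff_mem, map_sub, sub_eq_zero] at this
  rw [stdSymplForm_eq, rho_apply, rho_apply, frm_apply]
  simp [this]
  ring

theorem ModData.lift_uni [IsNoetherianRing B] (D : SympData B P L om z)
    (hdim : ringKrullDim B ≤ 2) (E : ModData om I χ φ f0) (u : Fin 4 → B ⧸ I)
    (hu : IsUnimodular (B ⧸ I) u) : ∃ w, rho I χ φ f0 w = u ∧ Uni w := by
  obtain ⟨⟨p, x, y⟩, hw⟩ := E.surjQ u
  obtain ⟨F, hF⟩ := hu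
  choose c hc using fun i => Ideal.Quotient.mk_surjective (F (Pi.single i 1))
  have hF' : F u = ∑ i, F (Pi.single i 1) * u i := by
    rw [LinearMap.pi_apply_eq_sum_univ F u]
    refine Finset.sum_congr rfl fun i _ => ?_
    rw [smul_eq_mul, mul_comm]
    congr 2
    ext j
    simp [Pi.single_apply, eq_comm]
  obtain ⟨i, hi⟩ : ∃ i, i = 1 - (c 0 * χ p + c 1 * φ p + c 2 * x + c 3 * f0 y) := ⟨_, rfl⟩
  have hiI : i ∈ I := by
    rw [← Ideal.Quotient.eq_zero_iff_mem, hi]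
    simp only [map_sub, map_add, map_mul, map_one, hc]
    rw [sub_eq_zero]; refine hF.symm.trans ?_; rw [hF', ← hw, Fin.sum_univ_four, rho_apply]
    rfl
  obtain ⟨q, m, hqm⟩ := stable D hdim hKB p x (c 3 * f0 y + i)
    (ordI_top3 _ _ _ (c 0 • χ + c 1 • φ) (c 2 • LinearMap.id) 1 (by simp; rw [hi]; ring))
  obtain ⟨ψ', c', h1⟩ := (ordI_top _ _).1 hqm
  rw [dual_self c'] at h1
  generalize c' 1 = c1 at h1
  refine ⟨(p, x, y) + i • (q, m, 0), ?_, ψ', c1, (c 3 * (ψ' q + c1 * m)) • f0, ?_⟩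
  · rw [map_add, hw, rho_IQ (Submodule.smul_mem_smul hiI trivial), add_zero]
  · rw [← h1]
    simp
    ring

theorem lift_pair [IsNoetherianRing B] (D : SympData B P L om z)
    (hdim : ringKrullDim B ≤ 2) (E : ModData om I χ φ f0) (u v : Fin 4 → B ⧸ I)
    (hu : IsUnimodular (B ⧸ I) u) (huv : stdSymplForm (B ⧸ I) u v = 0) :
    ∃ U V, rho I χ φ f0 U = u ∧ rho I χ φ f0 V = v ∧ frm om U V = 0 := by
  obtain ⟨U, hU, ψ, c, f, h1⟩ := E.lift_uni D hdim u hu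
  obtain ⟨V, hV⟩ := E.surjQ v
  obtain ⟨l, hl⟩ : ∃ l, l = frm om U V := ⟨_, rfl⟩
  have hlI : l ∈ (I • ⊤ : Submodule B L) := by
    apply E.kerL D
    rw [← Ideal.Quotient.eq_zero_iff_mem, hl, ← E.form, hU, hV, huv]
  have hfl : f l ∈ I := by simpa using! lin_I I f hlI
  refine ⟨U, V - (z ψ l, - f l, c • l), hU, ?_, ?_⟩
  · rw [map_sub, hV, rho_IQ, sub_zero]
    rw [mem_IQ]
    exact ⟨lin_I I _ hlI, neg_mem hfl, Submodule.smul_mem _ _ hlI⟩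
  · rw [map_sub, ← hl, frm_apply, D.contr]
    have h2 := D.symL f U.2.2 l
    simp only
    have h3 : l = (ψ U.1 + c * U.2.1 + f U.2.2) • l := by rw [h1, one_smul]
    linear_combination (norm := module) h3 + h2

theorem lift_ESp [IsNoetherianRing B] (D : SympData B P L om z)
    (hdim : ringKrullDim B ≤ 2) (E : ModData om I χ φ f0)
    (τ : Module.End (B ⧸ I) (Fin 4 → B ⧸ I)) (hτ : τ ∈ ESp4 (B ⧸ I)) :
    ∃ γ, Isom om γ ∧ ∀ w, rho I χ φ f0 (γ w) = τ (rho I χ φ f0 w) := by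
  refine Submonoid.closure_induction ?_ ?_ ?_ hτ
  · rintro τ ⟨a, u, v, huv, huni, hτ⟩
    obtain ⟨U, V, hU, hV, hUV⟩ :
        ∃ U V, rho I χ φ f0 U = u ∧ rho I χ φ f0 V = v ∧ frm om U V = 0 := by
      rcases huni with h | h
      · exact lift_pair D hdim E u v h huv
      · obtain ⟨V, U, hV, hU, h0⟩ := lift_pair D hdim E v u h (by
          rw [stdSymplForm_eq] at huv ⊢
          linear_combination -huv)
        exact ⟨U, V, hU, hV, by rw [frm_skew D, h0, neg_zero]⟩
    obtain ⟨a, rfl⟩ := Ideal.Quotient.mk_surjective a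
    refine ⟨T3 om f0 U V a, T3_isom D _ _ _ _ hUV, fun w => ?_⟩
    rw [hτ, T3_apply, ← hU, ← hV, E.form, E.form, ← map_mul]
    simp only [map_add, map_smul]
    rfl
  · exact ⟨LinearMap.id, fun _ _ => rfl, fun _ => rfl⟩
  · rintro τ τ' - - ⟨γ, h1, h2⟩ ⟨γ', h1', h2'⟩
    refine ⟨γ ∘ₗ γ', h1.comp h1', fun w => ?_⟩
    rw [LinearMap.comp_apply, h2, h2']
    rfl

theorem lift_main [IsNoetherianRing B] (D : SympData B P L om z)
    (hdim : ringKrullDim B ≤ 2) (E : ModData om I χ φ f0) (M : Matrix (Fin 2) (Fin 2) (B ⧸ I))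
    (hM : Matrix.toLin' (blockDiag4 M (1 : Matrix (Fin 2) (Fin 2) (B ⧸ I))) ∈ ESp4 (B ⧸ I)) :
    ∃ Φ : P →ₗ[B] P, (∀ a b, om (Φ a) (Φ b) = om a b) ∧ ∀ p,
      Ideal.Quotient.mk I (χ (Φ p)) = M 0 0 * Ideal.Quotient.mk I (χ p) +
        M 0 1 * Ideal.Quotient.mk I (φ p) ∧
      Ideal.Quotient.mk I (φ (Φ p)) = M 1 0 * Ideal.Quotient.mk I (χ p) +
        M 1 1 * Ideal.Quotient.mk I (φ p) := by
  obtain ⟨γ, hγ, hγM⟩ := lift_ESp D hdim E _ hM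
  obtain ⟨l0, h0⟩ := E.ex_l0
  have he : γ (0, 1, 0) - (0, 1, 0) ∈ (I • ⊤ : Submodule B (P × B × L)) := by
    apply E.kerQ D
    rw [map_sub, hγM, sub_eq_zero, Matrix.toLin'_apply, blockDiag4_mulVec, rho_apply]
    simp
  obtain ⟨θ, hθ, hc, hθe⟩ := move D hdim I f0 l0 h0 hγ he
  refine ⟨LinearMap.fst B P (B × L) ∘ₗ θ ∘ₗ LinearMap.inl B P (B × L), descend hθ hθe, fun p => ?_⟩
  have h1 : rho I χ φ f0 (θ (p, 0, 0)) = rho I χ φ f0 (γ (p, 0, 0)) := by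
    rw [← sub_eq_zero, ← map_sub]
    exact rho_IQ (hc _)
  rw [hγM, Matrix.toLin'_apply, blockDiag4_mulVec, rho_apply] at h1
  have a0 := congrFun h1 0
  have a1 := congrFun h1 1
  exact ⟨by simpa using! a0, by simpa using! a1⟩

end lifting

section inst
variable {B P : Type*} [CommRing B] [AddCommGroup P] [Module B P]

theorem local_basis [Module.Finite B P] [Module.Projective B P]
    (hrank : ∀ 𝔭 : PrimeSpectrum B, rankAt B P 𝔭 = 2) (𝔭 : Ideal B) [h𝔭 : 𝔭.IsPrime] :
    ∃ e : Module.Basis (Fin 2) (Localization.AtPrime 𝔭) (LocalizedModule 𝔭.primeCompl P),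
      ∀ ψ : Module.Dual B P, ∃ ξ : Fin 2 → Localization.AtPrime 𝔭, ∀ a : P,
        algebraMap B (Localization.AtPrime 𝔭) (ψ a) =
          ξ 0 * e.repr (LocalizedModule.mkLinearMap 𝔭.primeCompl P a) 0 +
          ξ 1 * e.repr (LocalizedModule.mkLinearMap 𝔭.primeCompl P a) 1 := by
  have hp : Module.Projective (Localization.AtPrime 𝔭) (LocalizedModule 𝔭.primeCompl P) :=
    Module.projective_of_isLocalizedModule 𝔭.primeCompl
      (LocalizedModule.mkLinearMap 𝔭.primeCompl P)
  have hfree : Module.Free (Localization.AtPrime 𝔭) (LocalizedModule 𝔭.primeCompl P) :=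
    Module.free_of_flat_of_isLocalRing
  have hr : Module.finrank (Localization.AtPrime 𝔭) (LocalizedModule 𝔭.primeCompl P) = 2 :=
    hrank ⟨𝔭, h𝔭⟩
  let e := Module.finBasisOfFinrankEq _ _ hr
  refine ⟨e, fun ψ => ?_⟩
  let Ψ := IsLocalizedModule.mapExtendScalars 𝔭.primeCompl
    (LocalizedModule.mkLinearMap 𝔭.primeCompl P)
    (Algebra.linearMap B (Localization.AtPrime 𝔭)) (Localization.AtPrime 𝔭) ψ
  refine ⟨fun i => Ψ (e i), fun a => ?_⟩
  have h1 : Ψ (LocalizedModule.mkLinearMap 𝔭.primeCompl P a) =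
      algebraMap B (Localization.AtPrime 𝔭) (ψ a) := by
    simp only [Ψ, IsLocalizedModule.mapExtendScalars_apply_apply, IsLocalizedModule.map_apply,
      Algebra.linearMap_apply]
  rw [← h1]
  conv_lhs => rw [← e.sum_repr (LocalizedModule.mkLinearMap 𝔭.primeCompl P a)]
  rw [Fin.sum_univ_two, map_add, map_smul, map_smul, smul_eq_mul, smul_eq_mul]
  ring

theorem eq_of_loc (x y : B) (h : ∀ (𝔭 : Ideal B) [𝔭.IsPrime],
    algebraMap B (Localization.AtPrime 𝔭) x = algebraMap B (Localization.AtPrime 𝔭) y) :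
    x = y := by
  refine Module.eq_of_localization_maximal (R := B) (M := B)
    (fun J _ => Localization.AtPrime J) (fun J _ => Algebra.linearMap B _) x y ?_
  intro J hJ
  exact h J

/-- minors -/
def mnr (χ φ : Module.Dual B P) (a b : P) : B := χ a * φ b - φ a * χ b

theorem rel1 [Module.Finite B P] [Module.Projective B P]
    (hrank : ∀ 𝔭 : PrimeSpectrum B, rankAt B P 𝔭 = 2) (ψ χ φ : Module.Dual B P) (x a b : P) :
    ψ x * mnr χ φ a b = ψ a * mnr χ φ x b - ψ b * mnr χ φ x a := by
  apply eq_of_loc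
  intro 𝔭 _
  obtain ⟨e, he⟩ := local_basis hrank 𝔭
  obtain ⟨s, hs⟩ := he ψ
  obtain ⟨t, ht⟩ := he χ
  obtain ⟨u, hu⟩ := he φ
  simp only [mnr, map_sub, map_mul, hs, ht, hu]
  ring

theorem rel2 [Module.Finite B P] [Module.Projective B P]
    (hrank : ∀ 𝔭 : PrimeSpectrum B, rankAt B P 𝔭 = 2) (χ φ χ' φ' : Module.Dual B P)
    (a b c d : P) :
    mnr χ φ a b * mnr χ' φ' c d = mnr χ φ c d * mnr χ' φ' a b := by
  apply eq_of_loc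
  intro 𝔭 _
  obtain ⟨e, he⟩ := local_basis hrank 𝔭
  obtain ⟨s, hs⟩ := he χ'
  obtain ⟨s', hs'⟩ := he φ'
  obtain ⟨t, ht⟩ := he χ
  obtain ⟨u, hu⟩ := he φ
  simp only [mnr, map_sub, map_mul, hs, ht, hu, hs']
  ring

theorem ex_notMem {ι : Type*} (s : Finset ι) {S : Type*} [CommRing S] [IsLocalRing S]
    (f g : ι → S) (h : IsUnit (∑ i ∈ s, f i * g i)) : ∃ i ∈ s, IsUnit (f i) := by
  by_contra! hc
  have : ∑ i ∈ s, f i * g i ∈ IsLocalRing.maximalIdeal S :=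
    Ideal.sum_mem _ fun i hi => Ideal.mul_mem_right _ _
      ((IsLocalRing.mem_maximalIdeal _).2 (hc i hi))
  exact (IsLocalRing.mem_maximalIdeal _).1 this h

theorem rel3 [Module.Finite B P] [Module.Projective B P]
    (hrank : ∀ 𝔭 : PrimeSpectrum B, rankAt B P 𝔭 = 2) {n : ℕ} (p : Fin n → P)
    (ψ : Fin n → Module.Dual B P) (hp : ∀ x, ∑ i, ψ i x • p i = x)
    (𝔭 : Ideal B) (h𝔭 : 𝔭.IsPrime) :
    ∃ (χ φ : Module.Dual B P) (a b : P), mnr χ φ a b ∉ 𝔭 := by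
  obtain ⟨e, -⟩ := local_basis hrank 𝔭
  have key : ∀ (i : Fin 2) (x : P),
      IsUnit (e.repr (LocalizedModule.mkLinearMap 𝔭.primeCompl P x) i) →
      ∃ j, ψ j x ∉ 𝔭 := by
    intro i x hx
    have hx' : e.repr (LocalizedModule.mkLinearMap 𝔭.primeCompl P x) i =
      ∑ j, algebraMap B (Localization.AtPrime 𝔭) (ψ j x) *
        e.repr (LocalizedModule.mkLinearMap 𝔭.primeCompl P (p j)) i := by
      conv_lhs => rw [← hp x]
      simp only [map_sum, map_smul, Finsupp.finsetSum_apply]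
      refine Finset.sum_congr rfl fun j _ => ?_
      rw [← algebraMap_smul (Localization.AtPrime 𝔭) (ψ j x), map_smul, Finsupp.smul_apply,
        smul_eq_mul]
    rw [hx'] at hx
    obtain ⟨j, -, hj⟩ := ex_notMem _ _ _ hx
    exact ⟨j, (IsLocalization.AtPrime.isUnit_to_map_iff (Localization.AtPrime 𝔭) 𝔭 _).1 hj⟩
  obtain ⟨⟨a, s⟩, ha⟩ := IsLocalizedModule.surj 𝔭.primeCompl
    (LocalizedModule.mkLinearMap 𝔭.primeCompl P) (e 0)
  obtain ⟨⟨b, t⟩, hb⟩ := IsLocalizedModule.surj 𝔭.primeCompl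
    (LocalizedModule.mkLinearMap 𝔭.primeCompl P) (e 1)
  simp only [Submonoid.smul_def] at ha hb
  rw [← algebraMap_smul (Localization.AtPrime 𝔭)] at ha hb
  have hs := IsLocalization.map_units (Localization.AtPrime 𝔭) s
  have ht := IsLocalization.map_units (Localization.AtPrime 𝔭) t
  obtain ⟨j, hj⟩ := key 0 a (by
    rw [← ha, map_smul, e.repr_self, Finsupp.smul_apply, Finsupp.single_eq_same, smul_eq_mul,
      mul_one]
    exact hs)
  have hju := (IsLocalization.AtPrime.isUnit_to_map_iff (Localization.AtPrime 𝔭) 𝔭 _).2 hj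
  obtain ⟨k, hk⟩ := key 1 (ψ j a • b - ψ j b • a) (by
    rw [map_sub, map_smul, map_smul, ← algebraMap_smul (Localization.AtPrime 𝔭) (ψ j a),
      ← algebraMap_smul (Localization.AtPrime 𝔭) (ψ j b), ← ha, ← hb]
    simp only [map_sub, map_smul, Finsupp.sub_apply, Finsupp.smul_apply, e.repr_self,
      Finsupp.single_eq_same, smul_eq_mul, mul_one]
    rw [Finsupp.single_eq_of_ne (by decide), mul_zero, mul_zero, sub_zero]
    exact hju.mul ht)
  refine ⟨ψ j, ψ k, a, ψ j a • b - ψ j b • a, ?_⟩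
  have : mnr (ψ j) (ψ k) a (ψ j a • b - ψ j b • a) = ψ j a * ψ k (ψ j a • b - ψ j b • a) := by
    simp only [mnr, map_sub, map_smul, smul_eq_mul]; ring
  rw [this]
  exact fun h => (h𝔭.mem_or_mem h).elim hj hk

/-- all minors at once -/
def om0 : P →ₗ[B] P →ₗ[B] (Module.Dual B P × Module.Dual B P → B) :=
  LinearMap.mk₂ B (fun a b c => mnr c.1 c.2 a b)
    (fun a a' b => by ext c; simp [mnr]; ring) (fun r a b => by ext c; simp [mnr]; ring)
    (fun a b b' => by ext c; simp [mnr]; ring) (fun r a b => by ext c; simp [mnr]; ring)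

theorem om0_apply (a b : P) (c : Module.Dual B P × Module.Dual B P) :
    om0 a b c = mnr c.1 c.2 a b := rfl

/-- the determinant line -/
def Lin (B P : Type*) [CommRing B] [AddCommGroup P] [Module B P] :
    Submodule B (Module.Dual B P × Module.Dual B P → B) :=
  Submodule.span B (Set.range fun q : P × P => om0 q.1 q.2)

theorem om0_mem (a b : P) : om0 a b ∈ Lin B P := Submodule.subset_span ⟨(a, b), rfl⟩

/-- the determinant form -/
def omL : P →ₗ[B] P →ₗ[B] Lin B P :=
  LinearMap.mk₂ B (fun a b => ⟨om0 a b, om0_mem a b⟩)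
    (fun a a' b => by ext; simp) (fun r a b => by ext; simp)
    (fun a b b' => by ext; simp) (fun r a b => by ext; simp)

theorem omL_coe (a b : P) : ((omL a b : Lin B P) : _ → B) = om0 a b := rfl

/-- evaluation -/
def evL (c : Module.Dual B P × Module.Dual B P) : Lin B P →ₗ[B] B :=
  LinearMap.proj c ∘ₗ (Lin B P).subtype

theorem evL_apply (c : Module.Dual B P × Module.Dual B P) (l : Lin B P) :
    evL c l = (l : _ → B) c := rfl

/-- contraction -/
def zL {n : ℕ} (p : Fin n → P) (ψ : Fin n → Module.Dual B P) (χ : Module.Dual B P) :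
    Lin B P →ₗ[B] P :=
  ∑ i, (evL (χ, ψ i)).smulRight (p i)

theorem zL_om {n : ℕ} (p : Fin n → P)
    (ψ : Fin n → Module.Dual B P) (hp : ∀ x, ∑ i, ψ i x • p i = x)
    (χ : Module.Dual B P) (a b : P) : zL p ψ χ (omL a b) = χ a • b - χ b • a := by
  simp only [zL, LinearMap.sum_apply, LinearMap.smulRight_apply, evL_apply, omL_coe, om0_apply,
    mnr, sub_smul, Finset.sum_sub_distrib]
  have h1 : χ a • b = ∑ i, χ a • ψ i b • p i := by rw [← Finset.smul_sum, hp]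
  have h2 : χ b • a = ∑ i, χ b • ψ i a • p i := by rw [← Finset.smul_sum, hp]
  rw [h1, h2]
  congr 1
  · exact Finset.sum_congr rfl fun i _ => mul_smul _ _ _
  · exact Finset.sum_congr rfl fun i _ => by rw [mul_comm, mul_smul]

theorem Lin_ind {q : Lin B P → Prop} (h0 : ∀ a b, q (omL a b)) (hz : q 0)
    (ha : ∀ x y, q x → q y → q (x + y)) (hs : ∀ (r : B) x, q x → q (r • x)) (l : Lin B P) :
    q l := by
  obtain ⟨l, hl⟩ := l
  induction hl using Submodule.span_induction with
  | mem x h => obtain ⟨⟨a, b⟩, rfl⟩ := h; exact h0 a b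
  | zero => exact hz
  | add x y hx hy h1 h2 => exact ha ⟨x, hx⟩ ⟨y, hy⟩ h1 h2
  | smul r x hx h => exact hs r ⟨x, hx⟩ h

theorem Lin_sym [Module.Finite B P] [Module.Projective B P]
    (hrank : ∀ 𝔭 : PrimeSpectrum B, rankAt B P 𝔭 = 2) (c : Module.Dual B P × Module.Dual B P)
    (l l' : Lin B P) : evL c l • l' = evL c l' • l := by
  induction l using Lin_ind with
  | hz => simp
  | ha x y hx hy => rw [map_add, add_smul, hx, hy, smul_add]
  | hs r x hx => rw [map_smul, smul_assoc, hx, smul_comm]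
  | h0 a b =>
    induction l' using Lin_ind with
    | hz => simp
    | ha x y hx hy => rw [map_add, add_smul, ← hx, ← hy, smul_add]
    | hs r x hx => rw [map_smul, smul_assoc, ← hx, smul_comm]
    | h0 a' b' =>
      ext d
      exact rel2 hrank _ _ _ _ _ _ _ _

theorem sympL [Module.Finite B P] [Module.Projective B P]
    (hrank : ∀ 𝔭 : PrimeSpectrum B, rankAt B P 𝔭 = 2) {n : ℕ} (p : Fin n → P)
    (ψ : Fin n → Module.Dual B P) (hp : ∀ x, ∑ i, ψ i x • p i = x) :
    SympData B P (Lin B P) omL (zL p ψ) where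
  alt a := by
    ext c
    simp only [omL_coe, om0_apply, mnr, ZeroMemClass.coe_zero, Pi.zero_apply]; ring
  contr χ x l := by
    induction l using Lin_ind with
    | hz => simp
    | ha x y hx hy => rw [map_add, map_add, hx, hy, smul_add]
    | hs r x hx => rw [map_smul, map_smul, hx, smul_comm]
    | h0 a b =>
      rw [zL_om p ψ hp]
      ext c
      simp only [map_sub, map_smul]
      exact (rel1 hrank χ c.1 c.2 x a b).symm
  zz χ l := by
    induction l using Lin_ind with
    | hz => simp
    | ha x y hx hy => rw [map_add, map_add, hx, hy, add_zero]
    | hs r x hx => rw [map_smul, map_smul, hx, smul_zero]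
    | h0 a b =>
      rw [zL_om p ψ hp, map_sub, map_smul, map_smul, smul_eq_mul, smul_eq_mul]; ring
  symL f l l' := by
    ext c
    have h := congrArg f (Lin_sym hrank c l l')
    rw [map_smul, map_smul, evL_apply, evL_apply, smul_eq_mul, smul_eq_mul] at h
    change f l * (l' : _ → B) c = f l' * (l : _ → B) c
    rw [mul_comm, ← h, mul_comm]
  loc 𝔭 h𝔭 := by
    obtain ⟨χ, φ, a, b, h⟩ := rel3 hrank p ψ hp 𝔭 h𝔭
    exact ⟨evL (χ, φ), a, b, h⟩

theorem det_one [Module.Finite B P] [Module.Projective B P]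
    (hrank : ∀ 𝔭 : PrimeSpectrum B, rankAt B P 𝔭 = 2) {n : ℕ} (p : Fin n → P)
    (ψ : Fin n → Module.Dual B P) (hp : ∀ x, ∑ i, ψ i x • p i = x) (Φ : P →ₗ[B] P)
    (hΦ : ∀ a b, omL (B := B) (Φ a) (Φ b) = omL a b) (𝔭 : Ideal B) [h𝔭 : 𝔭.IsPrime] :
    LinearMap.det (LocalizedModule.map 𝔭.primeCompl Φ) = 1 := by
  obtain ⟨e, he⟩ := local_basis hrank 𝔭
  obtain ⟨χ, φ, a, b, h⟩ := rel3 hrank p ψ hp 𝔭 h𝔭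
  obtain ⟨s, hs⟩ := he χ
  obtain ⟨t, ht⟩ := he φ
  have h2 : ∀ x y, algebraMap B (Localization.AtPrime 𝔭) (mnr χ φ x y) =
      (s 0 * t 1 - s 1 * t 0) * e.det ![LocalizedModule.mkLinearMap 𝔭.primeCompl P x,
        LocalizedModule.mkLinearMap 𝔭.primeCompl P y] := by
    intro x y
    rw [Module.Basis.det_apply, Matrix.det_fin_two]
    simp only [Module.Basis.toMatrix_apply, mnr, map_sub, map_mul, hs, ht, Matrix.cons_val_zero,
      Matrix.cons_val_one]
    ring
  have hu := (IsLocalization.AtPrime.isUnit_to_map_iff (Localization.AtPrime 𝔭) 𝔭 _).2 h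
  have h3 : mnr χ φ (Φ a) (Φ b) = mnr χ φ a b :=
    congrArg (evL (χ, φ)) (hΦ a b)
  have h4 := congrArg (algebraMap B (Localization.AtPrime 𝔭)) h3
  rw [h2, h2] at h4
  rw [h2] at hu
  have h5 : ![LocalizedModule.mkLinearMap 𝔭.primeCompl P (Φ a),
        LocalizedModule.mkLinearMap 𝔭.primeCompl P (Φ b)] =
      (LocalizedModule.map 𝔭.primeCompl Φ) ∘ ![LocalizedModule.mkLinearMap 𝔭.primeCompl P a,
        LocalizedModule.mkLinearMap 𝔭.primeCompl P b] := by
    ext i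
    fin_cases i <;> simp [LocalizedModule.map_mk, LocalizedModule.mkLinearMap_apply]
  rw [h5, Module.Basis.det_comp] at h4
  rw [← hu.mul_left_inj, one_mul]
  refine Eq.trans ?_ h4
  ring

theorem bij_of_det [Module.Finite B P] [Module.Projective B P]
    (Φ : P →ₗ[B] P)
    (h : ∀ (𝔭 : Ideal B) [𝔭.IsPrime],
      LinearMap.det (LocalizedModule.map 𝔭.primeCompl Φ) = 1) : Function.Bijective Φ := by
  apply bijective_of_localized_maximal
  intro J hJ
  have hp : Module.Projective (Localization.AtPrime J) (LocalizedModule J.primeCompl P) :=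
    Module.projective_of_isLocalizedModule J.primeCompl
      (LocalizedModule.mkLinearMap J.primeCompl P)
  have hfree : Module.Free (Localization.AtPrime J) (LocalizedModule J.primeCompl P) :=
    Module.free_of_flat_of_isLocalRing
  have hu : IsUnit (LinearMap.det (LocalizedModule.map J.primeCompl Φ)) := by
    rw [h J]; exact isUnit_one
  exact (Module.End.isUnit_iff _).1 ((LinearMap.isUnit_iff_isUnit_det _).2 hu)

theorem ex_dual [Module.Finite B P] [Module.Projective B P] :
    ∃ (n : ℕ) (p : Fin n → P) (ψ : Fin n → Module.Dual B P), ∀ x, ∑ i, ψ i x • p i = x := by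
  obtain ⟨n, f, hf⟩ := Module.Finite.exists_fin' B P
  obtain ⟨g, hg⟩ := Module.projective_lifting_property f LinearMap.id hf
  refine ⟨n, fun i => f (Pi.single i 1), fun i => LinearMap.proj i ∘ₗ g, fun x => ?_⟩
  have h1 : f (g x) = x := LinearMap.congr_fun hg x
  conv_rhs => rw [← h1, ← Finset.univ_sum_single (g x)]
  rw [map_sum]
  refine Finset.sum_congr rfl fun i _ => ?_
  rw [LinearMap.comp_apply, LinearMap.proj_apply, ← map_smul]
  congr 1
  rw [← Pi.single_smul, smul_eq_mul, mul_one]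

end inst

/-- **Bhatwadekar.** Let `B` be a commutative Noetherian ring of dimension `2`, `I` an ideal with
`dim B/I ≤ 1`, and `P` a finitely generated projective `B`-module of constant rank `2` with
`P/IP` free. Then any element of `SL₂(B/I) ∩ ESp₄(B/I)` lifts to an element of `SL(P)`
(an automorphism of `P` of determinant `1`, i.e. of determinant `1` in every localization). -/
theorem bhatwadekar_sl2_lifting
    (B : Type*) [CommRing B] [IsNoetherianRing B] (hdim : ringKrullDim B = 2)
    (I : Ideal B) (hdimBI : ringKrullDim (B ⧸ I) ≤ 1)
    (P : Type*) [AddCommGroup P] [Module B P] [Module.Finite B P] [Module.Projective B P]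
    (hrank : ∀ 𝔭 : PrimeSpectrum B, rankAt B P 𝔭 = 2)
    (b : Module.Basis (Fin 2) (B ⧸ I) (P ⧸ (I • ⊤ : Submodule B P)))
    (M : Matrix (Fin 2) (Fin 2) (B ⧸ I)) (hdet : M.det = 1)
    (hM : Matrix.toLin' (blockDiag4 M (1 : Matrix (Fin 2) (Fin 2) (B ⧸ I)))
      ∈ ESp4 (B ⧸ I)) :
    ∃ Φ : P ≃ₗ[B] P,
      (∀ 𝔭 : PrimeSpectrum B,
        LinearMap.det (LocalizedModule.map 𝔭.asIdeal.primeCompl (Φ : P →ₗ[B] P)) = 1) ∧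
      (∀ x : P, (Submodule.Quotient.mk (Φ x) : P ⧸ (I • ⊤ : Submodule B P)) =
        ∑ i : Fin 2, M.mulVec (⇑(b.repr (Submodule.Quotient.mk x))) i • b i) := by
  obtain ⟨n, p, ψ, hp⟩ := ex_dual (B := B) (P := P)
  have D := sympL hrank p ψ hp
  let π : B →ₗ[B] B ⧸ I := Algebra.linearMap B (B ⧸ I)
  have hπ : Function.Surjective π := Ideal.Quotient.mk_surjective
  have hlift : ∀ i : Fin 2, ∃ χ : Module.Dual B P, ∀ x,
      Ideal.Quotient.mk I (χ x) = b.repr (Submodule.Quotient.mk x) i := by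
    intro i
    obtain ⟨χ, hχ⟩ := Module.projective_lifting_property π
      ((b.coord i).restrictScalars B ∘ₗ (I • ⊤ : Submodule B P).mkQ) hπ
    exact ⟨χ, fun x => LinearMap.congr_fun hχ x⟩
  obtain ⟨χ, hχ⟩ := hlift 0
  obtain ⟨φ, hφ⟩ := hlift 1
  have E : ModData (omL (B := B) (P := P)) I χ φ (evL (χ, φ)) := by
    refine ⟨fun x h1 h2 => ?_, fun c d => ?_, fun x y => ?_⟩
    · rw [← Ideal.Quotient.eq_zero_iff_mem, hχ] at h1
      rw [← Ideal.Quotient.eq_zero_iff_mem, hφ] at h2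
      rw [← Submodule.Quotient.mk_eq_zero]
      apply b.ext_elem
      intro i
      fin_cases i
      · simpa using h1
      · simpa using h2
    · obtain ⟨x, hx⟩ := Submodule.Quotient.mk_surjective (I • ⊤ : Submodule B P)
        (Ideal.Quotient.mk I c • b 0 + Ideal.Quotient.mk I d • b 1)
      refine ⟨x, ?_, ?_⟩
      · rw [← Ideal.Quotient.eq, hχ, hx]
        simp only [map_add, map_smul, Finsupp.add_apply, Finsupp.smul_apply, b.repr_self, smul_eq_mul]
        simp
      · rw [← Ideal.Quotient.eq, hφ, hx]
        simp only [map_add, map_smul, Finsupp.add_apply, Finsupp.smul_apply, b.repr_self, smul_eq_mul]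
        simp
    · have : evL (χ, φ) (omL x y) = χ x * φ y - φ x * χ y := rfl
      rw [this, sub_self]
      exact I.zero_mem
  obtain ⟨Φ, hΦ, hM'⟩ := lift_main D hdim.le E M hM
  have hd : ∀ (𝔭 : Ideal B) [𝔭.IsPrime],
      LinearMap.det (LocalizedModule.map 𝔭.primeCompl Φ) = 1 :=
    fun 𝔭 _ => det_one hrank p ψ hp Φ hΦ 𝔭
  refine ⟨LinearEquiv.ofBijective Φ (bij_of_det Φ hd), fun 𝔭 => hd 𝔭.asIdeal, fun x => ?_⟩
  apply b.ext_elem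
  intro i
  obtain ⟨h1, h2⟩ := hM' x
  rw [b.repr_sum_self, LinearEquiv.ofBijective_apply, Matrix.mulVec, dotProduct,
    Fin.sum_univ_two]
  simp only [hχ, hφ] at h1 h2
  fin_cases i
  · exact h1
  · exact h2
end

section
/- (Suslin) Let A be a commutative ring and let P be a finitely generated projective A-module of rank d. Let (c, p₁) ∈ A ⊕ P be a unimodular element. Suppose that P/cP is a free A/Ac-module of rank d and that the image p̄₁ of p₁ in P/cP can be extended to a basis of P/cP. Then there exists an A-automorphism Φ of A ⊕ P such that Φ(c^d, p₁) = (1, 0). -/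
/-- One Whitehead step, made explicit. -/
lemma suslin_step {A ι : Type*} [CommRing A] [DecidableEq ι] (a c u : A) (hu : c * u + a = 1)
    (i₀ i : ι) (hi : i ≠ i₀) : ∃ e : (ι → A) ≃ₗ[A] (ι → A), ∀ x,
      e x i₀ = u * (1 + a) * x i₀ - a * x i ∧ e x i = a * x i₀ + c * x i ∧
        ∀ j, j ≠ i₀ → j ≠ i → e x j = x j := by
  have key : c * u * (1 + a) + a * a = 1 := by linear_combination (1 + a) * hu
  refine ⟨
    { toFun := fun x j => if j = i₀ then u * (1 + a) * x i₀ - a * x i else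
        if j = i then a * x i₀ + c * x i else x j
      invFun := fun x j => if j = i₀ then c * x i₀ + a * x i else
        if j = i then - a * x i₀ + u * (1 + a) * x i else x j
      map_add' := ?_
      map_smul' := ?_
      left_inv := ?_
      right_inv := ?_ }, ?_⟩
  · intro x y; ext j
    simp only [Pi.add_apply]
    split_ifs <;> ring
  · intro r x; ext j
    simp only [Pi.smul_apply, smul_eq_mul, RingHom.id_apply]
    split_ifs <;> ring
  · intro x; ext j
    by_cases h0 : j = i₀
    · subst h0; simp [hi]; linear_combination (x j) * key
    by_cases h1 : j = i
    · subst h1; simp [hi]; linear_combination (x j) * key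
    simp [h0, h1]
  · intro x; ext j
    by_cases h0 : j = i₀
    · subst h0; simp [hi]; linear_combination (x j) * key
    by_cases h1 : j = i
    · subst h1; simp [hi]; linear_combination (x j) * key
    simp [h0, h1]
  · intro x
    refine ⟨by simp, by simp [hi], fun j h0 h1 => by simp [h0, h1]⟩

/-- `c • 1` agrees modulo `a` with an automorphism times a diagonal matrix. -/
lemma suslin_diag {A ι : Type*} [CommRing A] [DecidableEq ι] (a c u : A) (hu : c * u + a = 1)
    (i₀ : ι) (s : Finset ι) (hs : i₀ ∉ s) :
    ∃ (e : (ι → A) ≃ₗ[A] (ι → A)) (η : (ι → A) →ₗ[A] (ι → A)), ∀ x : ι → A,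
      e (fun j => (if j = i₀ then c ^ (s.card + 1) else if j ∈ s then 1 else c) * x j)
        = c • x + a • η x := by
  induction s using Finset.induction_on with
  | empty =>
    refine ⟨LinearEquiv.refl _ _, 0, fun x => ?_⟩
    ext j
    simp
  | insert i s his ih =>
    have hi : i ≠ i₀ := by rintro rfl; simp at hs
    obtain ⟨e, η, he⟩ := ih (fun h => hs (Finset.mem_insert_of_mem h))
    obtain ⟨f, hf⟩ := suslin_step a c u hu i₀ i hi
    let θ : (ι → A) →ₗ[A] (ι → A) := LinearMap.pi fun j =>
      if j = i₀ then (-(a * c ^ (s.card + 1))) • LinearMap.proj i₀ - LinearMap.proj i else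
      if j = i then (c ^ (s.card + 2)) • LinearMap.proj i₀ else 0
    refine ⟨f.trans e, η + e.toLinearMap ∘ₗ θ, fun x => ?_⟩
    have h1 : f (fun j => (if j = i₀ then c ^ ((insert i s).card + 1) else
        if j ∈ insert i s then 1 else c) * x j)
        = (fun j => (if j = i₀ then c ^ (s.card + 1) else if j ∈ s then 1 else c) * x j)
          + a • θ x := by
      rw [Finset.card_insert_of_notMem his]
      obtain ⟨g0, g1, g2⟩ := hf (fun j => (if j = i₀ then c ^ (s.card + 1 + 1) else
        if j ∈ insert i s then 1 else c) * x j)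
      ext j
      by_cases h0 : j = i₀
      · subst h0
        rw [g0]
        simp [hi, θ]
        linear_combination (1 + a) * c ^ (s.card + 1) * x j * hu
      by_cases h1 : j = i
      · subst h1
        rw [g1]
        simp [hi, θ, his]
        ring
      rw [g2 j h0 h1]
      simp [h0, h1, θ]
    rw [LinearEquiv.trans_apply, h1, map_add, he, map_smul]
    simp [smul_add, add_assoc]

/-- The algebraic core, given the lifted data. -/
lemma suslin_core {A P ι : Type*} [CommRing A] [AddCommGroup P] [Module A P] [Fintype ι]
    [DecidableEq ι] (c : A) (i₀ : ι) (φ : (ι → A) →ₗ[A] P) (ψ : P →ₗ[A] (ι → A))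
    (γ : P →ₗ[A] P) (δ : (ι → A) →ₗ[A] (ι → A))
    (hγ : ∀ y, φ (ψ y) = y + c • γ y) (hδ : ∀ x, ψ (φ x) = x + c • δ x) :
    ∃ π : (A × P) →ₗ[A] P, Function.Surjective π ∧
      π (c ^ (Fintype.card ι), φ (Pi.single i₀ 1)) = 0 ∧
      ∀ w, π w = 0 → ∃ z : A, w = z • (c ^ (Fintype.card ι), φ (Pi.single i₀ 1)) := by
  -- the adjugate
  obtain ⟨χ, r, hχ⟩ : ∃ (χ : P →ₗ[A] (ι → A)) (r : A), ∀ x, χ (φ x) = (1 + c * r) • x := by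
    let M := LinearMap.toMatrix' δ
    refine ⟨(Matrix.toLin' (1 + c • M).adjugate) ∘ₗ ψ, Matrix.trace M + 
      ((Matrix.det (1 + (Polynomial.X : Polynomial A) • M.map Polynomial.C)).divX.divX).eval c * c,
      fun x => ?_⟩
    have h1 : ψ (φ x) = (1 + c • M).mulVec x := by
      rw [hδ, Matrix.add_mulVec, Matrix.one_mulVec, Matrix.smul_mulVec]
      congr 2
      rw [← Matrix.toLin'_apply, Matrix.toLin'_toMatrix']
    rw [LinearMap.comp_apply, h1, Matrix.toLin'_apply, Matrix.mulVec_mulVec, Matrix.adjugate_mul,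
      Matrix.smul_mulVec, Matrix.one_mulVec, Matrix.det_one_add_smul]
    congr 1
    ring
  set a := 1 + c * r with ha
  obtain ⟨e, η, he⟩ := suslin_diag a c (-r) (by rw [ha]; ring) i₀ (Finset.univ.erase i₀)
    (by simp)
  have hcard : (Finset.univ.erase i₀).card + 1 = Fintype.card ι := by
    rw [Finset.card_erase_add_one (Finset.mem_univ _)]; rfl
  rw [hcard] at he
  -- exactness of the basic complex
  have hex : ∀ x y, φ x = c • y → ∃ z, x = c • z ∧ y = φ z := by
    intro x y h
    have h1 : x = c • (ψ y - δ x) := by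
      have := hδ x
      rw [h, map_smul] at this
      rw [smul_sub, this]; abel
    refine ⟨ψ y - δ x, h1, ?_⟩
    set z := ψ y - δ x with hz
    have h2 : φ z = y + c • γ y - φ (δ x) := by rw [hz, map_sub, hγ]
    have h3 : c • γ y = c • γ (φ z) := by
      rw [← map_smul, ← h, h1, map_smul, map_smul]
    have h4 : φ (δ x) = c • φ (δ z) := by rw [h1, map_smul, map_smul]
    have h5 : c • φ (δ z) = c • γ (φ z) := by
      have := hγ (φ z)
      rw [hδ, map_add, map_smul] at this
      exact add_left_cancel this
    rw [h2, h3, h4, h5]; abel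
  let D : (ι → A) → (ι → A) := fun x j => (if j = i₀ then c ^ (Fintype.card ι) else
    if j ∈ Finset.univ.erase i₀ then 1 else c) * x j
  have heD : ∀ x, e (D x) = c • x + a • η x := he
  -- the big surjection
  let π₁ : ((ι → A) × P) →ₗ[A] P :=
    (φ ∘ₗ e.toLinearMap).coprod (- (φ ∘ₗ η ∘ₗ χ) - c • LinearMap.id)
  have hπ₁ : ∀ x y, π₁ (x, y) = φ (e x - η (χ y)) - c • y := by
    intro x y
    simp [π₁]; abel
  have hker : ∀ x y, π₁ (x, y) = 0 → ∃ z, x = D z ∧ y = φ z := by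
    intro x y h
    rw [hπ₁, sub_eq_zero] at h
    obtain ⟨z, h1, h2⟩ := hex _ _ h
    refine ⟨z, ?_, h2⟩
    apply e.injective
    rw [heD, ← map_smul, ← hχ, ← h2, ← h1]; abel
  have hker' : ∀ z, π₁ (D z, φ z) = 0 := by
    intro z
    rw [hπ₁, heD, hχ, map_smul]; simp
  have hsurj : ∀ y, ∃ w, π₁ w = y := by
    intro y
    refine ⟨(e.symm (ψ y + η (χ (γ y))), γ y), ?_⟩
    rw [hπ₁]
    simp [hγ]
  refine ⟨π₁ ∘ₗ (LinearMap.prodMap (LinearMap.single A (fun _ => A) i₀) LinearMap.id), ?_, ?_, ?_⟩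
  · intro y
    obtain ⟨⟨x, p⟩, hw⟩ := hsurj y
    let z : ι → A := Function.update x i₀ 0
    refine ⟨(x i₀, p - φ z), ?_⟩
    rw [← hw, ← sub_zero (π₁ (x, p)), ← hker' z, ← map_sub]
    simp only [LinearMap.comp_apply, LinearMap.prodMap_apply, LinearMap.id_apply]
    congr 1
    refine Prod.ext ?_ rfl
    ext j
    by_cases h : j = i₀
    · subst h; simp [D, z]
    · simp [D, z, h]
  · rw [← hker' (Pi.single i₀ 1)]
    simp only [LinearMap.comp_apply, LinearMap.prodMap_apply, LinearMap.id_apply]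
    congr 1
    refine Prod.ext ?_ rfl
    ext j
    by_cases h : j = i₀
    · subst h; simp [D]
    · simp [D, h]
  · rintro ⟨t, y⟩ h
    obtain ⟨z, h1, h2⟩ := hker _ _ h
    have hz : z = z i₀ • Pi.single i₀ 1 := by
      ext j
      by_cases h : j = i₀
      · subst h; simp
      · have := congrFun h1 j
        simp [D, h] at this
        simp [h, ← this]
    refine ⟨z i₀, ?_⟩
    have h3 := congrFun h1 i₀
    simp [D] at h3
    refine Prod.ext ?_ ?_
    · simp [h3, mul_comm]
    · simp only [Prod.smul_mk]
      rw [← map_smul, ← hz, ← h2]; rfl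

/-- **Suslin.** Let `A` be a commutative ring and `P` a finitely generated projective
`A`-module of rank `d`.  Let `(c, p₁) ∈ A ⊕ P` be unimodular, suppose `P/cP` is a free
`A/Ac`-module of rank `d`, and that the image of `p₁` in `P/cP` can be extended to a basis of
`P/cP`.  Then there is an `A`-automorphism `Φ` of `A ⊕ P` with `Φ(c^d, p₁) = (1, 0)`. -/
theorem suslin_completion
    (A : Type*) [CommRing A]
    (P : Type*) [AddCommGroup P] [Module A P] [Module.Finite A P] [Module.Projective A P]
    (d : ℕ) (hrank : ∀ 𝔭 : PrimeSpectrum A, rankAt A P 𝔭 = d)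
    (c : A) (p₁ : P) (hum : IsUnimodular A ((c, p₁) : A × P))
    (hbasis : ∃ (b : Module.Basis (Fin d) (A ⧸ Ideal.span {c})
        (P ⧸ ((Ideal.span {c}) • ⊤ : Submodule A P))) (i : Fin d),
      b i = Submodule.Quotient.mk p₁) :
    ∃ Φ : (A × P) ≃ₗ[A] (A × P), Φ (c ^ d, p₁) = (1, 0) := by
  obtain ⟨I, hI⟩ : ∃ I : Ideal A, I = Ideal.span {c} := ⟨_, rfl⟩
  rw [← hI] at hbasis
  obtain ⟨b, i₀, hb⟩ := hbasis
  -- lifts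
  have hq : ∃ q : Fin d → P, q i₀ = p₁ ∧
      ∀ j, (Submodule.Quotient.mk (q j) : P ⧸ (I • ⊤ : Submodule A P)) = b j := by
    choose q hq using fun j => Submodule.Quotient.mk_surjective (I • ⊤ : Submodule A P) (b j)
    refine ⟨Function.update q i₀ p₁, by simp, fun j => ?_⟩
    by_cases h : j = i₀
    · subst h; simp [hb]
    · simp [h, hq]
  obtain ⟨q, hq0, hq⟩ := hq
  let φ : (Fin d → A) →ₗ[A] P := Fintype.linearCombination A q
  have hφ : ∀ x, φ x = ∑ j, x j • q j := fun x => by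
    simp [φ, Fintype.linearCombination_apply]
  let red : (Fin d → A) →ₗ[A] (Fin d → A ⧸ I) :=
    LinearMap.pi fun j => (Ideal.Quotient.mkₐ A I).toLinearMap ∘ₗ LinearMap.proj j
  have hred : Function.Surjective red := by
    intro y
    choose x hx using fun j => Ideal.Quotient.mk_surjective (y j)
    exact ⟨x, funext hx⟩
  let ρ : P →ₗ[A] (Fin d → A ⧸ I) :=
    (b.equivFun.toLinearMap.restrictScalars A) ∘ₗ (I • ⊤ : Submodule A P).mkQ
  obtain ⟨ψ, hψ⟩ := Module.projective_lifting_property red ρ hred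
  have hψ' : ∀ y j, Ideal.Quotient.mk I (ψ y j) = b.equivFun (Submodule.Quotient.mk y) j :=
    fun y j => congrFun (LinearMap.congr_fun hψ y) j
  have hmkφ : ∀ x : Fin d → A, (Submodule.Quotient.mk (φ x) : P ⧸ (I • ⊤ : Submodule A P))
      = ∑ j, (Ideal.Quotient.mk I (x j)) • b j := by
    intro x
    rw [hφ, ← Submodule.mkQ_apply, map_sum]
    refine Finset.sum_congr rfl fun j _ => ?_
    rw [map_smul, Submodule.mkQ_apply, hq]
    rfl
  have hcI : ∀ x : A, x ∈ I → ∃ y, x = c * y := fun x hx => by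
    rw [hI] at hx
    obtain ⟨y, hy⟩ := Ideal.mem_span_singleton'.1 hx
    exact ⟨y, by rw [← hy, mul_comm]⟩
  have hcP : ∀ y : P, y ∈ (I • ⊤ : Submodule A P) → ∃ z, c • z = y := fun y hy => by
    rw [hI, Submodule.ideal_span_singleton_smul] at hy
    obtain ⟨z, -, hz⟩ := hy
    exact ⟨z, hz⟩
  -- a divisibility lifting principle
  have hγ : ∃ γ : P →ₗ[A] P, ∀ y, φ (ψ y) = y + c • γ y := by
    let m : P →ₗ[A] P := LinearMap.lsmul A P c
    have hmem : ∀ y, (φ ∘ₗ ψ - LinearMap.id : P →ₗ[A] P) y ∈ LinearMap.range m := by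
      intro y
      obtain ⟨z, hz⟩ := hcP ((φ ∘ₗ ψ - LinearMap.id : P →ₗ[A] P) y) (by
        rw [← Submodule.Quotient.mk_eq_zero]
        simp only [LinearMap.sub_apply, LinearMap.comp_apply, LinearMap.id_apply,
          Submodule.Quotient.mk_sub]
        rw [hmkφ, sub_eq_zero]
        simp only [hψ']
        exact b.sum_equivFun _)
      exact ⟨z, hz⟩
    obtain ⟨γ, hγ⟩ := Module.projective_lifting_property m.rangeRestrict
      ((φ ∘ₗ ψ - LinearMap.id : P →ₗ[A] P).codRestrict (LinearMap.range m) hmem)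
      (LinearMap.surjective_rangeRestrict m)
    refine ⟨γ, fun y => ?_⟩
    have h : c • γ y = φ (ψ y) - y := congrArg Subtype.val (LinearMap.congr_fun hγ y)
    rw [h]; abel
  have hδ : ∃ δ : (Fin d → A) →ₗ[A] (Fin d → A), ∀ x, ψ (φ x) = x + c • δ x := by
    let m : (Fin d → A) →ₗ[A] (Fin d → A) := LinearMap.lsmul A (Fin d → A) c
    have hmem : ∀ y, (ψ ∘ₗ φ - LinearMap.id : (Fin d → A) →ₗ[A] (Fin d → A)) y ∈ LinearMap.range m := by
      intro y
      have : ∀ j, ∃ z, (ψ ∘ₗ φ - LinearMap.id : (Fin d → A) →ₗ[A] (Fin d → A)) y j = c * z := by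
        intro j
        apply hcI
        rw [← Ideal.Quotient.eq_zero_iff_mem]
        simp only [LinearMap.sub_apply, LinearMap.comp_apply, LinearMap.id_apply, Pi.sub_apply,
          map_sub]
        rw [hψ', hmkφ, sub_eq_zero, ← b.equivFun_symm_apply (fun j => Ideal.Quotient.mk I (y j)),
          LinearEquiv.apply_symm_apply]
      choose z hz using this
      exact ⟨z, funext fun j => (hz j).symm⟩
    obtain ⟨γ, hγ⟩ := Module.projective_lifting_property m.rangeRestrict
      ((ψ ∘ₗ φ - LinearMap.id : (Fin d → A) →ₗ[A] (Fin d → A)).codRestrict (LinearMap.range m) hmem)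
      (LinearMap.surjective_rangeRestrict m)
    refine ⟨γ, fun y => ?_⟩
    have h : c • γ y = ψ (φ y) - y := congrArg Subtype.val (LinearMap.congr_fun hγ y)
    rw [h]; abel
  obtain ⟨γ, hγ⟩ := hγ
  obtain ⟨δ, hδ⟩ := hδ
  obtain ⟨π, hπs, hπv, hπk⟩ := suslin_core c i₀ φ ψ γ δ hγ hδ
  have hφ0 : φ (Pi.single i₀ 1) = p₁ := by
    rw [hφ, Finset.sum_eq_single i₀] <;> simp +contextual [hq0]
  rw [hφ0, Fintype.card_fin] at hπk hπv
  -- a functional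
  obtain ⟨f, hf⟩ : ∃ f : (A × P) →ₗ[A] A, f (c ^ d, p₁) = 1 := by
    obtain ⟨g, hg⟩ := hum
    have h1 : c * g (1, 0) + g (0, p₁) = 1 := by
      refine Eq.trans ?_ hg
      rw [← smul_eq_mul, ← map_smul, ← map_add]
      congr 1
      simp
    have h2 : IsCoprime c (g (0, p₁)) := ⟨g (1, 0), 1, by linear_combination h1⟩
    obtain ⟨s, t, hst⟩ := h2.pow_left (m := d)
    refine ⟨(s • LinearMap.id).coprod (t • (g ∘ₗ LinearMap.inr A A P)), ?_⟩
    simpa using hst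
  let F : (A × P) →ₗ[A] (A × P) := f.prod π
  have hF : Function.Bijective F := by
    constructor
    · rw [injective_iff_map_eq_zero]
      intro w hw
      have h1 : f w = 0 := congrArg Prod.fst hw
      have h2 : π w = 0 := congrArg Prod.snd hw
      obtain ⟨z, rfl⟩ := hπk w h2
      rw [map_smul, hf] at h1
      have : z = 0 := by simpa using h1
      rw [this, zero_smul]
    · rintro ⟨t, y⟩
      obtain ⟨w, rfl⟩ := hπs y
      refine ⟨w + (t - f w) • (c ^ d, p₁), ?_⟩
      refine Prod.ext ?_ ?_
      · change f _ = t
        rw [map_add, map_smul, hf]; simp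
      · change π _ = π w
        rw [map_add, map_smul, hπv]; simp
  refine ⟨LinearEquiv.ofBijective F hF, ?_⟩
  change (f _, π _) = _
  rw [hf, hπv]
end

section
/- Let A be a reduced affine algebra of dimension d over ℝ and X = Spec A. Let J be an ideal of A of height ≥ 1. Let f ∈ A be an element not belonging to any real maximal ideal of A. Let P be a finitely generated projective A_f-module of rank d − 1 and let (a, p) ∈ Um(A_f ⊕ P). Then there exist h ∈ 1 + fA and an automorphism Δ of A_{fh} ⊕ P_{fh} such that, writing (a, p)Δ = (b, p̃): (1) b > 0 on X(ℝ) ∩ Spec A_{fh}; (2) the closed subscheme Z(b) of Spec A_{fh} is smooth of dimension ≤ d − 1 (i.e. for every prime ideal 𝔭 of A_{fh} containing b, (A_{fh}/bA_{fh})_𝔭 is a regular local ring of dimension ≤ d − 1); and (3) (b, p̃) ≡ (1, 0) modulo J·A_{fh} (i.e. b − 1 ∈ J·A_{fh} and p̃ ∈ J·P_{fh}). -/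
/-- A commutative ring is *regular local* if it is a Noetherian local ring whose maximal ideal
can be generated by (Krull dimension)-many elements. -/
def IsRegularLocal (R : Type*) [CommRing R] : Prop :=
  IsNoetherianRing R ∧ ∃ _h : IsLocalRing R, ∃ s : Finset R,
    Ideal.span (s : Set R) = IsLocalRing.maximalIdeal R ∧
      (s.card : WithBot ℕ∞) = ringKrullDim R


section LA
open Polynomial

/-- The elimination step: drop the last vector after adding multiples of it to the others. -/
def elimStep {V : Type*} {K : Type*} [Semiring K] [AddCommMonoid V] [Module K V] {n : ℕ}
    (s : K) (v : Fin (n + 1) → V) : Fin n → V :=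
  fun i => v i.castSucc + s ^ ((i : ℕ) + 1) • v (Fin.last n)

lemma la_span_le {K V : Type*} [Field K] [AddCommGroup V] [Module K V] {n : ℕ}
    (s : K) (v : Fin (n + 1) → V) :
    Submodule.span K (Set.range v) ≤
      Submodule.span K (Set.range (elimStep s v)) ⊔ Submodule.span K {v (Fin.last n)} := by
  rw [Submodule.span_le]
  rintro _ ⟨i, rfl⟩
  refine Fin.lastCases ?_ (fun i => ?_) i
  · exact Submodule.mem_sup_right (Submodule.mem_span_singleton_self _)
  · have h1 : elimStep s v i ∈ Submodule.span K (Set.range (elimStep s v)) :=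
      Submodule.subset_span ⟨i, rfl⟩
    have h2 : v i.castSucc = elimStep s v i + (-(s ^ ((i : ℕ) + 1))) • v (Fin.last n) := by
      simp [elimStep]
    rw [h2]
    exact Submodule.add_mem_sup h1
      (Submodule.smul_mem _ _ (Submodule.mem_span_singleton_self _))

lemma la_rank_le {K V : Type*} [Field K] [AddCommGroup V] [Module K V] [FiniteDimensional K V]
    {n : ℕ} (s : K) (v : Fin (n + 1) → V) :
    Module.finrank K (Submodule.span K (Set.range v)) ≤
      Module.finrank K (Submodule.span K (Set.range (elimStep s v))) + 1 := by
  refine (Submodule.finrank_mono (la_span_le s v)).trans ?_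
  refine (Submodule.finrank_add_le_finrank_add_finrank _ _).trans ?_
  gcongr
  exact (finrank_span_le_card _).trans (by simp)

lemma la_finite_bad {F K V : Type*} [Field F] [Field K] [AddCommGroup V] [Module K V]
    [FiniteDimensional K V] (τ : F →+* K) {n : ℕ} (v : Fin (n + 1) → V)
    (hv : Module.finrank K (Submodule.span K (Set.range v)) ≤ n) :
    {s : F | Module.finrank K (Submodule.span K (Set.range (elimStep (τ s) v))) <
      Module.finrank K (Submodule.span K (Set.range v))}.Finite := by
  have hdep : ¬ LinearIndependent K v := by
    intro h
    have := finrank_span_eq_card h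
    simp at this
    omega
  rw [Fintype.not_linearIndependent_iff] at hdep
  obtain ⟨c, hc, i0, hi0⟩ := hdep
  let Q : K[X] := ∑ i : Fin n, monomial ((i : ℕ) + 1) (c i.castSucc) - C (c (Fin.last n))
  have hQ : Q ≠ 0 := by
    intro hQ
    apply hi0
    revert i0
    have h0 : ∀ k, Q.coeff k = 0 := by simp [hQ]
    intro i0 
    refine Fin.lastCases ?_ (fun i => ?_) i0
    · have := h0 0
      simpa [Q, coeff_monomial] using this
    · have := h0 ((i : ℕ) + 1)
      simp only [Q, coeff_sub, finsetSum_coeff, coeff_monomial, coeff_C] at this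
      rw [Finset.sum_eq_single i] at this
      · simpa using this
      · intro b _ hb
        rw [if_neg]
        intro h
        exact hb (Fin.ext (by omega))
      · simp
  have hfin : {s : F | Q.eval (τ s) = 0}.Finite := by
    refine Set.Finite.subset
      ((Polynomial.finite_setOfPred_isRoot hQ).preimage (τ.injective.injOn)) ?_
    intro s hs
    exact hs
  refine hfin.subset ?_
  intro s hs
  by_contra hne
  rw [Set.mem_ofPred_eq] at hs
  apply not_le_of_gt hs
  apply Submodule.finrank_mono
  refine (la_span_le (τ s) v).trans (sup_le le_rfl ?_)
  rw [Submodule.span_singleton_le_iff_mem]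
  have key : Q.eval (τ s) • v (Fin.last n) = ∑ i : Fin n, c i.castSucc • elimStep (τ s) v i := by
    rw [Fin.sum_univ_castSucc] at hc
    have : ∑ i : Fin n, c i.castSucc • elimStep (τ s) v i =
      ∑ i : Fin n, c i.castSucc • v i.castSucc +
        (∑ i : Fin n, c i.castSucc * (τ s) ^ ((i : ℕ) + 1)) • v (Fin.last n) := by
      simp [elimStep, Finset.sum_add_distrib, Finset.sum_smul, mul_smul]
    rw [this, eq_neg_of_add_eq_zero_left hc]
    simp [Q, eval_finsetSum, sub_smul]
    abel
  have h2 : v (Fin.last n) = (Q.eval (τ s))⁻¹ • ∑ i : Fin n, c i.castSucc • elimStep (τ s) v i := by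
    rw [← key, smul_smul, inv_mul_cancel₀ hne, one_smul]
  rw [h2]
  exact Submodule.smul_mem _ _ (Submodule.sum_mem _ fun i _ =>
    Submodule.smul_mem _ _ (Submodule.subset_span ⟨i, rfl⟩))

/-- A family of vectors of rank at least `k` has a nonvanishing `k × k` minor. -/
lemma la_exists_minor {K : Type*} [Field K] {n N k : ℕ} (v : Fin n → Fin N → K)
    (h : k ≤ Module.finrank K (Submodule.span K (Set.range v))) :
    ∃ (r : Fin k → Fin n) (c : Fin k → Fin N),
      (Matrix.of fun a b => v (r a) (c b)).det ≠ 0 := by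
  have aux : ∀ {n N : ℕ} (v : Fin n → Fin N → K),
      k ≤ Module.finrank K (Submodule.span K (Set.range v)) →
      ∃ r : Fin k → Fin n, LinearIndependent K (v ∘ r) := by
    intro n N v h
    obtain ⟨s, hs1, hs2, hs3⟩ := exists_linearIndependent K (Set.range v)
    have hfin : s.Finite := (Set.finite_range v).subset hs1
    have := hfin.fintype
    have hcard : Fintype.card s = Module.finrank K (Submodule.span K (Set.range v)) := by
      rw [← hs2]
      have := finrank_span_eq_card hs3
      rw [Subtype.range_coe] at this
      exact this.symm
    let e : Fin k → s := fun i => (Fintype.equivFin s).symm (Fin.castLE (by omega) i)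
    have he : Function.Injective e := by
      intro i j hij
      simpa [e] using hij
    choose g hg using fun x : s => hs1 x.2
    refine ⟨fun i => g (e i), ?_⟩
    have : v ∘ (fun i => g (e i)) = (Subtype.val : s → _) ∘ e := by
      funext i
      simp [hg]
    rw [this]
    exact hs3.comp e he
  obtain ⟨r, hr⟩ := aux v h
  let M : Matrix (Fin k) (Fin N) K := Matrix.of (v ∘ r)
  have hM : M.rank = k := by
    have := LinearIndependent.rank_matrix (M := M) hr
    simpa using this
  have h2 : k ≤ Module.finrank K (Submodule.span K (Set.range M.col)) := by
    rw [← Matrix.rank_eq_finrank_span_cols, hM]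
  obtain ⟨c, hc⟩ := aux M.col h2
  refine ⟨r, c, ?_⟩
  have h3 : IsUnit (Matrix.of fun a b => v (r a) (c b)) := by
    rw [← Matrix.linearIndependent_cols_iff_isUnit]
    exact hc
  exact ((Matrix.isUnit_iff_isUnit_det _).1 h3).ne_zero

lemma la_minor_le {K : Type*} [Field K] {n N k : ℕ} (v : Fin n → Fin N → K)
    (r : Fin k → Fin n) (c : Fin k → Fin N)
    (h : (Matrix.of fun a b => v (r a) (c b)).det ≠ 0) :
    k ≤ Module.finrank K (Submodule.span K (Set.range v)) := by
  have h3 : IsUnit (Matrix.of fun a b => v (r a) (c b)) :=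
    (Matrix.isUnit_iff_isUnit_det _).2 h.isUnit
  rw [← Matrix.linearIndependent_rows_iff_isUnit] at h3
  have h4 : LinearIndependent K (v ∘ r) := by
    refine LinearIndependent.of_comp (LinearMap.funLeft K K c) ?_
    exact h3
  have := finrank_span_eq_card h4
  rw [Fintype.card_fin] at this
  rw [← this]
  exact Submodule.finrank_mono (Submodule.span_mono (Set.range_comp_subset_range _ _))

end LA

section EE

/-- The rank at the prime `x` of a family of vectors over `R`. -/
noncomputable def rkAt {R : Type*} [CommRing R] {n N : ℕ} (x : PrimeSpectrum R)
    (m : Fin n → Fin N → R) : ℕ :=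
  Module.finrank x.asIdeal.ResidueField (Submodule.span x.asIdeal.ResidueField
    (Set.range (fun i l => algebraMap R x.asIdeal.ResidueField (m i l))))

lemma ee_isClosed {R : Type*} [CommRing R] {n N : ℕ} (m : Fin n → Fin N → R) (k : ℕ) :
    ∃ I : Ideal R, ∀ x : PrimeSpectrum R, I ≤ x.asIdeal ↔ rkAt x m ≤ k := by
  refine ⟨Ideal.span {y | ∃ (r : Fin (k + 1) → Fin n) (c : Fin (k + 1) → Fin N),
    (Matrix.of fun a b => m (r a) (c b)).det = y}, fun x => ?_⟩
  have hdet : ∀ (r : Fin (k + 1) → Fin n) (c : Fin (k + 1) → Fin N),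
      (Matrix.of fun a b => m (r a) (c b)).det ∈ x.asIdeal ↔
      (Matrix.of fun a b => algebraMap R x.asIdeal.ResidueField (m (r a) (c b))).det = 0 := by
    intro r c
    rw [← Ideal.algebraMap_residueField_eq_zero, RingHom.map_det]
    rfl
  rw [Ideal.span_le]
  constructor
  · intro h
    by_contra hk
    obtain ⟨r, c, hrc⟩ := la_exists_minor (k := k + 1)
      (fun i l => algebraMap R x.asIdeal.ResidueField (m i l)) (by
        unfold rkAt at hk
        omega)
    exact hrc ((hdet r c).1 (h ⟨r, c, rfl⟩))
  · rintro h _ ⟨r, c, rfl⟩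
    rw [SetLike.mem_coe, hdet]
    by_contra hne
    have := la_minor_le (fun i l => algebraMap R x.asIdeal.ResidueField (m i l)) r c hne
    unfold rkAt at h
    omega

lemma ee_step {F R : Type*} [Field F] [Infinite F] [CommRing R] [Algebra F R] [IsNoetherianRing R]
    {n N : ℕ} (m : Fin (n + 1) → Fin N → R) (U : Set (PrimeSpectrum R))
    (hU : ∀ x ∈ U, ∀ y ≤ x, y ∈ U)
    (w : PrimeSpectrum R → ℕ) (hw : ∀ x y, x < y → w y < w x)
    {ι : Type*} [Finite ι] (I : ι → Ideal R) (e : ι → ℕ)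
    (h : ∀ i, ∀ x ∈ U, I i ≤ x.asIdeal → w x ≤ rkAt x m + e i ∨ n + 1 ≤ rkAt x m) :
    ∃ s : F, ∀ i, ∀ x ∈ U, I i ≤ x.asIdeal →
      w x ≤ rkAt x (elimStep (algebraMap F R s) m) + e i ∨
        n ≤ rkAt x (elimStep (algebraMap F R s) m) := by
  choose Y hY using ee_isClosed m
  have hvec : ∀ (x : PrimeSpectrum R) (s : F),
      (fun i l => algebraMap R x.asIdeal.ResidueField (elimStep (algebraMap F R s) m i l)) =
      elimStep (((algebraMap R x.asIdeal.ResidueField).comp (algebraMap F R)) s)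
        (fun i l => algebraMap R x.asIdeal.ResidueField (m i l)) := by
    intro x s
    funext i l
    simp [elimStep]
  have hle : ∀ (x : PrimeSpectrum R) (s : F),
      rkAt x m ≤ rkAt x (elimStep (algebraMap F R s) m) + 1 := by
    intro x s
    unfold rkAt
    rw [hvec]
    exact la_rank_le _ _
  have hbad : ∀ x : PrimeSpectrum R, rkAt x m ≤ n →
      {s : F | rkAt x (elimStep (algebraMap F R s) m) < rkAt x m}.Finite := by
    intro x hx
    have := la_finite_bad ((algebraMap R x.asIdeal.ResidueField).comp (algebraMap F R))
        (fun i l => algebraMap R x.asIdeal.ResidueField (m i l)) hx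
    refine this.subset fun s hs => ?_
    rw [Set.mem_ofPred_eq] at hs ⊢
    unfold rkAt at hs
    rwa [hvec] at hs
  -- the finite set of critical primes
  let T : Set (PrimeSpectrum R) :=
    ⋃ i : ι, ⋃ k : Fin (n + 1), {x | x.asIdeal ∈ (Y k ⊔ I i).minimalPrimes}
  have hT : T.Finite := by
    refine Set.finite_iUnion fun i => Set.finite_iUnion fun k => ?_
    have := (Y k ⊔ I i).finite_minimalPrimes_of_isNoetherianRing R
    refine Set.Finite.subset (this.preimage (f := PrimeSpectrum.asIdeal) ?_) (fun x hx => hx)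
    intro x _ y _ hxy
    exact PrimeSpectrum.ext hxy
  let Bad : Set F := ⋃ x ∈ {x ∈ T | rkAt x m ≤ n},
    {s : F | rkAt x (elimStep (algebraMap F R s) m) < rkAt x m}
  have hBad : Bad.Finite := by
    refine Set.Finite.biUnion (hT.subset (fun x hx => hx.1)) (fun x hx => hbad x hx.2)
  obtain ⟨s, hs⟩ := hBad.exists_notMem
  refine ⟨s, fun i x hxU hIx => ?_⟩
  by_cases hk : n + 1 ≤ rkAt x m
  · right
    have := hle x s
    omega
  have h1 := (h i x hxU hIx).resolve_right hk
  by_contra! hcon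
  have h2 := hle x s
  have hkn : rkAt x m ≤ n := by omega
  have hxT : x ∈ T := by
    refine Set.mem_iUnion.2 ⟨i, Set.mem_iUnion.2 ⟨⟨rkAt x m, by omega⟩, ?_⟩⟩
    refine ⟨⟨x.2, sup_le ((hY _ x).2 le_rfl) hIx⟩, ?_⟩
    rintro J ⟨hJp, hJ⟩ hJx
    by_contra hlt
    let y : PrimeSpectrum R := ⟨J, hJp⟩
    have hyx : y < x := lt_of_le_not_ge hJx hlt
    have h3 := (hY _ y).1 (le_sup_left.trans hJ)
    have h4 := h i y (hU x hxU y hyx.le) (le_sup_right.trans hJ)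
    have h5 := hw y x hyx
    simp only at h3
    omega
  apply hs
  refine Set.mem_iUnion₂.2 ⟨x, ⟨hxT, hkn⟩, ?_⟩
  rw [Set.mem_ofPred_eq]
  omega

lemma ee_iterate {F R : Type*} [Field F] [Infinite F] [CommRing R] [Algebra F R]
    [IsNoetherianRing R] {P : Type*} [AddCommGroup P] [Module R P]
    {N : ℕ} (emb : P →ₗ[R] (Fin N → R)) (U : Set (PrimeSpectrum R))
    (hU : ∀ x ∈ U, ∀ y ≤ x, y ∈ U)
    (w : PrimeSpectrum R → ℕ) (hw : ∀ x y, x < y → w y < w x)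
    {ι : Type*} [Finite ι] (I : ι → Ideal R) (e : ι → ℕ) (n : ℕ) :
    ∀ (m : Fin (n + 1) → P) 
    (_ : ∀ i, ∀ x ∈ U, I i ≤ x.asIdeal →
      w x ≤ rkAt x (fun i => emb (m i)) + e i ∨ n + 1 ≤ rkAt x (fun i => emb (m i))),
    ∃ p' : P, p' - m 0 ∈ Submodule.span R (Set.range fun i : Fin n => m i.succ) ∧
      ∀ i, ∀ x ∈ U, I i ≤ x.asIdeal →
        w x ≤ e i ∨ ∃ l, emb p' l ∉ x.asIdeal := by
  induction n with
  | zero =>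
    intro m h
    refine ⟨m 0, by simp, fun i x hx hIx => ?_⟩
    by_contra! hcon
    have h0 : rkAt x (fun i => emb (m i)) = 0 := by
      unfold rkAt
      have : (fun (i : Fin (0 + 1)) l => algebraMap R x.asIdeal.ResidueField (emb (m i) l)) = 0 := by
        funext i l
        obtain rfl : i = 0 := Fin.ext (by omega)
        simpa using hcon.2 l
      rw [this]
      have h1 : Set.range (0 : Fin (0 + 1) → Fin N → x.asIdeal.ResidueField) = {0} := Set.range_const
      rw [h1]
      simp
    have := h i x hx hIx
    omega
  | succ n ih =>
    intro m h
    obtain ⟨s, hs⟩ := ee_step (F := F) (fun i => emb (m i)) U hU w hw I e h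
    have hemb : (fun i => emb (elimStep (algebraMap F R s) m i)) =
        elimStep (algebraMap F R s) (fun i => emb (m i)) := by
      funext i
      simp [elimStep]
    obtain ⟨p', hp1, hp2⟩ := ih (elimStep (algebraMap F R s) m) (by rw [hemb]; exact hs)
    refine ⟨p', ?_, hp2⟩
    have hlast : m (Fin.last (n + 1)) ∈
        Submodule.span R (Set.range fun i : Fin (n + 1) => m i.succ) :=
      Submodule.subset_span ⟨Fin.last n, by simp⟩
    have h0 : p' - m 0 = (p' - elimStep (algebraMap F R s) m 0) +
        (algebraMap F R s) ^ (((0 : Fin (n + 1)) : ℕ) + 1) • m (Fin.last (n + 1)) := by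
      simp only [elimStep, Fin.castSucc_zero]
      abel
    rw [h0]
    refine Submodule.add_mem _ ?_ (Submodule.smul_mem _ _ hlast)
    refine (Submodule.span_le.2 ?_) hp1
    rintro _ ⟨i, rfl⟩
    refine Submodule.add_mem _ (Submodule.subset_span ⟨i.castSucc, ?_⟩)
      (Submodule.smul_mem _ _ hlast)
    simp

end EE


section EE2
open TensorProduct

lemma ee_rank_lower {R P : Type*} [CommRing R] [AddCommGroup P] [Module R P]
    [Module.Finite R P] [Module.Projective R P] {N : ℕ}
    (prj : (Fin N → R) →ₗ[R] P) (emb : P →ₗ[R] (Fin N → R)) (h : prj ∘ₗ emb = LinearMap.id)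
    (x : PrimeSpectrum R) (a : R) (ha : a ∉ x.asIdeal) {n : ℕ} (m : Fin n → P)
    (hm : ∀ l, ∃ i, m i = a • prj (Pi.single l 1)) :
    rankAt R P x ≤ rkAt x (fun i => emb (m i)) := by
  have h0 : rankAt R P x = Module.rankAtStalk (R := R) P x := rfl
  rw [h0, Module.rankAtStalk_eq]
  let K := x.asIdeal.ResidueField
  let T : K ⊗[R] P →ₗ[K] (Fin N → K) :=
    (TensorProduct.piScalarRight R K K (Fin N)).toLinearMap ∘ₗ LinearMap.baseChange K emb
  have hT : ∀ y, T (1 ⊗ₜ y) = fun l => algebraMap R K (emb y l) := by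
    intro y
    funext l
    simp [T, Algebra.smul_def]
  have hinj : Function.Injective T := by
    refine (TensorProduct.piScalarRight R K K (Fin N)).injective.comp ?_
    have : Function.LeftInverse (LinearMap.baseChange K prj) (LinearMap.baseChange K emb) := by
      intro y
      rw [← LinearMap.comp_apply, ← LinearMap.baseChange_comp, h]
      simp
    exact this.injective
  unfold rkAt
  rw [← LinearMap.finrank_range_of_inj hinj]
  refine Submodule.finrank_mono ?_
  rintro _ ⟨z, rfl⟩
  have hak : algebraMap R K a ≠ 0 := by
    rw [Ne, Ideal.algebraMap_residueField_eq_zero]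
    exact ha
  induction z with
  | zero => simp
  | add y z hy hz => rw [map_add]; exact Submodule.add_mem _ hy hz
  | tmul c y =>
    have hc : c ⊗ₜ[R] y = c • ((1 : K) ⊗ₜ[R] y) := by simp [TensorProduct.smul_tmul']
    rw [hc, map_smul]
    refine Submodule.smul_mem _ _ ?_
    have hy : y = ∑ l, emb y l • prj (Pi.single l 1) := by
      conv_lhs => rw [← LinearMap.id_apply (R := R) y, ← h, LinearMap.comp_apply,
        LinearMap.pi_apply_eq_sum_univ prj]
      refine Finset.sum_congr rfl fun l _ => ?_
      congr 2
      funext j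
      simp [Pi.single_apply, eq_comm]
    rw [hy, TensorProduct.tmul_sum, map_sum]
    refine Submodule.sum_mem _ fun l _ => ?_
    have h3 : (1 : K) ⊗ₜ[R] (emb y l • prj (Pi.single l 1)) =
        (algebraMap R K (emb y l)) • ((1 : K) ⊗ₜ[R] prj (Pi.single l 1)) := by
      rw [TensorProduct.tmul_smul, algebraMap_smul]
    rw [h3, map_smul]
    refine Submodule.smul_mem _ _ ?_
    obtain ⟨i, hi⟩ := hm l
    have h4 : T ((1 : K) ⊗ₜ[R] prj (Pi.single l 1)) =
        (algebraMap R K a)⁻¹ • (fun l => algebraMap R K (emb (m i) l)) := by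
      rw [hT, hi]
      funext k
      simp only [map_smul, Pi.smul_apply, smul_eq_mul, map_mul]
      rw [inv_mul_cancel_left₀ hak]
    rw [h4]
    exact Submodule.smul_mem _ _ (Submodule.subset_span ⟨i, rfl⟩)

lemma ee_main (F : Type*) {R P : Type*} [Field F] [Infinite F] [CommRing R] [Algebra F R]
    [IsNoetherianRing R] [AddCommGroup P] [Module R P]
    [Module.Finite R P] [Module.Projective R P] (r : ℕ) (hr : ∀ x, rankAt R P x = r)
    (a : R) (p : P) (hum : IsUnimodular R ((a, p) : R × P))
    (w : PrimeSpectrum R → ℕ) (hw : ∀ x y, x < y → w y < w x)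
    {ι : Type*} [Finite ι] (I : ι → Ideal R) (e : ι → ℕ)
    (hwr : ∀ i x, I i ≤ x.asIdeal → w x ≤ r + e i) :
    ∃ q : P, ∀ i, ∀ x : PrimeSpectrum R, I i ≤ x.asIdeal →
      (∀ l : P →ₗ[R] R, l (p + a • q) ∈ x.asIdeal) → w x ≤ e i := by
  obtain ⟨N, prj, hprj⟩ := Module.Finite.exists_fin' R P
  obtain ⟨emb, hemb⟩ := Module.projective_lifting_property prj LinearMap.id hprj
  let m : Fin (N + 1) → P := Fin.cons p (fun l => a • prj (Pi.single l 1))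
  obtain ⟨p', hp1, hp2⟩ := ee_iterate (F := F) emb {x | a ∉ x.asIdeal}
    (fun x hx y hyx hy => hx (hyx hy)) w hw I e N m (by
      intro i x hx hIx
      left
      have := ee_rank_lower prj emb hemb x a hx m (fun l => ⟨l.succ, by simp [m]⟩)
      have h2 := hwr i x hIx
      rw [hr] at this
      omega)
  have hq : ∃ q : P, p' = p + a • q := by
    have : Submodule.span R (Set.range fun i : Fin N => m i.succ) ≤
        LinearMap.range (LinearMap.lsmul R P a) := by
      rw [Submodule.span_le]
      rintro _ ⟨i, rfl⟩
      exact ⟨prj (Pi.single i 1), by simp [m]⟩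
    obtain ⟨q, hq⟩ := this hp1
    refine ⟨q, ?_⟩
    have h3 : a • q = p' - p := hq
    rw [h3]
    abel
  obtain ⟨q, rfl⟩ := hq
  refine ⟨q, fun i x hIx hO => ?_⟩
  have hax : a ∉ x.asIdeal := by
    intro hax
    obtain ⟨ψ, hψ⟩ := hum
    apply x.2.ne_top
    rw [Ideal.eq_top_iff_one, ← hψ]
    have h1 : ((a, p) : R × P) = a • ((1 : R), - q) + ((0 : R), p + a • q) := by
      ext <;> simp
    rw [h1, map_add, map_smul]
    refine Ideal.add_mem _ (Ideal.mul_mem_right _ _ hax) ?_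
    exact hO (ψ ∘ₗ LinearMap.inr R R P)
  refine (hp2 i x hax hIx).resolve_right ?_
  rintro ⟨l, hl⟩
  exact hl (hO (LinearMap.proj l ∘ₗ emb))

end EE2


section Pos

/-- The coheight in `Spec A` of (the contraction of) a prime of an `A`-algebra. -/
noncomputable def wt (A : Type*) {R : Type*} [CommRing A] [CommRing R] [Algebra A R]
    (x : PrimeSpectrum R) : ℕ :=
  (Order.coheight (PrimeSpectrum.comap (algebraMap A R) x)).toNat

lemma coheight_lt_top' {A : Type*} [CommRing A] {d : ℕ} (hd : ringKrullDim A = d)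
    (x : PrimeSpectrum A) : Order.coheight x ≤ d := by
  have h := Order.coheight_le_krullDim x
  unfold ringKrullDim at hd
  rw [hd] at h
  exact_mod_cast h

lemma coheight_eq_wt {A R : Type*} [CommRing A] [CommRing R] [Algebra A R]
    {d : ℕ} (hd : ringKrullDim A = d) (x : PrimeSpectrum R) :
    Order.coheight (PrimeSpectrum.comap (algebraMap A R) x) = (wt A x : ℕ∞) := by
  unfold wt
  rw [ENat.natCast_toNat]
  exact ne_top_of_le_ne_top (ENat.natCast_ne_top d) (coheight_lt_top' hd _)

lemma wt_le {A R : Type*} [CommRing A] [CommRing R] [Algebra A R]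
    {d : ℕ} (hd : ringKrullDim A = d) (x : PrimeSpectrum R) : wt A x ≤ d := by
  have := coheight_lt_top' hd (PrimeSpectrum.comap (algebraMap A R) x)
  rw [coheight_eq_wt hd] at this
  exact_mod_cast this

lemma wt_lt {A R : Type*} [CommRing A] [CommRing R] [Algebra A R]
    {d : ℕ} (hd : ringKrullDim A = d) {x : PrimeSpectrum R} {y : PrimeSpectrum A}
    (hxy : PrimeSpectrum.comap (algebraMap A R) x < y) : Order.coheight y + 1 ≤ wt A x := by
  rw [← coheight_eq_wt hd]
  exact Order.coheight_add_one_le hxy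

lemma wt_lt_wt {A R : Type*} [CommRing A] [CommRing R] [Algebra A R] (f : A)
    [IsLocalization.Away f R]
    {d : ℕ} (hd : ringKrullDim A = d) (x y : PrimeSpectrum R)
    (hxy : x < y) : wt A y < wt A x := by
  have : PrimeSpectrum.comap (algebraMap A R) x < PrimeSpectrum.comap (algebraMap A R) y := by
    refine lt_of_le_of_ne (fun z hz => hxy.le hz) fun he => ?_
    exact hxy.ne (PrimeSpectrum.localization_comap_injective R (Submonoid.powers f) he)
  have := wt_lt hd this
  rw [coheight_eq_wt hd] at this
  exact_mod_cast this

lemma exists_prime_below {A R : Type*} [CommRing A] [CommRing R] [Algebra A R] (f : A)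
    [IsLocalization.Away f R] (O : Ideal R) (q : PrimeSpectrum A)
    (hq : O.comap (algebraMap A R) ≤ q.asIdeal) (hf : f ∈ q.asIdeal) :
    ∃ x : PrimeSpectrum R, O ≤ x.asIdeal ∧ PrimeSpectrum.comap (algebraMap A R) x < q := by
  obtain ⟨y, hy, hyq⟩ := Ideal.exists_minimalPrimes_le hq
  obtain ⟨z, hz, rfl⟩ := Ideal.exists_minimalPrimes_comap_eq _ y hy
  refine ⟨⟨z, hz.1.1⟩, hz.1.2, lt_of_le_of_ne hyq ?_⟩
  rintro rfl
  have h1 : algebraMap A R f ∈ z := hf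
  exact hz.1.1.ne_top (Ideal.eq_top_of_isUnit_mem _ h1 (IsLocalization.Away.algebraMap_isUnit f))

lemma exists_h1 {A R : Type*} [CommRing A] [CommRing R] [Algebra A R] (f : A)
    [IsLocalization.Away f R] {d : ℕ} (hd : ringKrullDim A = d) (O : Ideal R)
    (hO : ∀ x : PrimeSpectrum R, O ≤ x.asIdeal → wt A x ≤ 0) :
    ∃ y : A, algebraMap A R (1 + f * y) ∈ O := by
  have : O.comap (algebraMap A R) ⊔ Ideal.span {f} = ⊤ := by
    by_contra hne
    obtain ⟨M, hM, hle⟩ := Ideal.exists_le_maximal _ hne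
    obtain ⟨x, hx, hlt⟩ := exists_prime_below f O ⟨M, hM.isPrime⟩ (le_sup_left.trans hle)
      (hle (Ideal.mem_sup_right (Ideal.mem_span_singleton_self f)))
    have h1 := wt_lt hd hlt
    have h2 := hO x hx
    have h3 : wt A x = 0 := by omega
    rw [h3] at h1
    simp at h1
  rw [Ideal.eq_top_iff_one, Submodule.mem_sup] at this
  obtain ⟨i, hi, z, hz, h1⟩ := this
  obtain ⟨y, rfl⟩ := Ideal.mem_span_singleton'.1 hz
  refine ⟨-y, ?_⟩
  have : 1 + f * (-y) = i := by rw [← h1]; ring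
  rw [this]
  exact hi

lemma exists_sq_of_maximal {A : Type*} [CommRing A] [Algebra ℝ A] [Algebra.FiniteType ℝ A]
    (f : A) (hf : ∀ φ : A →ₐ[ℝ] ℝ, φ f ≠ 0) (M : Ideal A) [M.IsMaximal] (hfM : f ∈ M) :
    ∃ x : A, x ^ 2 + 1 ∈ M := by
  let _ : Field (A ⧸ M) := Ideal.Quotient.field M
  have h1 : Algebra.FiniteType ℝ (A ⧸ M) :=
    Algebra.FiniteType.of_surjective (Ideal.Quotient.mkₐ ℝ M) (Ideal.Quotient.mkₐ_surjective ℝ M)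
  have h2 : Module.Finite ℝ (A ⧸ M) := finite_of_finite_type_of_isJacobsonRing ℝ (A ⧸ M)
  have h3 : Algebra.IsAlgebraic ℝ (A ⧸ M) := inferInstance
  rcases Real.nonempty_algEquiv_or (A ⧸ M) with ⟨⟨e⟩⟩ | ⟨⟨e⟩⟩
  · exfalso
    apply hf (e.toAlgHom.comp (Ideal.Quotient.mkₐ ℝ M))
    have : Ideal.Quotient.mk M f = 0 := Ideal.Quotient.eq_zero_iff_mem.2 hfM
    simp [this]
  · obtain ⟨x, hx⟩ := Ideal.Quotient.mk_surjective (e.symm Complex.I)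
    refine ⟨x, ?_⟩
    rw [← Ideal.Quotient.eq_zero_iff_mem]
    apply e.injective
    simp [hx]

lemma exists_sigma {A R : Type*} [CommRing A] [Algebra ℝ A] [Algebra.FiniteType ℝ A]
    [CommRing R] [Algebra A R] (f : A) (hf : ∀ φ : A →ₐ[ℝ] ℝ, φ f ≠ 0)
    [IsLocalization.Away f R] {d : ℕ} (hd : ringKrullDim A = d) (O : Ideal R)
    (hO : ∀ x : PrimeSpectrum R, O ≤ x.asIdeal → wt A x ≤ 1) :
    ∃ g i : A, algebraMap A R i ∈ O ∧ ∀ φ : A →ₐ[ℝ] ℝ, 1 ≤ φ (f * g + i) := by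
  let S : Submonoid A :=
    { carrier := {σ | ∀ φ : A →ₐ[ℝ] ℝ, 1 ≤ φ σ}
      one_mem' := by
        intro φ
        simp
      mul_mem' := by
        intro x y hx hy φ
        rw [map_mul]
        exact one_le_mul_of_one_le_of_one_le (hx φ) (hy φ) }
  have hS : ¬ Disjoint ((O.comap (algebraMap A R) ⊔ Ideal.span {f} : Ideal A) : Set A) S := by
    intro hdis
    obtain ⟨q, hq, hle, hqS⟩ := Ideal.exists_le_prime_disjoint _ _ hdis
    have hfq : f ∈ q := hle (Ideal.mem_sup_right (Ideal.mem_span_singleton_self f))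
    obtain ⟨x, hx, hlt⟩ := exists_prime_below f O ⟨q, hq⟩ (le_sup_left.trans hle) hfq
    have h1 := wt_lt hd hlt
    have h2 := hO x hx
    have h3 : Order.coheight (⟨q, hq⟩ : PrimeSpectrum A) = 0 := by
      have h4 : Order.coheight (⟨q, hq⟩ : PrimeSpectrum A) + 1 ≤ 0 + 1 :=
        h1.trans (by exact_mod_cast h2)
      have := (ENat.add_le_add_iff_right ENat.one_ne_top).1 h4
      simpa using this
    rw [Order.coheight_eq_zero] at h3
    have : q.IsMaximal := (PrimeSpectrum.isMax_iff (x := ⟨q, hq⟩)).1 h3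
    obtain ⟨y, hy⟩ := exists_sq_of_maximal f hf q hfq
    refine Set.disjoint_left.1 hqS hy ?_
    intro φ
    rw [map_add, map_pow, map_one]
    nlinarith [sq_nonneg (φ y)]
  rw [Set.not_disjoint_iff] at hS
  obtain ⟨σ, h1, h2⟩ := hS
  obtain ⟨i, hi, z, hz, rfl⟩ := Submodule.mem_sup.1 h1
  obtain ⟨y, rfl⟩ := Ideal.mem_span_singleton'.1 hz
  refine ⟨y, i, hi, fun φ => ?_⟩
  have := h2 φ
  rwa [show f * y + i = i + y * f by ring]

end Pos


section Reg
open IsLocalRing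

lemma reg_etale {C T : Type*} [CommRing C] [CommRing T] [Algebra C T] [IsRegularRing C]
    [Algebra.Etale C T] (q : Ideal T) [q.IsPrime] :
    IsRegularLocalRing (Localization.AtPrime q) := by
  have : IsNoetherianRing T := Algebra.FiniteType.isNoetherianRing C T
  let p : Ideal C := q.under C
  have hlo : q.LiesOver p := inferInstance
  have hflat : Module.Flat C T := inferInstance
  have h1 := Ideal.height_eq_height_add_of_liesOver_of_hasGoingDown p q
  let _ : Algebra (Localization.AtPrime p) (Localization.AtPrime q) :=
    Localization.AtPrime.algebraOfLiesOver p q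
  have : Localization.AtPrime.IsLiesOverAlgebra p q := inferInstance
  have hu : Algebra.IsUnramifiedAt C q := inferInstance
  have h2 := ((Algebra.isUnramifiedAt_iff_map_eq C p q).1 hu).2
  apply IsRegularLocalRing.of_spanFinrank_maximalIdeal_le
  have h3 := (isRegularLocalRing_iff _).1 (inferInstance : IsRegularLocalRing (Localization.AtPrime p))
  rw [IsLocalization.AtPrime.ringKrullDim_eq_height q (Localization.AtPrime q)]
  rw [IsLocalization.AtPrime.ringKrullDim_eq_height p (Localization.AtPrime p)] at h3
  have h4 : maximalIdeal (Localization.AtPrime q) = (maximalIdeal (Localization.AtPrime p)).map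
      (algebraMap (Localization.AtPrime p) (Localization.AtPrime q)) := by
    rw [← h2, ← Localization.AtPrime.map_eq_maximalIdeal, Ideal.map_map,
      ← IsScalarTower.algebraMap_eq]
  rw [h4]
  have h5 := Ideal.spanFinrank_map_le_of_fg
    (algebraMap (Localization.AtPrime p) (Localization.AtPrime q))
    (maximalIdeal (Localization.AtPrime p)).fg_of_isNoetherianRing
  calc _ ≤ (((maximalIdeal (Localization.AtPrime p)).spanFinrank : ℕ) : WithBot ℕ∞) := by
        exact_mod_cast h5
    _ = p.height := h3
    _ ≤ q.height := by
      rw [h1]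
      exact_mod_cast le_self_add

lemma reg_of_isSmoothAt (k : Type*) {S : Type*} [Field k] [CommRing S] [Algebra k S]
    [Algebra.FinitePresentation k S] (q : Ideal S) [q.IsPrime] [Algebra.IsSmoothAt k q] :
    IsRegularLocalRing (Localization.AtPrime q) := by
  obtain ⟨f, hf, hs⟩ := Algebra.IsSmoothAt.exists_notMem_isStandardSmooth k q
  have hs' : (algebraMap k (Localization.Away f)).IsStandardSmooth :=
    RingHom.isStandardSmooth_algebraMap.2 hs
  obtain ⟨n, g, hg, hge⟩ := hs'.exists_etale_mvPolynomial
  let _ := g.toAlgebra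
  have : Algebra.Etale (MvPolynomial (Fin n) k) (Localization.Away f) := hge
  have hdis : Disjoint (Submonoid.powers f : Set S) q := by
    rwa [Ideal.disjoint_powers_iff_notMem_of_isPrime]
  have hp : (Ideal.map (algebraMap S (Localization.Away f)) q).IsPrime :=
    IsLocalization.isPrime_of_isPrime_disjoint (.powers f) _ _ ‹_› hdis
  have h1 := reg_etale (C := MvPolynomial (Fin n) k)
    (Ideal.map (algebraMap S (Localization.Away f)) q)
  have h2 := IsLocalization.isLocalization_isLocalization_atPrime_isLocalization
    (Submonoid.powers f) (Localization.AtPrime (Ideal.map (algebraMap S (Localization.Away f)) q))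
    (Ideal.map (algebraMap S (Localization.Away f)) q)
  have hc : Ideal.comap (algebraMap S (Localization.Away f))
    (Ideal.map (algebraMap S (Localization.Away f)) q) = q :=
    IsLocalization.under_map_of_isPrime_disjoint _ _ ‹_› hdis
  have h3 : IsLocalization.AtPrime
    (Localization.AtPrime (Ideal.map (algebraMap S (Localization.Away f)) q)) q := by
    simpa only [hc] using h2
  exact IsRegularLocalRing.of_ringEquiv (IsLocalization.algEquiv q.primeCompl
    (Localization.AtPrime (Ideal.map (algebraMap S (Localization.Away f)) q))
    (Localization.AtPrime q)).toRingEquiv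

end Reg


section Reg2
open IsLocalRing

lemma isRegularLocal_of_isRegularLocalRing {R : Type*} [CommRing R] [IsRegularLocalRing R] :
    IsRegularLocal R := by
  refine ⟨inferInstance, inferInstance, ?_⟩
  obtain ⟨s, hs, hs2⟩ := Submodule.FG.exists_span_finset_card_eq_spanFinrank
    (maximalIdeal R).fg_of_isNoetherianRing
  refine ⟨s, hs2, ?_⟩
  rw [hs]
  exact (isRegularLocalRing_iff _).1 inferInstance

lemma emb_quot {L : Type*} [CommRing L] [IsLocalRing L] [IsNoetherianRing L] (x : L)
    (hx : x ∈ maximalIdeal L) (hx2 : x ∉ maximalIdeal L ^ 2) :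
    ∃ (n : ℕ) (y : Fin n → L), n + 1 = (maximalIdeal L).spanFinrank ∧
      Ideal.span (insert x (Set.range y)) = maximalIdeal L := by
  let V := CotangentSpace L
  let K := ResidueField L
  let v : V := (maximalIdeal L).toCotangent ⟨x, hx⟩
  have hv : v ≠ 0 := by
    intro h
    exact hx2 ((maximalIdeal L).toCotangent_eq_zero ⟨x, hx⟩ |>.1 h)
  let W := V ⧸ Submodule.span K {v}
  let b := Module.finBasis K W
  have hn : Module.finrank K W + 1 = Module.finrank K V := by
    rw [← Submodule.finrank_quotient_add_finrank (Submodule.span K {v}), finrank_span_singleton hv]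
  choose c hc using fun i => Submodule.mkQ_surjective (Submodule.span K {v}) (b i)
  choose y hy using fun i => (maximalIdeal L).toCotangent_surjective (c i)
  have hspan : Submodule.span K (insert v (Set.range c)) = ⊤ := by
    rw [Submodule.span_insert]
    have h1 : Submodule.map (Submodule.mkQ (Submodule.span K {v})) (Submodule.span K (Set.range c)) = ⊤ := by
      rw [Submodule.map_span, ← Set.range_comp, ← b.span_eq]
      congr 2
      ext i
      exact hc i
    have h2 := congrArg (Submodule.comap (Submodule.mkQ (Submodule.span K {v}))) h1
    rw [Submodule.comap_map_mkQ, Submodule.comap_top] at h2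
    exact h2
  refine ⟨Module.finrank K W, fun i => (y i : L), ?_, ?_⟩
  · rw [hn, spanFinrank_maximalIdeal_eq_finrank_cotangentSpace]
  · have h3 : Submodule.span L (insert ⟨x, hx⟩ (Set.range y)) = ⊤ := by
      rw [← CotangentSpace.span_image_eq_top_iff, Set.image_insert_eq, ← Set.range_comp, ← hspan]
      congr 3
      ext i
      exact hy i
    have h4 := congrArg (Submodule.map (maximalIdeal L).subtype) h3
    rw [Submodule.map_span, Set.image_insert_eq, ← Set.range_comp, Submodule.map_top,
      Submodule.range_subtype] at h4
    exact h4

lemma reg_quot {L C : Type*} [CommRing L] [IsRegularLocalRing L] [CommRing C] (x : L)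
    (hx : x ∈ maximalIdeal L) (hx2 : x ∉ maximalIdeal L ^ 2) (π : L →+* C)
    (hπ : Function.Surjective π) (hker : RingHom.ker π = Ideal.span {x}) :
    IsRegularLocalRing C ∧ ringKrullDim C + 1 = ringKrullDim L := by
  have hnt : Nontrivial C := by
    refine ⟨⟨0, 1, fun h => ?_⟩⟩
    have : (1 : L) ∈ RingHom.ker π := by rw [RingHom.mem_ker, map_one, h]
    rw [hker] at this
    exact (Ideal.ne_top_iff_one _).1 (maximalIdeal.isMaximal L).ne_top
      ((Ideal.span_singleton_le_iff_mem _).2 hx this)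
  have hloc : IsLocalRing C := IsLocalRing.of_surjective' π hπ
  have hnoe : IsNoetherianRing C := isNoetherianRing_of_surjective L C π hπ
  obtain ⟨n, y, hn, hspan⟩ := emb_quot x hx hx2
  have hmap : (maximalIdeal L).map π = maximalIdeal C := by
    have := Ideal.map_eq_top_or_isMaximal_of_surjective π hπ (maximalIdeal.isMaximal L)
    rcases this with h | h
    · exfalso
      have h1 := congrArg (Ideal.comap π) h
      rw [Ideal.comap_map_of_surjective' π hπ, hker, Ideal.comap_top, sup_eq_left.2
        ((Ideal.span_singleton_le_iff_mem _).2 hx)] at h1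
      exact (maximalIdeal.isMaximal L).ne_top h1
    · exact eq_maximalIdeal h
  have hdimL := (isRegularLocalRing_iff L).1 inferInstance
  have h5 : (maximalIdeal C).spanFinrank ≤ n := by
    have hx0 : π x = 0 := by
      rw [← RingHom.mem_ker, hker]
      exact Ideal.mem_span_singleton_self x
    have : maximalIdeal C = Ideal.span (Set.range (π ∘ y)) := by
      rw [← hmap, ← hspan, Ideal.map_span, Set.image_insert_eq, ← Set.range_comp, hx0,
        Ideal.span_insert_zero]
    rw [this]
    refine (Submodule.spanFinrank_span_le_ncard_of_finite (Set.finite_range _)).trans ?_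
    rw [← Set.image_univ]
    refine (Set.ncard_image_le Set.finite_univ).trans ?_
    simp
  have h6 : ringKrullDim L ≤ ringKrullDim C + 1 := by
    have := Ideal.height_le_ringKrullDim_quotient_add_one hx
    rw [maximalIdeal_height_eq_ringKrullDim] at this
    have e := (Ideal.quotEquivOfEq hker.symm).trans (RingHom.quotientKerEquivOfSurjective hπ)
    rwa [ringKrullDim_eq_of_ringEquiv e] at this
  have h7 := ringKrullDim_le_spanFinrank_maximalIdeal C
  rw [← hdimL, ← hn] at h6 ⊢
  have h8 : ringKrullDim C ≤ n := h7.trans (by exact_mod_cast h5)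
  have h9 : (n : WithBot ℕ∞) ≤ ringKrullDim C := by
    push_cast at h6
    revert h6
    generalize ringKrullDim C = D
    intro h6
    induction D with
    | bot => simp at h6
    | coe D =>
      have h6' : (n : ℕ∞) + 1 ≤ D + 1 := by exact_mod_cast h6
      have := (ENat.add_le_add_iff_right ENat.one_ne_top).1 h6'
      exact_mod_cast this
  refine ⟨IsRegularLocalRing.of_spanFinrank_maximalIdeal_le _ (le_trans (by exact_mod_cast h5) h9), ?_⟩
  rw [le_antisymm h8 h9]
  push_cast
  rfl

/-- Regularity of the local rings of `S ⧸ (b)`. -/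
lemma reg_hyper (k : Type*) {S : Type*} [Field k] [CommRing S] [Algebra k S]
    [Algebra.FinitePresentation k S] (b : S) (d : ℕ) (hd : ringKrullDim S ≤ d)
    (H : ∀ (q : Ideal S) [q.IsPrime], b ∈ q → Algebra.IsSmoothAt k q ∧
      ∀ s, s ∉ q → s * b ∉ q ^ 2)
    (𝔮 : PrimeSpectrum (S ⧸ Ideal.span {b})) :
    IsRegularLocal (Localization.AtPrime 𝔮.asIdeal) ∧
      ringKrullDim (Localization.AtPrime 𝔮.asIdeal) ≤ ((d - 1 : ℕ) : WithBot ℕ∞) := by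
  let mk := Ideal.Quotient.mk (Ideal.span {b})
  let q : Ideal S := 𝔮.asIdeal.comap mk
  have hbq : b ∈ q := by
    have : mk b = 0 := Ideal.Quotient.eq_zero_iff_mem.2 (Ideal.mem_span_singleton_self b)
    simp [q, Ideal.mem_comap, this]
  obtain ⟨hsm, hs⟩ := H q hbq
  have hreg := reg_of_isSmoothAt k q
  let L := Localization.AtPrime q
  let π : L →+* Localization.AtPrime 𝔮.asIdeal := Localization.localRingHom q 𝔮.asIdeal mk rfl
  have hM : q.primeCompl.map mk = 𝔮.asIdeal.primeCompl := by
    ext z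
    constructor
    · rintro ⟨w, hw, rfl⟩
      exact hw
    · intro hz
      obtain ⟨w, rfl⟩ := Ideal.Quotient.mk_surjective z
      exact ⟨w, hz, rfl⟩
  have hker : RingHom.ker π = Ideal.span {algebraMap S L b} := by
    have := IsLocalization.ker_map (S := L) (Localization.AtPrime 𝔮.asIdeal) mk hM
    rw [Ideal.mk_ker, Ideal.map_span, Set.image_singleton] at this
    exact this
  have hsurj : Function.Surjective π := by
    intro z
    obtain ⟨u, v, rfl⟩ := IsLocalization.exists_mk'_eq 𝔮.asIdeal.primeCompl z
    obtain ⟨u, rfl⟩ := Ideal.Quotient.mk_surjective u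
    obtain ⟨v, hv⟩ := v
    obtain ⟨v, rfl⟩ := Ideal.Quotient.mk_surjective v
    refine ⟨IsLocalization.mk' L u (⟨v, hv⟩ : q.primeCompl), ?_⟩
    exact Localization.localRingHom_mk' _ _ _ _ _ _
  have hmem : algebraMap S L b ∈ maximalIdeal L := by
    rw [← Localization.AtPrime.map_eq_maximalIdeal]
    exact Ideal.mem_map_of_mem _ hbq
  have hnmem : algebraMap S L b ∉ maximalIdeal L ^ 2 := by
    rw [← Localization.AtPrime.map_eq_maximalIdeal, ← Ideal.map_pow]
    intro hin
    obtain ⟨s, h1, h2⟩ := (IsLocalization.algebraMap_mem_map_algebraMap_iff q.primeCompl L _ _).1 hin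
    exact hs s h1 h2
  obtain ⟨h1, h2⟩ := reg_quot _ hmem hnmem π hsurj hker
  refine ⟨isRegularLocal_of_isRegularLocalRing, ?_⟩
  have h3 : ringKrullDim L ≤ d := by
    refine le_trans ?_ hd
    rw [IsLocalization.AtPrime.ringKrullDim_eq_height q L]
    exact Ideal.height_le_ringKrullDim_of_ne_top Ideal.IsPrime.ne_top'
  rw [← h2] at h3
  revert h3
  generalize ringKrullDim (Localization.AtPrime 𝔮.asIdeal) = D
  intro h3
  induction D with
  | bot => simp
  | coe D =>
    have h3' : D + 1 ≤ (d : ℕ∞) := by exact_mod_cast h3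
    cases d with
    | zero => simp at h3'
    | succ d =>
      have : D + 1 ≤ (d : ℕ∞) + 1 := by exact_mod_cast h3'
      have := (ENat.add_le_add_iff_right ENat.one_ne_top).1 this
      rw [Nat.add_sub_cancel]
      exact_mod_cast this

end Reg2


section Sard
open Polynomial

lemma lift_ringHom {R K D : Type*} [CommRing R] [CommRing K] [CommRing D] [Algebra R K]
    [Algebra.FormallySmooth R K] (g : D →+* K) (hg : Function.Surjective g)
    (hker : RingHom.ker g ^ 2 = ⊥) (σ : R →+* D) (hσ : ∀ r, g (σ r) = algebraMap R K r) :
    ∃ τ : K →+* D, (∀ x, g (τ x) = x) ∧ ∀ r, τ (algebraMap R K r) = σ r := by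
  let _ : Algebra R D := σ.toAlgebra
  let g' : D →ₐ[R] K := { g with commutes' := hσ }
  have hnil : IsNilpotent (RingHom.ker (g' : D →+* K)) := ⟨2, hker⟩
  refine ⟨(Algebra.FormallySmooth.liftOfSurjective (AlgHom.id R K) g' hg hnil : K →ₐ[R] D), ?_, ?_⟩
  · intro x
    exact Algebra.FormallySmooth.liftOfSurjective_apply (AlgHom.id R K) g' hg hnil x
  · intro r
    exact AlgHom.commutes _ r

lemma transc_formallySmooth {k K : Type*} [Field k] [CharZero k] [Field K] [Algebra k K]
    [Algebra k[X] K] [IsScalarTower k k[X] K]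
    [Algebra.EssFiniteType k K] (hx : Function.Injective (algebraMap k[X] K)) :
    Algebra.FormallySmooth k[X] K := by
  have : FaithfulSMul k[X] K := (faithfulSMul_iff_algebraMap_injective _ _).2 hx
  let _ := FractionRing.liftAlgebra k[X] K
  have h0 : IsScalarTower k[X] (FractionRing k[X]) K := FractionRing.isScalarTower_liftAlgebra k[X] K
  have h1 : Algebra.FormallySmooth k[X] (FractionRing k[X]) :=
    .of_isLocalization (nonZeroDivisors _)
  have h00 : IsScalarTower k (FractionRing k[X]) K := IsScalarTower.to₁₃₄ k k[X] (FractionRing k[X]) K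
  have hE : Algebra.EssFiniteType (FractionRing k[X]) K := .of_comp k _ _
  have hc : CharZero (FractionRing k[X]) := inferInstance
  have h2 : Algebra.FormallySmooth (FractionRing k[X]) K := inferInstance
  exact .comp _ (FractionRing k[X]) _

lemma transc_deriv {k K : Type*} [Field k] [CharZero k] [Field K] [Algebra k K]
    [Algebra.EssFiniteType k K] (x : K) (hx : Transcendental k x) :
    ∃ δ : Derivation k K K, δ x = 1 := by
  let _ : Algebra k[X] K := (aeval x : k[X] →ₐ[k] K).toRingHom.toAlgebra
  have : IsScalarTower k k[X] K := .of_algebraMap_eq' (aeval x : k[X] →ₐ[k] K).comp_algebraMap.symm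
  have hsm : Algebra.FormallySmooth k[X] K :=
    transc_formallySmooth (transcendental_iff_injective.1 hx)
  let g : DualNumber K →ₐ[k] K := TrivSqZeroExt.fstHom k K K
  let σ : k[X] →ₐ[k] DualNumber K := aeval (TrivSqZeroExt.inl x + DualNumber.eps)
  have hg : Function.Surjective g := fun y => ⟨TrivSqZeroExt.inl y, rfl⟩
  have hσ : ∀ r, g (σ r) = algebraMap k[X] K r := by
    intro r
    have : g.comp σ = aeval x := by
      apply Polynomial.algHom_ext
      simp [g, σ]
    exact congrArg (fun h => h r) this
  have hker : RingHom.ker (g : DualNumber K →+* K) ^ 2 = ⊥ := by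
    rw [pow_two, eq_bot_iff, Ideal.mul_le]
    intro a ha b hb
    have ha' : a.fst = 0 := ha
    have hb' : b.fst = 0 := hb
    rw [Ideal.mem_bot]
    ext <;> simp [ha', hb']
  obtain ⟨τ, h1, h2⟩ := lift_ringHom (g : DualNumber K →+* K) hg hker (σ : k[X] →+* DualNumber K) hσ
  have h1' : ∀ y, (τ y).fst = y := h1
  have h3 : ∀ c : k, τ (algebraMap k K c) = algebraMap k _ c := by
    intro c
    rw [IsScalarTower.algebraMap_apply k k[X] K, h2]
    exact σ.commutes c
  let τ' : K →ₐ[k] DualNumber K := { τ with commutes' := h3 }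
  let δ : Derivation k K K := Derivation.mk' ((TrivSqZeroExt.sndHom K K).restrictScalars k ∘ₗ τ'.toLinearMap) (by
    intro a b
    change (τ (a * b)).snd = a • (τ b).snd + b • (τ a).snd
    rw [map_mul]
    simp [h1', mul_comm])
  refine ⟨δ, ?_⟩
  change (τ x).snd = 1
  have : x = algebraMap k[X] K X := by
    change x = aeval x X
    simp
  rw [this, h2]
  simp [σ]

lemma alg_of_deriv {k B : Type*} [Field k] [CharZero k] [CommRing B] [Algebra k B]
    [Algebra.EssFiniteType k B] (Q : Ideal B) [Q.IsPrime] (φ : B)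
    (h : KaehlerDifferential.D k B φ ∈ Q • (⊤ : Submodule B (Ω[B⁄k]))) :
    ∃ m : k[X], m ≠ 0 ∧ aeval φ m ∈ Q := by
  let K := FractionRing (B ⧸ Q)
  by_contra hcon
  push Not at hcon
  let x : K := algebraMap B K φ
  have hx : Transcendental k x := by
    rw [transcendental_iff]
    intro m hm
    by_contra hne
    apply hcon m hne
    have : algebraMap B K (aeval φ m) = 0 := by
      rw [← hm, Polynomial.aeval_algebraMap_apply]
    rw [IsScalarTower.algebraMap_apply B (B ⧸ Q) K] at this
    have := (IsFractionRing.injective (B ⧸ Q) K) (this.trans (map_zero _).symm)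
    exact Ideal.Quotient.eq_zero_iff_mem.1 this
  have hq : Algebra.EssFiniteType k (B ⧸ Q) := .comp k B _
  have hE : Algebra.EssFiniteType k K :=
    have : Algebra.EssFiniteType (B ⧸ Q) K := .of_isLocalization _ (nonZeroDivisors (B ⧸ Q))
    .comp k (B ⧸ Q) K
  obtain ⟨δ, hδ⟩ := transc_deriv x hx
  let δ' : Derivation k B K := (δ.compAlgebraMap B)
  have h1 : δ'.liftKaehlerDifferential (KaehlerDifferential.D k B φ) = 1 := by
    rw [Derivation.liftKaehlerDifferential_comp_D]
    exact hδ
  have h2 : ∀ ω ∈ Q • (⊤ : Submodule B (Ω[B⁄k])), δ'.liftKaehlerDifferential ω = 0 := by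
    intro ω hω
    refine Submodule.smul_induction_on hω ?_ ?_
    · intro r hr n _
      rw [map_smul, Algebra.smul_def, IsScalarTower.algebraMap_apply B (B ⧸ Q) K]
      have : algebraMap B (B ⧸ Q) r = 0 := Ideal.Quotient.eq_zero_iff_mem.2 hr
      rw [this, map_zero, zero_mul]
    · intro a b ha hb
      rw [map_add, ha, hb, add_zero]
  rw [h2 _ h] at h1
  exact zero_ne_one h1

/-- Algebraic Sard theorem. -/
lemma sard {k B : Type*} [Field k] [CharZero k] [CommRing B] [Algebra k B]
    [Algebra.FiniteType k B] [Algebra.FormallySmooth k B] (φ : B) :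
    ∃ Z : Set k, Z.Finite ∧ ∀ u ∉ Z, ∀ (q : Ideal B) [q.IsPrime], φ + algebraMap k B u ∈ q →
      ∀ s ∉ q, s * (φ + algebraMap k B u) ∉ q ^ 2 := by
  have hnoe : IsNoetherianRing B := Algebra.FiniteType.isNoetherianRing k B
  let Dφ := KaehlerDifferential.D k B φ
  let I : Ideal B := LinearMap.range (LinearMap.applyₗ (R := B) Dφ : (Ω[B⁄k] →ₗ[B] B) →ₗ[B] B)
  have hI : ∀ Q : Ideal B, I ≤ Q → Dφ ∈ Q • (⊤ : Submodule B (Ω[B⁄k])) := by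
    intro Q hQ
    obtain ⟨n, prj, hprj⟩ := Module.Finite.exists_fin' B (Ω[B⁄k])
    obtain ⟨emb, hemb⟩ := Module.projective_lifting_property prj LinearMap.id hprj
    have h1 : prj (emb Dφ) = Dφ := congrArg (fun h => h Dφ) hemb
    rw [← h1, pi_eq_sum_univ (emb Dφ), map_sum]
    refine Submodule.sum_mem _ fun i _ => ?_
    rw [map_smul]
    refine Submodule.smul_mem_smul (hQ ?_) trivial
    exact ⟨(LinearMap.proj i).comp emb, rfl⟩
  have hfin : I.minimalPrimes.Finite := I.finite_minimalPrimes_of_isNoetherianRing B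
  have hm : ∀ Q : I.minimalPrimes, ∃ m : k[X], m ≠ 0 ∧ aeval φ m ∈ Q.1 := by
    intro Q
    have : Q.1.IsPrime := Q.2.1.1
    exact alg_of_deriv Q.1 φ (hI _ Q.2.1.2)
  choose m hm0 hmQ using hm
  have : Finite I.minimalPrimes := hfin
  refine ⟨⋃ Q : I.minimalPrimes, Set.image (fun u => -u) {u | (m Q).IsRoot u}, ?_, ?_⟩
  · refine Set.finite_iUnion fun Q => Set.Finite.image _ ?_
    exact Polynomial.finite_setOfPred_isRoot (hm0 Q)
  · intro u hu q hq hmem s hs hs2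
    apply hu
    have hIq : I ≤ q := by
      rintro _ ⟨l, rfl⟩
      have key : ∀ z ∈ q ^ 2, l (KaehlerDifferential.D k B z) ∈ q := by
        intro z hz
        rw [pow_two] at hz
        refine Submodule.mul_induction_on hz ?_ ?_
        · intro a ha b hb
          rw [Derivation.leibniz, map_add, map_smul, map_smul]
          exact q.add_mem (q.mul_mem_right _ ha) (q.mul_mem_right _ hb)
        · intro a b ha hb
          rw [map_add, map_add]
          exact q.add_mem ha hb
      have h2 := key _ hs2
      rw [Derivation.leibniz, map_add, map_smul, map_smul, map_add, Derivation.map_algebraMap,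
        add_zero, smul_eq_mul, smul_eq_mul] at h2
      have h3 := (q.add_mem_iff_left (q.mul_mem_right _ hmem)).1 h2
      exact (hq.mem_or_mem h3).resolve_left hs
    obtain ⟨Q, hQ, hQq⟩ := Ideal.exists_minimalPrimes_le hIq
    refine Set.mem_iUnion.2 ⟨⟨Q, hQ⟩, -u, ?_, by simp⟩
    have h4 : aeval φ (m ⟨Q, hQ⟩) ∈ q := hQq (hmQ ⟨Q, hQ⟩)
    have h5 : aeval φ (m ⟨Q, hQ⟩) - algebraMap k B ((m ⟨Q, hQ⟩).eval (-u)) ∈ q := by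
      have h6 := (Polynomial.sub_dvd_eval_sub φ (algebraMap k B (-u)) ((m ⟨Q, hQ⟩).map (algebraMap k B)))
      rw [Polynomial.eval_map_algebraMap, Polynomial.eval_map_algebraMap,
        Polynomial.aeval_algebraMap_apply_eq_algebraMap_eval] at h6
      obtain ⟨c, hc⟩ := h6
      rw [hc, map_neg, sub_neg_eq_add]
      exact q.mul_mem_right _ hmem
    have h7 : algebraMap k B ((m ⟨Q, hQ⟩).eval (-u)) ∈ q := by
      have := q.sub_mem h4 h5
      rwa [sub_sub_cancel] at this
    change (m ⟨Q, hQ⟩).eval (-u) = 0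
    by_contra hne
    exact hq.ne_top (Ideal.eq_top_of_isUnit_mem _ h7 ((isUnit_iff_ne_zero.2 hne).map _))

end Sard


section ExJ

lemma smooth_of_minimal (k : Type*) {A : Type*} [Field k] [PerfectField k] [CommRing A]
    [Algebra k A] [Algebra.FiniteType k A] [IsReduced A] (p : Ideal A) [p.IsPrime]
    (hp : p ∈ minimalPrimes A) : Algebra.IsSmoothAt k p := by
  let L := Localization.AtPrime p
  have h0 : Subsingleton (PrimeSpectrum L) :=
    IsLocalization.subsingleton_primeSpectrum_of_mem_minimalPrimes p hp L
  have hred : IsReduced L := isReduced_localizationPreserves p.primeCompl _ inferInstance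
  have hF : IsField L := by
    rw [IsLocalRing.isField_iff_maximalIdeal_eq, eq_bot_iff]
    intro z hz
    have : z ∈ nilradical L := by
      rw [nilradical_eq_sInf, Ideal.mem_sInf]
      intro Q hQ
      have : (⟨Q, hQ⟩ : PrimeSpectrum L) = IsLocalRing.closedPoint L := Subsingleton.elim _ _
      have h2 : Q = IsLocalRing.maximalIdeal L := congrArg PrimeSpectrum.asIdeal this
      rw [h2]
      exact hz
    rwa [nilradical_eq_zero] at this
  let _ : Field L := hF.toField
  have : Algebra.EssFiniteType A L := .of_isLocalization _ p.primeCompl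
  have : Algebra.EssFiniteType k L := .comp k A L
  exact Algebra.FormallySmooth.of_perfectField (K := k) (L := L)

lemma exists_j (k : Type*) {A : Type*} [Field k] [PerfectField k] [CommRing A]
    [Algebra k A] [Algebra.FiniteType k A] [IsReduced A] (J : Ideal A)
    (hJ : ∀ 𝔭 ∈ minimalPrimes A, ¬ J ≤ 𝔭) :
    ∃ j ∈ J, (∀ 𝔭 ∈ minimalPrimes A, j ∉ 𝔭) ∧
      ∀ x : PrimeSpectrum A, j ∉ x.asIdeal → x ∈ Algebra.smoothLocus k A := by
  have hnoe : IsNoetherianRing A := Algebra.FiniteType.isNoetherianRing k A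
  have hfp : Algebra.FinitePresentation k A := Algebra.FinitePresentation.of_finiteType.1 inferInstance
  have hopen := Algebra.isOpen_smoothLocus (R := k) (A := A)
  have hcl : IsClosed (Algebra.smoothLocus k A)ᶜ := hopen.isClosed_compl
  obtain ⟨K, hK⟩ := (PrimeSpectrum.isClosed_iff_zeroLocus_ideal _).1 hcl
  have hfin : (minimalPrimes A).Finite := minimalPrimes.finite_of_isNoetherianRing A
  have hav : ¬ (((J ⊓ K : Ideal A) : Set A) ⊆ ⋃ i ∈ minimalPrimes A, (i : Set A)) := by
    intro h
    obtain ⟨p, hp, hle⟩ := (Ideal.subset_union_prime_finite hfin (f := fun i => i) ⊥ ⊥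
      (fun i hi _ _ => hi.1.1)).1 h
    have hpp : p.IsPrime := hp.1.1
    rcases (hpp.inf_le).1 hle with h1 | h1
    · exact hJ p hp h1
    · have h2 : (⟨p, hpp⟩ : PrimeSpectrum A) ∈ (Algebra.smoothLocus k A)ᶜ := by
        rw [hK]
        exact h1
      exact h2 (smooth_of_minimal k p hp)
  rw [Set.not_subset] at hav
  obtain ⟨j, hj, hj2⟩ := hav
  refine ⟨j, hj.1, ?_, ?_⟩
  · intro p hp hjp
    exact hj2 (Set.mem_iUnion₂.2 ⟨p, hp, hjp⟩)
  · intro x hx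
    by_contra hns
    have : x ∈ (Algebra.smoothLocus k A)ᶜ := hns
    rw [hK] at this
    exact hx (this hj.2)

end ExJ


section Core

lemma pos_real (β c s t0 i σ : ℝ) (n : ℕ) (h1 : c * β + t0 = 1) (h2 : 1 ≤ σ + i)
    (hs : s = (2 * σ) ^ (2 * n)) :
    0 < β * (1 + s * (β * (1 + c ^ 2) * (β - 1) ^ 2)) +
      5 * (β - 1) ^ 2 * (t0 ^ 2 + (1 + β ^ 2) * i ^ 2) := by
  have hs0 : 0 ≤ s := by
    rw [hs, pow_mul]; positivity
  rcases lt_or_ge 0 β with hβ | hβ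
  · positivity
  have hb1 : 1 ≤ (β - 1) ^ 2 := by nlinarith
  have key : 0 ≤ s * (β ^ 2 * (1 + c ^ 2)) * (β - 1) ^ 2 := by positivity
  by_cases hi : 1 / 4 ≤ i ^ 2
  · have h5 : 5 * ((1 + β ^ 2) * (1 / 4)) ≤ 5 * (β - 1) ^ 2 * (t0 ^ 2 + (1 + β ^ 2) * i ^ 2) := by
      have : (1 + β ^ 2) * (1 / 4) ≤ (t0 ^ 2 + (1 + β ^ 2) * i ^ 2) := by
        nlinarith [sq_nonneg t0, sq_nonneg β]
      have h0 : 0 ≤ (1 + β ^ 2) * (1 / 4) := by positivity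
      nlinarith
    nlinarith [sq_nonneg β, sq_nonneg (β + 1)]
  · push Not at hi
    have hi2 : i < 1 / 2 := by nlinarith
    have hσ : 1 ≤ 2 * σ := by linarith
    have hs1 : 1 ≤ s := by rw [hs]; exact one_le_pow₀ hσ
    have k1 : β ^ 2 * (1 + c ^ 2) ≤ s * (β ^ 2 * (1 + c ^ 2)) * (β - 1) ^ 2 := by
      have h0 : 0 ≤ β ^ 2 * (1 + c ^ 2) := by positivity
      have h3 : 1 * 1 ≤ s * (β - 1) ^ 2 := mul_le_mul hs1 hb1 (by norm_num) hs0
      nlinarith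
    have k2 : 5 * t0 ^ 2 ≤ 5 * (β - 1) ^ 2 * (t0 ^ 2 + (1 + β ^ 2) * i ^ 2) := by
      have h3 : t0 ^ 2 ≤ t0 ^ 2 + (1 + β ^ 2) * i ^ 2 := by
        have : 0 ≤ (1 + β ^ 2) * i ^ 2 := by positivity
        linarith
      have h0 := sq_nonneg t0
      nlinarith
    have ht : t0 = 1 - c * β := by linarith
    have k3 : 0 < β + β ^ 2 * (1 + c ^ 2) + 5 * t0 ^ 2 := by
      rw [ht]
      nlinarith [sq_nonneg (β + 1 / 2), sq_nonneg (c * β - 5 / 6)]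
    nlinarith

lemma core_alg {S : Type*} [CommRing S] [Algebra ℝ S] (O : Ideal S)
    (a c t0' ψ0 j m h1 h1i i σ : S) (n : ℕ) (hh : h1 * h1i = 1) (hψ : h1 = ψ0 + j * m)
    (hψO : ψ0 ∈ O) (hca : c * a + t0' = 1) (ht0 : t0' ∈ O) (hi : i ∈ O)
    (hpos : ∀ ψ : S →ₐ[ℝ] ℝ, 1 ≤ ψ (σ + i))
    (hU : IsUnit (1 + (2 * σ) ^ (2 * n) * ((a + (1 - a) * ψ0 * h1i) * (1 + c ^ 2) *
      ((a + (1 - a) * ψ0 * h1i) - 1) ^ 2))) :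
    ∃ (U : Sˣ) (b t : S), (∀ ψ : S →ₐ[ℝ] ℝ, 0 < ψ b) ∧ b - U * a ∈ O ∧ t ∈ O ∧
      j ∣ t ∧ j ∣ b - 1 ∧ ∃ r, b * r + t = 1 := by
  obtain ⟨U, hU⟩ := hU
  set b1 := a + (1 - a) * ψ0 * h1i with hb1
  set s := (2 * σ) ^ (2 * n) with hs
  have hb1' : b1 - 1 = j * (-(1 - a) * m * h1i) := by
    rw [hb1]
    linear_combination (-(1 - a)) * h1i * hψ + (1 - a) * hh
  let t0 := 1 - c * b1
  have ht0O : t0 ∈ O := by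
    have : t0 = t0' - ψ0 * (c * (1 - a) * h1i) := by
      simp only [t0, hb1]; linear_combination -hca
    rw [this]
    exact O.sub_mem ht0 (O.mul_mem_right _ hψO)
  let w := 5 * (b1 - 1) ^ 2 * (t0 ^ 2 + (1 + b1 ^ 2) * i ^ 2)
  have hw : w ∈ O := by
    refine O.mul_mem_left _ (O.add_mem ?_ (O.mul_mem_left _ ?_))
    · rw [sq]; exact O.mul_mem_left _ ht0O
    · rw [sq]; exact O.mul_mem_left _ hi
  let b := b1 * U + w
  have hbm : b - 1 = (b1 - 1) * (1 + b1 * (s * (b1 * (1 + c ^ 2) * (b1 - 1))) +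
      5 * (b1 - 1) * (t0 ^ 2 + (1 + b1 ^ 2) * i ^ 2)) := by
    simp only [b, hU, w]; ring
  have hjb : j ∣ b - 1 := by
    rw [hbm, hb1']
    exact Dvd.dvd.mul_right (Dvd.intro _ rfl) _
  let c2 := c * (↑U⁻¹ : S)
  have hUU : (U : S) * (↑U⁻¹ : S) = 1 := U.mul_inv
  have ht2 : 1 - c2 * b ∈ O := by
    have : 1 - c2 * b = t0 - c2 * w := by
      simp only [c2, b, t0]; linear_combination (-c * b1) * hUU
    rw [this]
    exact O.sub_mem ht0O (O.mul_mem_left _ hw)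
  refine ⟨U, b, (1 - b) * (1 - c2 * b), ?_, ?_, O.mul_mem_left _ ht2, ?_, hjb,
    1 + c2 - c2 * b, by ring⟩
  · intro ψ
    have h1 : ψ c * ψ b1 + ψ t0 = 1 := by
      simp [t0]
    have h2 := hpos ψ
    rw [map_add] at h2
    have := pos_real (ψ b1) (ψ c) (ψ s) (ψ t0) (ψ i) (ψ σ) n h1 h2 (by rw [hs, map_pow, map_mul, map_ofNat])
    have h3 : ψ b = ψ b1 * (1 + ψ s * (ψ b1 * (1 + ψ c ^ 2) * (ψ b1 - 1) ^ 2)) +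
      5 * (ψ b1 - 1) ^ 2 * (ψ t0 ^ 2 + (1 + ψ b1 ^ 2) * ψ i ^ 2) := by
      simp only [b, hU, w]
      simp only [map_add, map_mul, map_sub, map_pow, map_one, map_ofNat]
    rw [h3]; exact this
  · have : b - U * a = ψ0 * (U * (1 - a) * h1i) + w := by
      simp only [b, hb1]; ring
    rw [this]
    exact O.add_mem (O.mul_mem_right _ hψO) hw
  · have : j ∣ 1 - b := by
      rw [← neg_sub]; exact (dvd_neg).2 hjb
    exact this.mul_right _

lemma bertini {k S : Type*} [Field k] [CharZero k] [CommRing S] [Algebra k S]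
    [Algebra.FinitePresentation k S] (b t : S)
    (hsm : ∀ x : PrimeSpectrum S, t ∉ x.asIdeal → x ∈ Algebra.smoothLocus k S) :
    ∃ Z : Set k, Z.Finite ∧ ∀ u ∉ Z, ∀ (q : Ideal S) [q.IsPrime], t ∉ q →
      ∀ s ∉ q, s * (b + algebraMap k S u * t ^ 2) ∉ q ^ 2 ∨ b + algebraMap k S u * t ^ 2 ∉ q := by
  let B := Localization.Away t
  have hfs : Algebra.FormallySmooth k B := by
    rw [← Algebra.basicOpen_subset_smoothLocus_iff]
    intro x hx
    exact hsm x hx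
  have : Algebra.FinitePresentation S B := IsLocalization.Away.finitePresentation t
  have : Algebra.FinitePresentation k B := .trans k S B
  have : Algebra.FiniteType k B := inferInstance
  let ti : B := IsLocalization.Away.invSelf t
  have hti : algebraMap S B t * ti = 1 := IsLocalization.Away.mul_invSelf t
  obtain ⟨Z, hZ, H⟩ := sard (k := k) (B := B) (algebraMap S B b * ti ^ 2)
  refine ⟨Z, hZ, fun u hu q hq htq s hs => ?_⟩
  by_contra hcon
  push Not at hcon
  obtain ⟨hc1, hc2⟩ := hcon
  have hdisj : Disjoint ((Submonoid.powers t : Submonoid S) : Set S) (q : Set S) := by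
    rw [Set.disjoint_left]
    rintro _ ⟨n, rfl⟩ hn
    exact htq (hq.mem_of_pow_mem _ hn)
  have hQ : (q.map (algebraMap S B)).IsPrime :=
    IsLocalization.isPrime_of_isPrime_disjoint (Submonoid.powers t) B q hq hdisj
  have hcm : (q.map (algebraMap S B)).comap (algebraMap S B) = q :=
    IsLocalization.under_map_of_isPrime_disjoint (Submonoid.powers t) B hq hdisj
  have hid : algebraMap S B b * ti ^ 2 + algebraMap k B u =
      algebraMap S B (b + algebraMap k S u * t ^ 2) * ti ^ 2 := by
    rw [map_add, map_mul, map_pow, ← IsScalarTower.algebraMap_apply]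
    linear_combination (-(algebraMap k B u)) * (algebraMap S B t * ti + 1) * hti
  refine H u hu (q.map (algebraMap S B)) ?_ (algebraMap S B s) ?_ ?_
  · rw [hid]
    exact Ideal.mul_mem_right _ _ (Ideal.mem_map_of_mem _ hc2)
  · intro h
    exact hs (by rw [← hcm]; exact h)
  · rw [hid, ← mul_assoc, ← map_mul, ← Ideal.map_pow]
    exact Ideal.mul_mem_right _ _ (Ideal.mem_map_of_mem _ hc1)

/-- The automorphism. -/
lemma exists_delta {S M : Type*} [CommRing S] [AddCommGroup M] [Module S M] (a : S) (p q : M)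
    (U : Sˣ) (l : M →ₗ[S] S) (b : S) (hb : b - U * a = l (p + a • q)) :
    ∃ Δ : (S × M) ≃ₗ[S] (S × M), Δ (a, p) = (b, (1 - b) • (p + a • q)) := by
  let e1 : M → ((S × M) ≃ₗ[S] (S × M)) := fun v =>
    { toFun := fun x => (x.1, x.2 + x.1 • v)
      invFun := fun x => (x.1, x.2 - x.1 • v)
      left_inv := fun x => by simp
      right_inv := fun x => by simp
      map_add' := fun x y => by
        ext
        · simp
        · simp [add_smul]; abel
      map_smul' := fun r x => by
        ext
        · simp
        · simp [smul_smul] }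
  let e2 : (S × M) ≃ₗ[S] (S × M) :=
    { toFun := fun x => (U * x.1 + l x.2, x.2)
      invFun := fun x => (↑U⁻¹ * (x.1 - l x.2), x.2)
      left_inv := fun x => by simp
      right_inv := fun x => by simp
      map_add' := fun x y => by
        ext
        · simp; ring
        · simp
      map_smul' := fun r x => by
        ext
        · simp; ring
        · simp }
  refine ⟨(e1 q).trans (e2.trans (e1 (-(p + a • q)))), ?_⟩
  have h1 : (U : S) * a + l (p + a • q) = b := by rw [← hb]; ring
  ext
  · simpa [e1, e2] using h1
  · have : (e1 (-(p + a • q))) (e2 ((e1 q) (a, p))) =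
      ((U : S) * a + l (p + a • q), p + a • q + ((U : S) * a + l (p + a • q)) • (-(p + a • q))) := rfl
    simp only [LinearEquiv.trans_apply, this, h1]
    rw [sub_smul, one_smul, smul_neg, sub_eq_add_neg]

end Core


section Final

lemma dim_loc {R S : Type*} [CommRing R] [CommRing S] [Algebra R S] (M : Submonoid R)
    [IsLocalization M S] : ringKrullDim S ≤ ringKrullDim R := by
  refine Order.krullDim_le_of_strictMono (PrimeSpectrum.comap (algebraMap R S)) ?_
  intro x y hxy
  refine lt_of_le_of_ne (fun z hz => hxy.le hz) fun he => ?_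
  exact hxy.ne (PrimeSpectrum.localization_comap_injective S M he)

/-- Values of functionals at an element. -/
def valIdeal (R : Type*) {P : Type*} [CommRing R] [AddCommGroup P] [Module R P] (p : P) :
    Ideal R := LinearMap.range (LinearMap.applyₗ (R := R) p : (P →ₗ[R] R) →ₗ[R] R)

lemma mem_valIdeal {R P : Type*} [CommRing R] [AddCommGroup P] [Module R P] (p : P) (x : R) :
    x ∈ valIdeal R p ↔ ∃ l : P →ₗ[R] R, l p = x := Iff.rfl

lemma val_loc {R P : Type*} [CommRing R] [AddCommGroup P] [Module R P] (M : Submonoid R)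
    (p : P) (x : R) (hx : x ∈ valIdeal R p) :
    algebraMap R (Localization M) x ∈
      valIdeal (Localization M) (LocalizedModule.mkLinearMap M P p) := by
  obtain ⟨l, rfl⟩ := (mem_valIdeal _ _).1 hx
  refine (mem_valIdeal _ _).2 ⟨IsLocalizedModule.mapExtendScalars M
    (LocalizedModule.mkLinearMap M P) (Algebra.linearMap R (Localization M)) (Localization M) l, ?_⟩
  rw [IsLocalizedModule.mapExtendScalars_apply_apply, IsLocalizedModule.map_apply]
  rfl

lemma general_position {A : Type*} [CommRing A] [Algebra ℝ A] [Algebra.FiniteType ℝ A]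
    {R P : Type*} [CommRing R] [Algebra ℝ R] [Algebra A R] (f : A) [IsLocalization.Away f R]
    [IsNoetherianRing R] [AddCommGroup P] [Module R P] [Module.Finite R P] [Module.Projective R P]
    (d : ℕ) (hdim : ringKrullDim A = d) (hrank : ∀ x, rankAt R P x = d - 1)
    (a : R) (p : P) (hum : IsUnimodular R ((a, p) : R × P))
    (j : A) (hj : ∀ 𝔭 ∈ minimalPrimes A, j ∉ 𝔭) :
    ∃ q : P, (∀ x : PrimeSpectrum R, valIdeal R (p + a • q) ≤ x.asIdeal → wt A x ≤ 1) ∧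
      (∀ x : PrimeSpectrum R, valIdeal R (p + a • q) ⊔ Ideal.span {algebraMap A R j} ≤ x.asIdeal →
        wt A x ≤ 0) := by
  obtain ⟨q, hq⟩ := ee_main ℝ (d - 1) hrank a p hum (wt A) (wt_lt_wt f hdim) (ι := Bool)
    (fun b => if b then ⊥ else Ideal.span {algebraMap A R j}) (fun b => if b then 1 else 0) (by
      rintro (_ | _) x hx
      · have hjx : j ∈ (PrimeSpectrum.comap (algebraMap A R) x).asIdeal :=
          hx (Ideal.mem_span_singleton_self _)
        obtain ⟨m, hm, hmx⟩ := Ideal.exists_minimalPrimes_le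
          (I := ⊥) (J := (PrimeSpectrum.comap (algebraMap A R) x).asIdeal) bot_le
        have hlt : (⟨m, hm.1.1⟩ : PrimeSpectrum A) < PrimeSpectrum.comap (algebraMap A R) x := by
          refine lt_of_le_of_ne hmx ?_
          intro he
          apply hj m hm
          rw [← he] at hjx
          exact hjx
        have h1 := Order.coheight_add_one_le hlt
        have h2 := h1.trans (coheight_lt_top' hdim _)
        rw [coheight_eq_wt hdim] at h2
        have h3 : wt A x + 1 ≤ d := by exact_mod_cast h2
        simp
        omega
      · have := wt_le hdim x
        simp
        omega)
  refine ⟨q, fun x hx => ?_, fun x hx => ?_⟩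
  · exact hq true x (by simp) fun l => hx ((mem_valIdeal _ _).2 ⟨l, rfl⟩)
  · exact hq false x (by simpa using le_sup_right.trans hx) fun l =>
      hx (Ideal.mem_sup_left ((mem_valIdeal _ _).2 ⟨l, rfl⟩))

end Final


section Finish

lemma finish_up {A R S M : Type*} [CommRing A] [Algebra ℝ A] [Algebra.FiniteType ℝ A]
    [CommRing R] [CommRing S] [Algebra A R] [Algebra ℝ R] [IsScalarTower ℝ A R]
    [Algebra R S] [Algebra A S] [IsScalarTower A R S] [Algebra ℝ S] [IsScalarTower ℝ R S]
    (f : A) (h : R) [IsLocalization.Away f R] [IsLocalization.Away h S]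
    [AddCommGroup M] [Module S M] (d : ℕ) (hdim : ringKrullDim A = d) (J : Ideal A) (j : A)
    (hjJ : j ∈ J) (hjs : ∀ x : PrimeSpectrum A, j ∉ x.asIdeal → x ∈ Algebra.smoothLocus ℝ A)
    (a : S) (p q : M) (U : Sˣ) (b t : S) (hb0 : ∀ ψ : S →ₐ[ℝ] ℝ, 0 < ψ b)
    (hbO : b - U * a ∈ valIdeal S (p + a • q)) (htO : t ∈ valIdeal S (p + a • q))
    (hjt : algebraMap A S j ∣ t) (hjb : algebraMap A S j ∣ b - 1) (hr : ∃ r, b * r + t = 1) :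
    ∃ Δ : (S × M) ≃ₗ[S] (S × M),
      (∀ ψ : S →ₐ[ℝ] ℝ, 0 < ψ (Δ (a, p)).1) ∧
      (∀ 𝔮 : PrimeSpectrum (S ⧸ Ideal.span {(Δ (a, p)).1}),
          IsRegularLocal (Localization.AtPrime 𝔮.asIdeal) ∧
            ringKrullDim (Localization.AtPrime 𝔮.asIdeal) ≤ ((d - 1 : ℕ) : WithBot ℕ∞)) ∧
      (Δ (a, p)).1 - 1 ∈ J.map (algebraMap A S) ∧
      (Δ (a, p)).2 ∈ (J.map (algebraMap A S)) • (⊤ : Submodule S M) := by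
  have : Algebra.FinitePresentation ℝ A := Algebra.FinitePresentation.of_finiteType.1 inferInstance
  have : Algebra.FinitePresentation A R := IsLocalization.Away.finitePresentation f
  have : Algebra.FinitePresentation ℝ R := .trans ℝ A R
  have : Algebra.FinitePresentation R S := IsLocalization.Away.finitePresentation h
  have : Algebra.FinitePresentation ℝ S := .trans ℝ R S
  have hdS : ringKrullDim S ≤ d := by
    rw [← hdim]
    exact (dim_loc (Submonoid.powers h)).trans (dim_loc (Submonoid.powers f))
  have hsm : ∀ x : PrimeSpectrum S, algebraMap A S j ∉ x.asIdeal → x ∈ Algebra.smoothLocus ℝ S := by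
    intro x hx
    rw [← Algebra.smoothLocus_comap_of_isLocalization (R := ℝ) (A := R) (Af := S) h]
    rw [← Algebra.smoothLocus_comap_of_isLocalization (R := ℝ) (A := A) (Af := R) f]
    refine hjs _ ?_
    intro hmem
    apply hx
    rw [IsScalarTower.algebraMap_apply A R S]
    exact hmem
  have hsmt : ∀ x : PrimeSpectrum S, t ∉ x.asIdeal → x ∈ Algebra.smoothLocus ℝ S := by
    intro x hx
    refine hsm x fun hj => hx ?_
    obtain ⟨y, rfl⟩ := hjt
    exact Ideal.mul_mem_right _ _ hj
  obtain ⟨Z, hZ, H⟩ := bertini (k := ℝ) b t hsmt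
  obtain ⟨u, hu0, huZ⟩ : ∃ u : ℝ, 0 < u ∧ u ∉ Z := by
    obtain ⟨u, hu, hu2⟩ := (Set.Ioi_infinite (0 : ℝ)).exists_notMem_finite hZ
    exact ⟨u, hu, hu2⟩
  set b3 := b + algebraMap ℝ S u * t ^ 2 with hb3
  have hb3O : b3 - U * a ∈ valIdeal S (p + a • q) := by
    have : b3 - U * a = (b - U * a) + (algebraMap ℝ S u * t) * t := by rw [hb3]; ring
    rw [this]
    exact Ideal.add_mem _ hbO (Ideal.mul_mem_left _ _ htO)
  obtain ⟨l, hl⟩ := (mem_valIdeal _ _).1 hb3O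
  obtain ⟨Δ, hΔ⟩ := exists_delta a p q U l b3 hl.symm
  have hjb3 : b3 - 1 ∈ J.map (algebraMap A S) := by
    have : algebraMap A S j ∣ b3 - 1 := by
      have h2 : b3 - 1 = (b - 1) + t * (algebraMap ℝ S u * t) := by rw [hb3]; ring
      rw [h2]
      exact dvd_add hjb (hjt.mul_right _)
    exact Ideal.mem_of_dvd _ this (Ideal.mem_map_of_mem _ hjJ)
  refine ⟨Δ, ?_⟩
  rw [hΔ]
  refine ⟨fun ψ => ?_, fun 𝔮 => ?_, hjb3, ?_⟩
  · have h1 : ψ b3 = ψ b + u * ψ t ^ 2 := by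
      rw [hb3, map_add, map_mul, map_pow, AlgHom.commutes]; rfl
    change 0 < ψ b3
    rw [h1]
    have := hb0 ψ
    positivity
  · refine reg_hyper ℝ b3 d hdS ?_ 𝔮
    intro Q hQ hbQ
    have htQ : t ∉ Q := by
      intro ht
      have hbm : b ∈ Q := by
        have : b = b3 - (algebraMap ℝ S u * t) * t := by rw [hb3]; ring
        rw [this]
        exact Q.sub_mem hbQ (Q.mul_mem_left _ ht)
      obtain ⟨r, hr⟩ := hr
      apply hQ.ne_top
      rw [Ideal.eq_top_iff_one, ← hr]
      exact Q.add_mem (Q.mul_mem_right _ hbm) ht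
    refine ⟨hsmt ⟨Q, hQ⟩ htQ, fun s hs => ?_⟩
    rcases H u huZ Q htQ s hs with h1 | h1
    · exact h1
    · exact absurd hbQ h1
  · have : 1 - b3 ∈ J.map (algebraMap A S) := by
      rw [← neg_sub]; exact Ideal.neg_mem_iff _ |>.2 hjb3
    exact Submodule.smul_mem_smul this trivial

lemma stage_one {A : Type*} [CommRing A] [Algebra ℝ A] [Algebra.FiniteType ℝ A] [IsReduced A]
    (d : ℕ) (hdim : ringKrullDim A = d)
    (J : Ideal A) (hJ : ∀ 𝔭 ∈ minimalPrimes A, ¬ J ≤ 𝔭)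
    (f : A) (hf : ∀ φ : A →ₐ[ℝ] ℝ, φ f ≠ 0)
    {R P : Type*} [CommRing R] [Algebra ℝ R] [Algebra A R] [IsLocalization.Away f R]
    [AddCommGroup P] [Module R P] [Module.Finite R P] [Module.Projective R P]
    (hrank : ∀ x, rankAt R P x = d - 1)
    (a : R) (p : P) (hum : IsUnimodular R ((a, p) : R × P)) :
    ∃ (j g i h1 h2 : A) (q : P) (c ψ0 m : R) (n : ℕ), (∃ x, h1 * h2 = 1 + f * x) ∧ j ∈ J ∧
      (∀ x : PrimeSpectrum A, j ∉ x.asIdeal → x ∈ Algebra.smoothLocus ℝ A) ∧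
      algebraMap A R i ∈ valIdeal R (p + a • q) ∧ (∀ φ : A →ₐ[ℝ] ℝ, 1 ≤ φ (f * g + i)) ∧
      ψ0 ∈ valIdeal R (p + a • q) ∧ 1 - c * a ∈ valIdeal R (p + a • q) ∧
      algebraMap A R h1 = ψ0 + algebraMap A R j * m ∧
      algebraMap A R h2 = algebraMap A R h1 ^ 3 + (2 * algebraMap A R (f * g)) ^ (2 * n) *
        ((a * algebraMap A R h1 + (1 - a) * ψ0) * (1 + c ^ 2) *
          ((a * algebraMap A R h1 + (1 - a) * ψ0) - algebraMap A R h1) ^ 2) := by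
  have hnA : IsNoetherianRing A := Algebra.FiniteType.isNoetherianRing ℝ A
  have hnR : IsNoetherianRing R :=
    IsLocalization.isNoetherianRing (Submonoid.powers f) _ hnA
  obtain ⟨j, hjJ, hjm, hjs⟩ := exists_j ℝ J hJ
  obtain ⟨q, hq1, hq2⟩ := general_position f d hdim hrank a p hum j hjm
  obtain ⟨g, i, hiO, hgi⟩ := exists_sigma f hf hdim _ hq1
  obtain ⟨y, hy⟩ := exists_h1 f hdim _ hq2
  obtain ⟨ψ0, hψ0, z, hz, hψz⟩ := Submodule.mem_sup.1 hy
  obtain ⟨m, rfl⟩ := Ideal.mem_span_singleton'.1 hz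
  obtain ⟨ψ, hψ⟩ := hum
  obtain ⟨c, hc⟩ : ∃ c : R, 1 - c * a ∈ valIdeal R (p + a • q) := by
    refine ⟨ψ (1, 0) - ψ (0, q), (mem_valIdeal _ _).2 ⟨ψ ∘ₗ LinearMap.inr R R P, ?_⟩⟩
    have h1 : ((a, p) : R × P) = a • (1, 0) + (0, p) := by simp
    have h2 : ((0, p + a • q) : R × P) = (0, p) + a • (0, q) := by simp
    rw [h1, map_add, map_smul] at hψ
    rw [LinearMap.comp_apply, LinearMap.inr_apply, h2, map_add, map_smul]
    simp only [smul_eq_mul] at hψ ⊢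
    linear_combination hψ
  obtain ⟨⟨e, ⟨_, k, rfl⟩⟩, he⟩ := IsLocalization.surj (Submonoid.powers f)
    ((a * algebraMap A R (1 + f * y) + (1 - a) * ψ0) * (1 + c ^ 2) *
      ((a * algebraMap A R (1 + f * y) + (1 - a) * ψ0) - algebraMap A R (1 + f * y)) ^ 2)
  refine ⟨j, g, i, 1 + f * y,
    (1 + f * y) ^ 3 + f * ((2 * g) ^ (2 * (k + 1)) * f ^ (k + 1) * e), q, c, ψ0, m, k + 1,
    ⟨y + (1 + f * y) * (3 * y + 3 * f * y ^ 2 + f ^ 2 * y ^ 3 +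
    ((2 * g) ^ (2 * (k + 1)) * f ^ (k + 1) * e)), by ring⟩, hjJ, hjs, hiO, hgi, hψ0, hc,
    by rw [← hψz, mul_comm m], ?_⟩
  rw [map_add, map_pow, ← sub_eq_iff_eq_add', add_sub_cancel_left]
  generalize ((a * algebraMap A R (1 + f * y) + (1 - a) * ψ0) * (1 + c ^ 2) *
      ((a * algebraMap A R (1 + f * y) + (1 - a) * ψ0) - algebraMap A R (1 + f * y)) ^ 2) = E at he ⊢
  simp only [map_mul, map_pow, map_ofNat] at he ⊢
  rw [← he]
  ring

lemma stage_two {A : Type*} [CommRing A] [Algebra ℝ A]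
    {R S : Type*} [CommRing R] [Algebra ℝ R] [Algebra A R] [IsScalarTower ℝ A R]
    [CommRing S] [Algebra ℝ S] [Algebra R S] [IsScalarTower ℝ R S] [Algebra A S]
    [IsScalarTower A R S]
    (f j g i h1 h2 : A) (a c ψ0 m : R) (n : ℕ) (OR : Ideal R) (O : Ideal S)
    (hO : ∀ x ∈ OR, algebraMap R S x ∈ O)
    (hh : IsUnit (algebraMap R S (algebraMap A R (h1 * h2))))
    (hiO : algebraMap A R i ∈ OR) (hgi : ∀ φ : A →ₐ[ℝ] ℝ, 1 ≤ φ (f * g + i))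
    (hψ0 : ψ0 ∈ OR) (hc : 1 - c * a ∈ OR)
    (hh1 : algebraMap A R h1 = ψ0 + algebraMap A R j * m)
    (hh2 : algebraMap A R h2 = algebraMap A R h1 ^ 3 + (2 * algebraMap A R (f * g)) ^ (2 * n) *
        ((a * algebraMap A R h1 + (1 - a) * ψ0) * (1 + c ^ 2) *
          ((a * algebraMap A R h1 + (1 - a) * ψ0) - algebraMap A R h1) ^ 2)) :
    ∃ (U : Sˣ) (b t : S), (∀ ψ : S →ₐ[ℝ] ℝ, 0 < ψ b) ∧ b - U * algebraMap R S a ∈ O ∧ t ∈ O ∧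
      algebraMap A S j ∣ t ∧ algebraMap A S j ∣ b - 1 ∧ ∃ r, b * r + t = 1 := by
  rw [map_mul, map_mul] at hh
  have hu1 := isUnit_of_mul_isUnit_left hh
  have hu2 := isUnit_of_mul_isUnit_right hh
  obtain ⟨h1i, hi1⟩ := hu1.exists_right_inv
  have hU : algebraMap R S (algebraMap A R h2) = algebraMap R S (algebraMap A R h1) ^ 3 *
      (1 + (2 * algebraMap A S (f * g)) ^ (2 * n) *
      ((algebraMap R S a + (1 - algebraMap R S a) * algebraMap R S ψ0 * h1i) *
        (1 + algebraMap R S c ^ 2) *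
      ((algebraMap R S a + (1 - algebraMap R S a) * algebraMap R S ψ0 * h1i) - 1) ^ 2)) := by
    rw [hh2, IsScalarTower.algebraMap_apply A R S (f * g)]
    simp only [map_mul, map_add, map_sub, map_pow, map_one, map_ofNat]
    generalize (2 * (algebraMap R S (algebraMap A R f) * algebraMap R S (algebraMap A R g))) ^ (2 * n)
      = s
    generalize algebraMap R S (algebraMap A R h1) = H at hi1 ⊢
    have hb : algebraMap R S a * H + (1 - algebraMap R S a) * algebraMap R S ψ0 =
        H * (algebraMap R S a + (1 - algebraMap R S a) * algebraMap R S ψ0 * h1i) := by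
      linear_combination (-(1 - algebraMap R S a) * algebraMap R S ψ0) * hi1
    rw [hb]
    ring
  rw [hU] at hu2
  refine core_alg O (algebraMap R S a) (algebraMap R S c) (algebraMap R S (1 - c * a))
    (algebraMap R S ψ0) (algebraMap A S j) (algebraMap R S m) (algebraMap R S (algebraMap A R h1))
    h1i (algebraMap A S i) (algebraMap A S (f * g)) n hi1 ?_ (hO _ hψ0) ?_ (hO _ hc) ?_ ?_
    (isUnit_of_mul_isUnit_right hu2)
  · rw [hh1, map_add, map_mul, ← IsScalarTower.algebraMap_apply A R S]
  · rw [map_sub, map_mul, map_one]; ring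
  · rw [IsScalarTower.algebraMap_apply A R S]
    exact hO _ hiO
  · intro ψ
    have := hgi ((ψ.comp (IsScalarTower.toAlgHom ℝ R S)).comp (IsScalarTower.toAlgHom ℝ A R))
    rw [← map_add, IsScalarTower.algebraMap_apply A R S]
    exact this

lemma val_loc_add {R P : Type*} [CommRing R] [AddCommGroup P] [Module R P] (M : Submonoid R)
    (p q : P) (a x : R) (hx : x ∈ valIdeal R (p + a • q)) :
    algebraMap R (Localization M) x ∈
      valIdeal (Localization M) (LocalizedModule.mkLinearMap M P p +
        algebraMap R (Localization M) a • LocalizedModule.mkLinearMap M P q) := by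
  have := val_loc M _ x hx
  rwa [map_add, map_smul, ← algebraMap_smul (Localization M) a] at this

end Finish


set_option maxSynthPendingDepth 3 in
/-- Let `A` be a reduced affine `ℝ`-algebra of dimension `d` (real points of `X = Spec A`
being identified with the `ℝ`-algebra homomorphisms `A → ℝ`), `J` an ideal of height `≥ 1`
(i.e. contained in no minimal prime), `f ∈ A` not belonging to any real maximal ideal, `P` a
finitely generated projective `A_f`-module of rank `d - 1` and `(a, p) ∈ Um(A_f ⊕ P)`.  Then
there are `h ∈ 1 + fA` and an automorphism `Δ` of `A_{fh} ⊕ P_{fh}` such that, writing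
`(a, p)Δ = (b, p')`: (1) `b > 0` on `X(ℝ) ∩ Spec A_{fh}`; (2) `Z(b)` is smooth over
`Spec A_{fh}` of dimension `≤ d - 1`; (3) `(b, p') ≡ (1, 0) (mod J·A_{fh})`.
(Here `A_{fh}` is realized as the localization of `A_f` away from the image of `h`, and
`P_{fh}` as the corresponding localization of `P`.) -/
theorem good_position_over_localization
    (A : Type*) [CommRing A] [Algebra ℝ A] [Algebra.FiniteType ℝ A] [IsReduced A]
    (d : ℕ) (hdim : ringKrullDim A = d)
    (J : Ideal A) (hJ : ∀ 𝔭 ∈ minimalPrimes A, ¬ J ≤ 𝔭)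
    (f : A) (hf : ∀ φ : A →ₐ[ℝ] ℝ, φ f ≠ 0)
    (P : Type*) [AddCommGroup P] [Module (Localization.Away f) P]
    [Module.Finite (Localization.Away f) P] [Module.Projective (Localization.Away f) P]
    (hrank : ∀ 𝔭 : PrimeSpectrum (Localization.Away f), rankAt (Localization.Away f) P 𝔭 = d - 1)
    (a : Localization.Away f) (p : P)
    (hum : IsUnimodular (Localization.Away f) ((a, p) : Localization.Away f × P)) :
    ∃ h : A, (∃ x : A, h = 1 + f * x) ∧
      ∃ Δ : (Localization (Submonoid.powers (algebraMap A (Localization.Away f) h)) × LocalizedModule (Submonoid.powers (algebraMap A (Localization.Away f) h)) P) ≃ₗ[Localization (Submonoid.powers (algebraMap A (Localization.Away f) h))] (Localization (Submonoid.powers (algebraMap A (Localization.Away f) h)) × LocalizedModule (Submonoid.powers (algebraMap A (Localization.Away f) h)) P),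
        (∀ ψ : (Localization (Submonoid.powers (algebraMap A (Localization.Away f) h))) →ₐ[ℝ] ℝ,
          0 < ψ (Δ (algebraMap (Localization.Away f) (Localization (Submonoid.powers (algebraMap A (Localization.Away f) h))) a, LocalizedModule.mkLinearMap (Submonoid.powers (algebraMap A (Localization.Away f) h)) P p)).1) ∧
        (∀ 𝔮 : PrimeSpectrum ((Localization (Submonoid.powers (algebraMap A (Localization.Away f) h))) ⧸ Ideal.span {(Δ (algebraMap (Localization.Away f) (Localization (Submonoid.powers (algebraMap A (Localization.Away f) h))) a, LocalizedModule.mkLinearMap (Submonoid.powers (algebraMap A (Localization.Away f) h)) P p)).1}),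
          IsRegularLocal (Localization.AtPrime 𝔮.asIdeal) ∧
            ringKrullDim (Localization.AtPrime 𝔮.asIdeal) ≤ ((d - 1 : ℕ) : WithBot ℕ∞)) ∧
        (Δ (algebraMap (Localization.Away f) (Localization (Submonoid.powers (algebraMap A (Localization.Away f) h))) a, LocalizedModule.mkLinearMap (Submonoid.powers (algebraMap A (Localization.Away f) h)) P p)).1 - 1
            ∈ J.map (algebraMap A (Localization (Submonoid.powers (algebraMap A (Localization.Away f) h)))) ∧
        (Δ (algebraMap (Localization.Away f) (Localization (Submonoid.powers (algebraMap A (Localization.Away f) h))) a, LocalizedModule.mkLinearMap (Submonoid.powers (algebraMap A (Localization.Away f) h)) P p)).2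
            ∈ (J.map (algebraMap A (Localization (Submonoid.powers (algebraMap A (Localization.Away f) h))))) • (⊤ : Submodule (Localization (Submonoid.powers (algebraMap A (Localization.Away f) h))) (LocalizedModule (Submonoid.powers (algebraMap A (Localization.Away f) h)) P)) := by
  obtain ⟨j, g, i, h1, h2, q, c, ψ0, m, n, hx, hjJ, hjs, hiO, hgi, hψ0, hc, hh1, hh2⟩ :=
    stage_one d hdim J hJ f hf hrank a p hum
  refine ⟨h1 * h2, hx, ?_⟩
  have hval := val_loc_add (Submonoid.powers (algebraMap A (Localization.Away f) (h1 * h2))) p q a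
  obtain ⟨U, b, t, hb0, hbO, htO, hjt, hjb, hr⟩ := stage_two f j g i h1 h2 a c ψ0 m n _ _ hval
    (IsLocalization.map_units (Localization (Submonoid.powers
      (algebraMap A (Localization.Away f) (h1 * h2)))) (⟨_, Submonoid.mem_powers _⟩ :
        Submonoid.powers (algebraMap A (Localization.Away f) (h1 * h2))))
    hiO hgi hψ0 hc hh1 hh2
  exact finish_up f (algebraMap A (Localization.Away f) (h1 * h2)) d hdim J j hjJ hjs
    _ _ _ U b t hb0 hbO htO hjt hjb hr
end
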